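/- Let A be a basic indecomposable artin algebra and Γ a cycle-finite infinite connected component of the cyclic quiver _cΓ_A, lying in a component C of Γ_A. Then the left stable part _lC or the right stable part _rC of C admits a connected component D containing an oriented cycle and infinitely many modules of Γ. -/

import Mathlib

/-!
Common framework: finite length modules over a ring, the radical of the module
category, cycles of indecomposable modules, Auslander-Reiten quivers,
translation quivers notions, and classes of artin algebras.
Right `A`-modules are formalized as left `Aᵐᵒᵖ`-modules.
-/

universe u

/-- A bundled object of `mod R`: a finite length `R`-module. -/
structure ModA (R : Type u) [Ring R] : Type (u + 1) where
  M : Type u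
  [acg : AddCommGroup M]
  [mod : Module R M]
  finLen : IsFiniteLength R M

attribute [instance] ModA.acg ModA.mod

/-- A bundled (not necessarily finite length) `R`-module. -/
structure RawMod (R : Type u) [Ring R] : Type (u + 1) where
  M : Type u
  [acg : AddCommGroup M]
  [mod : Module R M]

attribute [instance] RawMod.acg RawMod.mod

/-- A module is indecomposable iff it is nonzero and its endomorphism ring has no
nontrivial idempotents. -/
def IsIndecMod (R : Type u) [Ring R] (M : Type u) [AddCommGroup M] [Module R M] : Prop :=
  Nontrivial M ∧ ∀ f : Module.End R M, f * f = f → f = 0 ∨ f = 1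

namespace ModA

variable {R : Type u} [Ring R]

/-- Indecomposability of an object of `mod R`. -/
def IsIndec (X : ModA R) : Prop := IsIndecMod R X.M

/-- Isomorphism of objects of `mod R`. -/
def Iso (X Y : ModA R) : Prop := Nonempty (X.M ≃ₗ[R] Y.M)

end ModA

/-- Membership in the radical `rad(X, Y)` of the category `mod R`: a map `f : X → Y`
belongs to the radical iff for every indecomposable `Z` and all `g : Z → X`, `h : Y → Z`
the composite `h ∘ f ∘ g` is not an isomorphism. -/
def InRad {R : Type u} [Ring R] {X Y : ModA R} (f : X.M →ₗ[R] Y.M) : Prop :=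
  ∀ Z : ModA R, Z.IsIndec → ∀ (g : Z.M →ₗ[R] X.M) (h : Y.M →ₗ[R] Z.M),
    ¬Function.Bijective (h.comp (f.comp g))

/-- The powers `rad^n` of the radical of `mod R`. -/
def radPow (R : Type u) [Ring R] : ℕ → ∀ X Y : ModA R, AddSubgroup (X.M →ₗ[R] Y.M)
  | 0, _, _ => ⊤
  | n + 1, X, Y => AddSubgroup.closure
      {f | ∃ (Z : ModA R) (g : X.M →ₗ[R] Z.M) (h : Z.M →ₗ[R] Y.M),
        InRad g ∧ h ∈ radPow R n Z Y ∧ f = h.comp g}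

/-- Membership in the infinite radical `rad^∞ = ⋂ₙ radⁿ` of `mod R`. -/
def InRadInf {R : Type u} [Ring R] {X Y : ModA R} (f : X.M →ₗ[R] Y.M) : Prop :=
  ∀ n : ℕ, f ∈ radPow R n X Y

/-- A cycle in `ind R`: a sequence of nonzero nonisomorphisms
`M₀ → M₁ → ⋯ → M_{r-1} → M_r = M₀` between indecomposable modules. -/
structure ModCycle (R : Type u) [Ring R] : Type (u + 1) where
  len : ℕ
  len_pos : 0 < len
  obj : Fin (len + 1) → ModA R
  obj_indec : ∀ i, (obj i).IsIndec
  closed : obj (Fin.last len) = obj 0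
  hom : ∀ i : Fin len, (obj i.castSucc).M →ₗ[R] (obj i.succ).M
  hom_ne_zero : ∀ i, hom i ≠ 0
  hom_not_iso : ∀ i, ¬Function.Bijective (hom i)

/-- A cycle is finite if none of its homomorphisms lies in the infinite radical. -/
def ModCycle.IsFiniteCycle {R : Type u} [Ring R] (c : ModCycle R) : Prop :=
  ∀ i, ¬InRadInf (c.hom i)

/-- The cycle passes through the module `M`. -/
def ModCycle.Passes {R : Type u} [Ring R] (c : ModCycle R) (M : ModA R) : Prop :=
  ∃ i, (c.obj i).Iso M

/-- A module is cycle-finite if it lies on a cycle and every cycle through it is finite. -/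
def IsCycleFiniteModule {R : Type u} [Ring R] (M : ModA R) : Prop :=
  (∃ c : ModCycle R, c.Passes M) ∧ ∀ c : ModCycle R, c.Passes M → c.IsFiniteCycle

/-- A module is directing if it lies on no cycle. -/
def IsDirectingModule {R : Type u} [Ring R] (M : ModA R) : Prop :=
  ¬∃ c : ModCycle R, c.Passes M

section Irreducible

variable {R : Type u} [Ring R]

/-- `f` is a split monomorphism (a section). -/
def SplitMonoMap {X Y : ModA R} (f : X.M →ₗ[R] Y.M) : Prop :=
  ∃ r : Y.M →ₗ[R] X.M, r.comp f = LinearMap.id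

/-- `f` is a split epimorphism (a retraction). -/
def SplitEpiMap {X Y : ModA R} (f : X.M →ₗ[R] Y.M) : Prop :=
  ∃ s : Y.M →ₗ[R] X.M, f.comp s = LinearMap.id

/-- `f` is an irreducible homomorphism. -/
def IsIrred {X Y : ModA R} (f : X.M →ₗ[R] Y.M) : Prop :=
  ¬SplitMonoMap f ∧ ¬SplitEpiMap f ∧
    ∀ (Z : ModA R) (g : X.M →ₗ[R] Z.M) (h : Z.M →ₗ[R] Y.M), h.comp g = f →
      SplitMonoMap g ∨ SplitEpiMap h

end Irreducible

/-- An almost split (Auslander-Reiten) sequence `0 → l → m → r → 0` in `mod R`. -/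
structure AlmostSplitSeq (R : Type u) [Ring R] : Type (u + 1) where
  l : ModA R
  m : ModA R
  r : ModA R
  f : l.M →ₗ[R] m.M
  g : m.M →ₗ[R] r.M
  inj : Function.Injective f
  surj : Function.Surjective g
  exact : LinearMap.range f = LinearMap.ker g
  not_split : ¬SplitEpiMap g
  l_indec : l.IsIndec
  r_indec : r.IsIndec
  right_almost : ∀ (Z : ModA R) (h : Z.M →ₗ[R] r.M), ¬SplitEpiMap h →
      ∃ h' : Z.M →ₗ[R] m.M, g.comp h' = h
  left_almost : ∀ (Z : ModA R) (h : l.M →ₗ[R] Z.M), ¬SplitMonoMap h →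
      ∃ h' : m.M →ₗ[R] Z.M, h'.comp f = h

/-- `N ≅ τ M` for the Auslander-Reiten translation `τ = DTr`. -/
def IsTauOf {R : Type u} [Ring R] (N M : ModA R) : Prop :=
  ∃ s : AlmostSplitSeq R, s.l.Iso N ∧ s.r.Iso M

/-- The indecomposable objects of `mod R`. -/
def IndecModA (R : Type u) [Ring R] := {X : ModA R // X.IsIndec}

/-- Isomorphism is an equivalence relation on indecomposable modules. -/
def isoSetoid (R : Type u) [Ring R] : Setoid (IndecModA R) where
  r X Y := X.1.Iso Y.1
  iseqv :=
    { refl := fun X => ⟨LinearEquiv.refl R X.1.M⟩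
      symm := fun h => h.elim fun e => ⟨e.symm⟩
      trans := fun h h' => h.elim fun e => h'.elim fun e' => ⟨e.trans e'⟩ }

/-- The vertices of the Auslander-Reiten quiver `Γ_R`: isomorphism classes of
indecomposable modules in `mod R`. -/
def ARVertex (R : Type u) [Ring R] := Quotient (isoSetoid R)

/-- The vertex of `Γ_R` given by an indecomposable module. -/
def ARVertex.mk {R : Type u} [Ring R] (X : IndecModA R) : ARVertex R :=
  Quotient.mk (isoSetoid R) X

section ARQuiver

variable {R : Type u} [Ring R]

/-- The arrows of the Auslander-Reiten quiver: `x → y` iff there is an irreducible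
homomorphism between representatives. -/
def ARArrow (x y : ARVertex R) : Prop :=
  ∃ (X Y : IndecModA R) (f : X.1.M →ₗ[R] Y.1.M),
    IsIrred f ∧ ARVertex.mk X = x ∧ ARVertex.mk Y = y

/-- `TauRel x y` iff `x = τ y` in the Auslander-Reiten quiver. -/
def TauRel (x y : ARVertex R) : Prop :=
  ∃ X Y : IndecModA R, ARVertex.mk X = x ∧ ARVertex.mk Y = y ∧ IsTauOf X.1 Y.1

/-- A vertex given by an (indecomposable) projective module. -/
def IsProjVertex (x : ARVertex R) : Prop :=
  ∃ X : IndecModA R, ARVertex.mk X = x ∧ Module.Projective R X.1.M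

/-- A vertex given by an (indecomposable) injective module. -/
def IsInjVertex (x : ARVertex R) : Prop :=
  ∃ X : IndecModA R, ARVertex.mk X = x ∧ Module.Injective R X.1.M

/-- The vertex lies on an oriented cycle of `Γ_R`. -/
def OnARCycle (x : ARVertex R) : Prop := Relation.TransGen ARArrow x x

/-- An edge (arrow in either direction) of the underlying graph of `Γ_R`. -/
def ARStep (x y : ARVertex R) : Prop := ARArrow x y ∨ ARArrow y x

/-- `D` is a connected component of the full subquiver of `Γ_R` on the vertex set `S`. -/
def IsComponentOf (S D : Set (ARVertex R)) : Prop :=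
  D ⊆ S ∧ D.Nonempty ∧
    (∀ x ∈ D, ∀ y ∈ S, ARStep x y → y ∈ D) ∧
    ∀ x ∈ D, ∀ y ∈ D, Relation.ReflTransGen (fun a b => a ∈ S ∧ b ∈ S ∧ ARStep a b) x y

/-- `C` is a connected component of `Γ_R`. -/
def IsARComponent (C : Set (ARVertex R)) : Prop := IsComponentOf Set.univ C

/-- The vertex lies on an oriented cycle all of whose vertices belong to `S`. -/
def OnCycleIn (S : Set (ARVertex R)) (x : ARVertex R) : Prop :=
  Relation.TransGen (fun a b => a ∈ S ∧ b ∈ S ∧ ARArrow a b) x x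

/-- `Γ` is a connected component of the cyclic quiver `_cΓ_R` (a cyclic component). -/
def IsCyclicComponent (Γ : Set (ARVertex R)) : Prop :=
  IsComponentOf {x | OnARCycle x} Γ

/-- A vertex represented by a cycle-finite module. -/
def IsCycleFiniteVertex (x : ARVertex R) : Prop :=
  ∃ X : IndecModA R, ARVertex.mk X = x ∧ IsCycleFiniteModule X.1

/-- A vertex represented by a directing module. -/
def IsDirectingVertex (x : ARVertex R) : Prop :=
  ∃ X : IndecModA R, ARVertex.mk X = x ∧ IsDirectingModule X.1

/-- A cycle-finite cyclic component: a cyclic component containing a cycle-finite module. -/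
def IsCycleFiniteCyclicComponent (Γ : Set (ARVertex R)) : Prop :=
  IsCyclicComponent Γ ∧ ∃ x ∈ Γ, IsCycleFiniteVertex x

/-- A full translation subquiver is cyclic if each of its vertices lies on an oriented
cycle inside it. -/
def IsCyclicSub (S : Set (ARVertex R)) : Prop := ∀ x ∈ S, OnCycleIn S x

/-- A full translation subquiver is coherent: every projective vertex is the start of an
infinite sectional path inside it, and every injective vertex is the end of an infinite
sectional path inside it. -/
def IsCoherentSub (S : Set (ARVertex R)) : Prop :=
  (∀ x ∈ S, IsProjVertex x → ∃ c : ℕ → ARVertex R, c 0 = x ∧ (∀ n, c n ∈ S) ∧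
      (∀ n, ARArrow (c n) (c (n + 1))) ∧ ∀ n, ¬TauRel (c n) (c (n + 2))) ∧
  (∀ x ∈ S, IsInjVertex x → ∃ c : ℕ → ARVertex R, c 0 = x ∧ (∀ n, c n ∈ S) ∧
      (∀ n, ARArrow (c (n + 1)) (c n)) ∧ ∀ n, ¬TauRel (c (n + 2)) (c n))

/-- `S` is a convex subquiver of (the full subquiver on) `C`: every path in `C` with
source and target in `S` has all its vertices in `S`. -/
def ConvexIn (C S : Set (ARVertex R)) : Prop :=
  ∀ (n : ℕ) (c : ℕ → ARVertex R), (∀ k ≤ n, c k ∈ C) →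
    (∀ k < n, ARArrow (c k) (c (k + 1))) → c 0 ∈ S → c n ∈ S → ∀ k ≤ n, c k ∈ S

/-- `S` is the core of the almost acyclic component `C`: the finite convex subquiver of
`C` containing all vertices lying on oriented cycles in `C`. -/
def IsCoreOf (C S : Set (ARVertex R)) : Prop :=
  S ⊆ C ∧ S.Finite ∧ ConvexIn C S ∧ ∀ x ∈ C, OnCycleIn C x → x ∈ S

/-- A component is almost acyclic if all but finitely many of its vertices do not lie on
oriented cycles. -/
def IsAlmostAcyclicComp (C : Set (ARVertex R)) : Prop := {x ∈ C | OnCycleIn C x}.Finite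

/-- A component is almost cyclic if its cyclic part is cofinite. -/
def IsAlmostCyclicComp (C : Set (ARVertex R)) : Prop := {x ∈ C | ¬OnCycleIn C x}.Finite

/-- Two vertices lie in the same `τ`-orbit. -/
def TauConn (x y : ARVertex R) : Prop :=
  Relation.ReflTransGen (fun a b => TauRel a b ∨ TauRel b a) x y

/-- The left stable part of `C`: remove the `τ`-orbits of projective vertices. -/
def leftStable (C : Set (ARVertex R)) : Set (ARVertex R) :=
  {x | x ∈ C ∧ ¬∃ y, TauConn x y ∧ IsProjVertex y}

/-- The right stable part of `C`: remove the `τ`-orbits of injective vertices. -/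
def rightStable (C : Set (ARVertex R)) : Set (ARVertex R) :=
  {x | x ∈ C ∧ ¬∃ y, TauConn x y ∧ IsInjVertex y}

/-- The stable part of `C`. -/
def stablePart (C : Set (ARVertex R)) : Set (ARVertex R) := leftStable C ∩ rightStable C

end ARQuiver

/-- The arrows of the translation quiver `ℤA∞/(τ^r)`, with vertices indexed by the
`τ`-orbit coordinate in `ZMod r` and the quasi-length (minus one) in `ℕ`. -/
def TubeArrow {r : ℕ} : ZMod r × ℕ → ZMod r × ℕ → Prop := fun u v =>
  (v.1 = u.1 ∧ v.2 = u.2 + 1) ∨ (v.1 = u.1 + 1 ∧ u.2 = v.2 + 1)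

section Tube

variable {R : Type u} [Ring R]

/-- `T` is a stable tube of rank `r`, parametrized by `φ : ℤA∞/(τ^r) → Γ_R`. -/
def IsStableTubeVia (T : Set (ARVertex R)) (r : ℕ) (φ : ZMod r × ℕ → ARVertex R) : Prop :=
  0 < r ∧ Function.Injective φ ∧ Set.range φ = T ∧
    (∀ u v, TubeArrow u v → ARArrow (φ u) (φ v)) ∧
    (∀ u v, ARArrow (φ u) (φ v) → TubeArrow u v) ∧
    ∀ (i : ZMod r) (n : ℕ), TauRel (φ (i - 1, n)) (φ (i, n))

/-- `T` is a stable tube. -/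
def IsStableTube (T : Set (ARVertex R)) : Prop := ∃ r φ, IsStableTubeVia T r φ

end Tube

section Separating

variable {R : Type u} [Ring R]

/-- A family of vertices is generalized standard if `rad^∞` vanishes between its modules. -/
def GeneralizedStandardSet (U : Set (ARVertex R)) : Prop :=
  ∀ X Y : IndecModA R, ARVertex.mk X ∈ U → ARVertex.mk Y ∈ U →
    ∀ f : X.1.M →ₗ[R] Y.1.M, InRadInf f → f = 0

/-- `S` is (isomorphic to) a composition factor (a subquotient) of `M`. -/
def IsCompFactorMod (R : Type u) [Ring R] (S : Type u) [AddCommGroup S] [Module R S]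
    (M : Type u) [AddCommGroup M] [Module R M] : Prop :=
  ∃ N' N : Submodule R M, N' ≤ N ∧
    Nonempty ((↥N ⧸ N'.comap N.subtype) ≃ₗ[R] S)

/-- A family of vertices is sincere if every simple module is a composition factor of one
of its modules. -/
def SincereSet (U : Set (ARVertex R)) : Prop :=
  ∀ (S : Type u) [AddCommGroup S] [Module R S], IsSimpleModule R S →
    ∃ x ∈ U, ∃ X : IndecModA R, ARVertex.mk X = x ∧ IsCompFactorMod R S X.1.M

/-- All homomorphisms from modules with vertex in `U` to modules with vertex in `V` vanish. -/
def HomVanish (U V : Set (ARVertex R)) : Prop :=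
  ∀ X Y : IndecModA R, ARVertex.mk X ∈ U → ARVertex.mk Y ∈ V →
    ∀ f : X.1.M →ₗ[R] Y.1.M, f = 0

/-- Every homomorphism from a module in `U` to a module in `V` factors through the
additive closure of the modules in `W`. -/
def FactorsThrough (U W V : Set (ARVertex R)) : Prop :=
  ∀ X Y : IndecModA R, ARVertex.mk X ∈ U → ARVertex.mk Y ∈ V →
    ∀ f : X.1.M →ₗ[R] Y.1.M, ∃ (k : ℕ) (Z : Fin k → IndecModA R)
      (g : ∀ i, X.1.M →ₗ[R] (Z i).1.M) (h : ∀ i, (Z i).1.M →ₗ[R] Y.1.M),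
      (∀ i, ARVertex.mk (Z i) ∈ W) ∧ f = ∑ i, (h i).comp (g i)

/-- `cs` is a separating family of components of `Γ_R`. -/
def IsSeparatingFamily (cs : Set (Set (ARVertex R))) : Prop :=
  ∃ ps qs : Set (Set (ARVertex R)),
    (∀ C ∈ ps, IsARComponent C) ∧ (∀ C ∈ cs, IsARComponent C) ∧ (∀ C ∈ qs, IsARComponent C) ∧
    (∀ C, IsARComponent C → C ∈ ps ∨ C ∈ cs ∨ C ∈ qs) ∧
    (∀ C ∈ ps, C ∉ cs ∧ C ∉ qs) ∧ (∀ C ∈ cs, C ∉ qs) ∧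
    SincereSet (⋃₀ cs) ∧ GeneralizedStandardSet (⋃₀ cs) ∧
    HomVanish (⋃₀ qs) (⋃₀ ps) ∧ HomVanish (⋃₀ qs) (⋃₀ cs) ∧ HomVanish (⋃₀ cs) (⋃₀ ps) ∧
    FactorsThrough (⋃₀ ps) (⋃₀ cs) (⋃₀ qs)

end Separating

/-! ### Classes of algebras via their Auslander-Reiten quivers.
For a ring `B`, the category `mod B` of finitely generated right `B`-modules is
realized as the category of finite length left `Bᵐᵒᵖ`-modules. -/

/-- An algebra is of finite representation type if it has only finitely many isomorphism
classes of indecomposable finitely generated (right) modules. -/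
def IsFiniteRepTypeAlg (B : Type u) [Ring B] : Prop :=
  (Set.univ : Set (ARVertex Bᵐᵒᵖ)).Finite

/-- An algebra is cycle-finite if all cycles in `ind B` are finite. -/
def IsCycleFiniteAlg (B : Type u) [Ring B] : Prop :=
  ∀ c : ModCycle Bᵐᵒᵖ, c.IsFiniteCycle

/-- A generalized multicoil algebra: an algebra whose Auslander-Reiten quiver admits a
separating family of almost cyclic coherent components. -/
def IsGeneralizedMulticoilAlgebra (B : Type u) [Ring B] : Prop :=
  ∃ cs : Set (Set (ARVertex Bᵐᵒᵖ)),
    (∀ C ∈ cs, IsARComponent C ∧ IsAlmostCyclicComp C ∧ IsCoherentSub C) ∧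
    IsSeparatingFamily cs

/-- A generalized double tilted algebra: an algebra whose Auslander-Reiten quiver admits
a separating almost acyclic component (a connecting component). -/
def IsGeneralizedDoubleTiltedAlgebra (B : Type u) [Ring B] : Prop :=
  ∃ C : Set (ARVertex Bᵐᵒᵖ),
    IsARComponent C ∧ IsAlmostAcyclicComp C ∧ IsSeparatingFamily {C}

/-- A concealed canonical algebra: an algebra whose Auslander-Reiten quiver admits a
separating family of stable tubes. -/
def IsConcealedCanonicalAlgebra (B : Type u) [Ring B] : Prop :=
  ∃ ts : Set (Set (ARVertex Bᵐᵒᵖ)), (∀ T ∈ ts, IsStableTube T) ∧ IsSeparatingFamily ts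

/-- A generic module: an indecomposable module of infinite length with finite endolength. -/
def IsGenericModule (R : Type u) [Ring R] (N : RawMod R) : Prop :=
  IsIndecMod R N.M ∧ ¬IsFiniteLength R N.M ∧ IsFiniteLength (Module.End R N.M) N.M

/-- The endolength of a module: its length over its endomorphism ring. -/
noncomputable def endolength (R : Type u) [Ring R] (N : RawMod R) : WithBot ℕ∞ :=
  Order.krullDim (Submodule (Module.End R N.M) N.M)

/-- Generic tameness in the sense of Crawley-Boevey: for each `d` there are only finitely
many isomorphism classes of generic (right) modules of endolength `d`. -/
def IsGenericallyTameAlg (B : Type u) [Ring B] : Prop :=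
  ∀ d : ℕ, ∃ (k : ℕ) (T : Fin k → RawMod Bᵐᵒᵖ),
    ∀ N : RawMod Bᵐᵒᵖ, IsGenericModule Bᵐᵒᵖ N → endolength Bᵐᵒᵖ N = (d : ℕ∞) →
      ∃ i, Nonempty (N.M ≃ₗ[Bᵐᵒᵖ] (T i).M)

/-- A tame generalized multicoil algebra. -/
def IsTameGeneralizedMulticoilAlgebra (B : Type u) [Ring B] : Prop :=
  IsGeneralizedMulticoilAlgebra B ∧ IsGenericallyTameAlg B

/-- A tame generalized double tilted algebra. -/
def IsTameGeneralizedDoubleTiltedAlgebra (B : Type u) [Ring B] : Prop :=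
  IsGeneralizedDoubleTiltedAlgebra B ∧ IsGenericallyTameAlg B

/-! ### The quiver of an algebra, convex idempotents, basic and connected algebras -/

section AlgebraSide

variable (A : Type u) [Ring A]

/-- The Jacobson radical of `A` (as a left ideal; it is in fact two-sided). -/
def jacobsonRad : Ideal A := (⊥ : Ideal A).jacobson

/-- The square of the Jacobson radical of `A`. -/
def jacobsonRadSq : Ideal A :=
  Ideal.span {x | ∃ a ∈ jacobsonRad A, ∃ b ∈ jacobsonRad A, x = a * b}

/-- A primitive idempotent of `A`. -/
def IsPrimitiveIdempotent (e : A) : Prop :=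
  IsIdempotentElem e ∧ e ≠ 0 ∧
    ∀ f g : A, IsIdempotentElem f → IsIdempotentElem g → f * g = 0 → g * f = 0 →
      e = f + g → f = 0 ∨ g = 0

/-- A complete family of pairwise orthogonal primitive idempotents of `A`; its indices
are the vertices of the quiver `Q_A` of `A`. -/
structure CompleteIdemFamily (A : Type u) [Ring A] where
  n : ℕ
  e : Fin n → A
  prim : ∀ i, IsPrimitiveIdempotent A (e i)
  orth : ∀ i j, i ≠ j → e i * e j = 0
  total : ∑ i, e i = 1

/-- There is an arrow `i → j` in the quiver `Q_A` iff `e_i (rad A) e_j ⊄ (rad A)²`. -/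
def QAarrow (E : CompleteIdemFamily A) (i j : Fin E.n) : Prop :=
  ∃ y ∈ jacobsonRad A, E.e i * y * E.e j ∉ jacobsonRadSq A

/-- A set of vertices of `Q_A` is convex if every path of `Q_A` with source and target in
it has all its vertices in it. -/
def ConvexVertexSet (E : CompleteIdemFamily A) (S : Set (Fin E.n)) : Prop :=
  ∀ (n : ℕ) (c : ℕ → Fin E.n), (∀ k < n, QAarrow A E (c k) (c (k + 1))) →
    c 0 ∈ S → c n ∈ S → ∀ k ≤ n, c k ∈ S

/-- A convex idempotent of `A`: a sum of pairwise orthogonal primitive idempotents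
corresponding to the vertices of a convex subquiver of `Q_A`. -/
def IsConvexIdempotent (e : A) : Prop :=
  ∃ (E : CompleteIdemFamily A) (S : Finset (Fin E.n)),
    ConvexVertexSet A E ↑S ∧ e = ∑ i ∈ S, E.e i

/-- The corner `eAe` of `A` at an idempotent `e`, as a nonunital subring (it is a unital
ring with unit `e`). -/
def cornerRing (e : A) : NonUnitalSubring A where
  carrier := {x | e * x = x ∧ x * e = x}
  zero_mem' := by simp
  add_mem' := by
    rintro a b ⟨ha1, ha2⟩ ⟨hb1, hb2⟩
    constructor
    · rw [mul_add, ha1, hb1]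
    · rw [add_mul, ha2, hb2]
  neg_mem' := by
    rintro a ⟨ha1, ha2⟩
    constructor
    · rw [mul_neg, ha1]
    · rw [neg_mul, ha2]
  mul_mem' := by
    rintro a b ⟨ha1, ha2⟩ ⟨hb1, hb2⟩
    constructor
    · rw [← mul_assoc, ha1]
    · rw [mul_assoc, hb2]

/-- An (indecomposable =) connected algebra: no nontrivial central idempotents. -/
def IsConnectedAlgebra : Prop :=
  Nontrivial A ∧ ∀ e : A, IsIdempotentElem e → e ∈ Set.center A → e = 0 ∨ e = 1

/-- A basic algebra: distinct orthogonal primitive idempotents have nonisomorphic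
associated indecomposable projective right modules. -/
def IsBasicAlgebra : Prop :=
  ¬∃ e f : A, IsPrimitiveIdempotent A e ∧ IsPrimitiveIdempotent A f ∧
    e * f = 0 ∧ f * e = 0 ∧
    Nonempty ((Submodule.span Aᵐᵒᵖ {e} : Submodule Aᵐᵒᵖ A) ≃ₗ[Aᵐᵒᵖ]
      (Submodule.span Aᵐᵒᵖ {f} : Submodule Aᵐᵒᵖ A))

end AlgebraSide

/-! ### Support algebras and faithful algebras of families of vertices -/

section Support

variable (A : Type u) [Ring A]

/-- The radical of a module: the intersection of its maximal submodules. -/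
def modRadical (R : Type u) [Ring R] (M : Type u) [AddCommGroup M] [Module R M] :
    Submodule R M :=
  sInf {N | IsCoatom N}

/-- The intersection `ann_A(Γ)` of the annihilators of all right `A`-modules whose
vertices belong to `Γ`, as a two-sided ideal of `A`. -/
def annTwoSidedIdeal (Γ : Set (ARVertex Aᵐᵒᵖ)) : TwoSidedIdeal A :=
  TwoSidedIdeal.mk'
    {a | ∀ x ∈ Γ, ∀ X : IndecModA Aᵐᵒᵖ, ARVertex.mk X = x →
      ∀ m : X.1.M, MulOpposite.op a • m = 0}
    (by intro x _ X _ m; simp)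
    (by
      intro a b ha hb x hx X hX m
      have : MulOpposite.op (a + b) • m = MulOpposite.op a • m + MulOpposite.op b • m := by
        rw [← add_smul]; rfl
      rw [this, ha x hx X hX m, hb x hx X hX m, add_zero])
    (by
      intro a ha x hx X hX m
      have : MulOpposite.op (-a) • m = -(MulOpposite.op a • m) := by
        rw [← neg_smul]; rfl
      rw [this, ha x hx X hX m, neg_zero])
    (by
      intro a b hb x hx X hX m
      have : MulOpposite.op (a * b) • m = MulOpposite.op b • (MulOpposite.op a • m) := by
        rw [← mul_smul]; rfl
      rw [this, hb x hx X hX _])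
    (by
      intro a b ha x hx X hX m
      have : MulOpposite.op (a * b) • m = MulOpposite.op b • (MulOpposite.op a • m) := by
        rw [← mul_smul]; rfl
      rw [this, ha x hx X hX m, smul_zero])

/-- The faithful algebra `B(Γ) = A / ann_A(Γ)` of a family `Γ` of vertices of `Γ_A`. -/
abbrev faithfulAlg (Γ : Set (ARVertex Aᵐᵒᵖ)) : Type u :=
  (annTwoSidedIdeal A Γ).ringCon.Quotient

/-- The canonical projection `A → B(Γ)`. -/
def faithfulProj (Γ : Set (ARVertex Aᵐᵒᵖ)) : A →+* faithfulAlg A Γ :=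
  RingCon.mk' (annTwoSidedIdeal A Γ).ringCon

/-- The trace ideal `t_A(Γ)`: the two-sided ideal of `A` generated by the images of all
homomorphisms of right `A`-modules from `Q` to `A`. -/
def traceIdeal (Q : Submodule Aᵐᵒᵖ A) : TwoSidedIdeal A :=
  TwoSidedIdeal.span (⋃ f : ↥Q →ₗ[Aᵐᵒᵖ] A, Set.range f)

/-- A decomposition `A = P_Γ ⊕ Q_Γ` of `A` in `mod A` such that the simple summands of
`P_Γ / rad P_Γ` are exactly the simple composition factors of the modules in `Γ`. -/
structure GammaDecomp (A : Type u) [Ring A] (Γ : Set (ARVertex Aᵐᵒᵖ)) where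
  P : Submodule Aᵐᵒᵖ A
  Q : Submodule Aᵐᵒᵖ A
  compl : IsCompl P Q
  top_factors : ∀ (S : Type u) [AddCommGroup S] [Module Aᵐᵒᵖ S], IsSimpleModule Aᵐᵒᵖ S →
    (IsCompFactorMod Aᵐᵒᵖ S (↥P ⧸ modRadical Aᵐᵒᵖ ↥P) ↔
      ∃ x ∈ Γ, ∃ X : IndecModA Aᵐᵒᵖ, ARVertex.mk X = x ∧ IsCompFactorMod Aᵐᵒᵖ S X.1.M)

end Support

/-- Restriction of scalars along a surjective ring homomorphism `π : A → B` identifies a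
vertex `y` of `Γ_B` with a vertex `x` of `Γ_A`: representatives have the same underlying
group, with the `A`-action obtained from the `B`-action through `π`. -/
def VertexRestrictsTo {A B : Type u} [Ring A] [Ring B] (π : A →+* B)
    (y : ARVertex Bᵐᵒᵖ) (x : ARVertex Aᵐᵒᵖ) : Prop :=
  ∃ (N : IndecModA Bᵐᵒᵖ) (X : IndecModA Aᵐᵒᵖ), ARVertex.mk N = y ∧ ARVertex.mk X = x ∧
    ∃ e : X.1.M ≃+ N.1.M, ∀ (a : A) (m : X.1.M),
      e (MulOpposite.op a • m) = MulOpposite.op (π a) • e m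

/-! ### `K`-module structures on Hom-groups, lengths, and Ext -/

section KLength

variable (K B : Type u) [CommRing K] [Ring B] [Algebra K B]
variable (X N : Type u) [AddCommGroup X] [Module B X] [AddCommGroup N] [Module B N]

/-- The action of `K` on `B`-linear maps, through `algebraMap K B`. -/
def homKSMul (k : K) (f : X →ₗ[B] N) : X →ₗ[B] N where
  toFun x := algebraMap K B k • f x
  map_add' x y := by show algebraMap K B k • f (x + y) = _; rw [map_add, smul_add]
  map_smul' b x := by
    simp only [map_smul, RingHom.id_apply, smul_smul]
    rw [Algebra.commutes]

/-- The `K`-module structure on the group of `B`-linear maps. -/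
def homKModule : Module K (X →ₗ[B] N) where
  smul := homKSMul K B X N
  one_smul f := LinearMap.ext fun x => by
    show algebraMap K B 1 • f x = f x
    rw [map_one, one_smul]
  mul_smul k l f := LinearMap.ext fun x => by
    show algebraMap K B (k * l) • f x = algebraMap K B k • algebraMap K B l • f x
    rw [map_mul, mul_smul]
  smul_zero k := LinearMap.ext fun x => by
    show algebraMap K B k • (0 : X →ₗ[B] N) x = 0
    simp
  smul_add k f g := LinearMap.ext fun x => by
    show algebraMap K B k • (f + g) x = algebraMap K B k • f x + algebraMap K B k • g x
    simp [smul_add]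
  add_smul k l f := LinearMap.ext fun x => by
    show algebraMap K B (k + l) • f x = algebraMap K B k • f x + algebraMap K B l • f x
    rw [map_add, add_smul]
  zero_smul f := LinearMap.ext fun x => by
    show algebraMap K B 0 • f x = 0
    rw [map_zero, zero_smul]

/-- The length `|Hom_B(X, N)|` of the group of `B`-linear maps `X → N` as a `K`-module. -/
noncomputable def homKLength : WithBot ℕ∞ :=
  letI : Module K (X →ₗ[B] N) := homKModule K B X N
  Order.krullDim (Submodule K (X →ₗ[B] N))

/-- The canonical surjection from the free module on (the underlying set of) `X` to `X`. -/
noncomputable def freeCover : (X →₀ B) →ₗ[B] X :=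
  Finsupp.linearCombination B id

/-- The length `|Ext¹_B(X, N)|` of `Ext¹` as a `K`-module, computed as the cokernel of
`Hom_B(F, N) → Hom_B(Ω X, N)` for the canonical free cover `F → X` with kernel `Ω X`. -/
noncomputable def ext1KLength : WithBot ℕ∞ :=
  letI : Module K (↥(LinearMap.ker (freeCover B X)) →ₗ[B] N) :=
    homKModule K B (↥(LinearMap.ker (freeCover B X))) N
  let D : Submodule K (↥(LinearMap.ker (freeCover B X)) →ₗ[B] N) :=
    { carrier := {f | ∃ g : (X →₀ B) →ₗ[B] N,
        f = g.comp (LinearMap.ker (freeCover B X)).subtype}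
      add_mem' := by
        rintro f₁ f₂ ⟨g₁, rfl⟩ ⟨g₂, rfl⟩
        exact ⟨g₁ + g₂, rfl⟩
      zero_mem' := ⟨0, rfl⟩
      smul_mem' := by
        rintro k f ⟨g, rfl⟩
        exact ⟨homKSMul K B _ N k g, rfl⟩ }
  Order.krullDim (Submodule K ((↥(LinearMap.ker (freeCover B X)) →ₗ[B] N) ⧸ D))

end KLength

/-- Vanishing of `Ext¹_B(X, N)`: every short exact sequence `0 → N → E → X → 0` splits. -/
def Ext1IsZero (B : Type u) [Ring B] (X : Type u) [AddCommGroup X] [Module B X]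
    (N : Type u) [AddCommGroup N] [Module B N] : Prop :=
  ∀ (E : Type u) [AddCommGroup E] [Module B E], ∀ (f : N →ₗ[B] E) (g : E →ₗ[B] X),
    Function.Injective f → Function.Surjective g → LinearMap.range f = LinearMap.ker g →
    ∃ s : X →ₗ[B] E, g.comp s = LinearMap.id

/-- The syzygy `Ω X`: the kernel of the canonical free cover of `X`. -/
noncomputable def syzygyRaw (B : Type u) [Ring B] (X : RawMod B) : RawMod B :=
  ⟨↥(LinearMap.ker (freeCover B X.M))⟩

/-- Iterated syzygies. -/
noncomputable def syzygyIter (B : Type u) [Ring B] : ℕ → RawMod B → RawMod B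
  | 0, X => X
  | n + 1, X => syzygyRaw B (syzygyIter B n X)

/-- Vanishing of `Ext^r_B(X, N)` for `r ≥ 1`, via `Ext^r(X, N) ≅ Ext¹(Ω^{r-1} X, N)`. -/
noncomputable def ExtIsZero (B : Type u) [Ring B] (X N : RawMod B) (r : ℕ) : Prop :=
  Ext1IsZero B (syzygyIter B (r - 1) X).M N.M

/-- `[X] = [M]` in the Grothendieck group `K₀`: the modules `X` and `M` have the same
composition factors including multiplicities. -/
def SameCompFactors {B : Type u} [Ring B] (X M : ModA B) : Prop :=
  ∃ (n : ℕ) (s : Fin (n + 1) → Submodule B X.M) (t : Fin (n + 1) → Submodule B M.M)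
    (σ : Equiv.Perm (Fin n)),
    s 0 = ⊥ ∧ s (Fin.last n) = ⊤ ∧ t 0 = ⊥ ∧ t (Fin.last n) = ⊤ ∧
    (∀ i : Fin n, s i.castSucc ≤ s i.succ) ∧ (∀ i : Fin n, t i.castSucc ≤ t i.succ) ∧
    ∀ i : Fin n,
      IsSimpleModule B (↥(s i.succ) ⧸ (s i.castSucc).comap (s i.succ).subtype) ∧
      Nonempty ((↥(s i.succ) ⧸ (s i.castSucc).comap (s i.succ).subtype) ≃ₗ[B]
        (↥(t (σ i).succ) ⧸ (t (σ i).castSucc).comap (t (σ i).succ).subtype))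

/-- A torsion class in `mod B`: a class of modules closed under factor modules and
extensions. -/
def IsTorsionClass (B : Type u) [Ring B] (T : Set (ModA B)) : Prop :=
  (∀ M ∈ T, ∀ (N : ModA B) (g : M.M →ₗ[B] N.M), Function.Surjective g → N ∈ T) ∧
  ∀ (X E M : ModA B) (f : X.M →ₗ[B] E.M) (g : E.M →ₗ[B] M.M),
    Function.Injective f → Function.Surjective g → LinearMap.range f = LinearMap.ker g →
    X ∈ T → M ∈ T → E ∈ T

/-- A torsion class is functorially finite iff it is of the form `Fac(M)`. -/
def IsFunctoriallyFinite (B : Type u) [Ring B] (T : Set (ModA B)) : Prop :=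
  ∃ M : ModA B,
    T = {N | ∃ (k : ℕ) (g : (Fin k → M.M) →ₗ[B] N.M), Function.Surjective g}

/-- A module `M` is `τ`-rigid if `Hom(M, τM) = 0`. -/
def IsTauRigid {B : Type u} [Ring B] (M : ModA B) : Prop :=
  ∀ N : ModA B, IsTauOf N M → ∀ f : M.M →ₗ[B] N.M, f = 0

/-- A module `M` is rigid if `Ext¹(M, M) = 0`. -/
def IsRigid {B : Type u} [Ring B] (M : ModA B) : Prop := Ext1IsZero B M.M M.M

/-- `α(M) ≤ 2`: the middle term of any almost split sequence ending at `M` has at most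
two indecomposable direct summands. -/
def AlphaLe2 {B : Type u} [Ring B] (M : ModA B) : Prop :=
  ∀ s : AlmostSplitSeq B, s.r.Iso M →
    ∀ (k : ℕ) (N : Fin k → Submodule B s.m.M),
      (∀ i, IsIndecMod B ↥(N i)) → iSupIndep N → (⨆ i, N i) = ⊤ → k ≤ 2

/-! ## Part 1: abstract combinatorics of translation quivers with a hom relation -/

namespace ARx

open Relation

structure TQ (V : Type*) where
  Arrow : V → V → Prop
  Tau : V → V → Prop
  Proj : V → Prop
  Inj : V → Prop
  hom : V → V → Prop
  tau_fun : ∀ {x x' y}, Tau x y → Tau x' y → x = x'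
  tau_inj : ∀ {x y y'}, Tau x y → Tau x y' → y = y'
  tau_ex : ∀ y, ¬ Proj y → ∃ x, Tau x y
  taui_ex : ∀ x, ¬ Inj x → ∃ y, Tau x y
  tau_not_proj : ∀ {x y}, Tau x y → ¬ Proj y
  tau_not_inj : ∀ {x y}, Tau x y → ¬ Inj x
  mesh_l : ∀ {x y z}, Arrow x y → Tau z y → Arrow z x
  mesh_r : ∀ {x y z}, Arrow x y → Tau x z → Arrow y z
  fin_succ : ∀ x, {y | Arrow x y}.Finite
  fin_pred : ∀ y, {x | Arrow x y}.Finite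
  fin_proj : {x | Proj x}.Finite
  fin_inj : {x | Inj x}.Finite
  hom_of_arrow : ∀ {x y}, Arrow x y → hom x y
  sec : ∀ (v : ℕ → V) (t : ℕ), (∀ k < t, Arrow (v k) (v (k + 1))) →
    (∀ k, k + 2 ≤ t → ¬ Tau (v k) (v (k + 2))) → hom (v 0) (v t)
  per : ∀ (v : ℕ → V) (n : ℕ), 0 < n → (∀ k, v (k + n) = v k) →
    (∀ k, Arrow (v k) (v (k + 1))) → (∀ k, ¬ Tau (v k) (v (k + 2))) → False
  hom_pi : ∀ {x y p i}, Arrow x y → Proj p → Inj i → hom p y → hom x i → hom p x ∨ hom y i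
  rigid : ∀ S : Set V, (∀ y ∈ S, ¬ Proj y) →
    (∀ x ∈ S, ∀ y ∈ S, ∀ z, Tau z y → ¬ hom x z) → S.Finite
  rigid' : ∀ S : Set V, (∀ y ∈ S, ¬ Inj y) →
    (∀ x ∈ S, ∀ y ∈ S, ∀ z, Tau y z → ¬ hom z x) → S.Finite

variable {V : Type*}

/-- A periodic path has a periodic reverse. -/
lemma rev_periodic {v : ℕ → V} {n : ℕ} (hn : 0 < n) (hp : ∀ k, v (k + n) = v k) :
    ∀ k j, v ((n - 1) * (k + j) + j) = v ((n - 1) * k) := by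
  have hp2 : ∀ j k, v (k + n * j) = v k := by
    intro j
    induction j with
    | zero => intro k; simp
    | succ j ih =>
      intro k
      have : k + n * (j + 1) = (k + n * j) + n := by ring
      rw [this, hp, ih]
  intro k j
  have : (n - 1) * (k + j) + j = (n - 1) * k + n * j := by
    obtain ⟨m, rfl⟩ : ∃ m, n = m + 1 := ⟨n - 1, by omega⟩
    simp; ring
  rw [this, hp2]

/-- The opposite. -/
def TQ.op (T : TQ V) : TQ V where
  Arrow x y := T.Arrow y x
  Tau x y := T.Tau y x
  Proj := T.Inj
  Inj := T.Proj
  hom x y := T.hom y x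
  tau_fun h h' := T.tau_inj h h'
  tau_inj h h' := T.tau_fun h h'
  tau_ex := T.taui_ex
  taui_ex := T.tau_ex
  tau_not_proj h := T.tau_not_inj h
  tau_not_inj h := T.tau_not_proj h
  mesh_l h h' := T.mesh_r h h'
  mesh_r h h' := T.mesh_l h h'
  fin_succ := T.fin_pred
  fin_pred := T.fin_succ
  fin_proj := T.fin_inj
  fin_inj := T.fin_proj
  hom_of_arrow h := T.hom_of_arrow h
  sec := by
    intro v t h1 h2
    have := T.sec (fun k => v (t - k)) t (fun k hk => by
      have := h1 (t - (k + 1)) (by omega)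
      rwa [show t - (k + 1) + 1 = t - k by omega] at this) (fun k hk => by
      have := h2 (t - (k + 2)) (by omega)
      rwa [show t - (k + 2) + 2 = t - k by omega] at this)
    simpa using this
  per := by
    intro v n hn hp h1 h2
    refine T.per (fun k => v ((n - 1) * k)) n hn ?_ ?_ ?_
    · intro k
      have := rev_periodic hn hp k n
      rw [hp] at this; exact this
    · intro k
      have := h1 ((n - 1) * (k + 1))
      rwa [rev_periodic hn hp k 1] at this
    · intro k
      have := h2 ((n - 1) * (k + 2))
      rwa [rev_periodic hn hp k 2] at this
  hom_pi h hp hi h1 h2 := (T.hom_pi h hi hp h2 h1).symm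
  rigid := T.rigid'
  rigid' := T.rigid

lemma rtg_mono {r s : V → V → Prop} (h : ∀ a b, r a b → s a b) {x y : V}
    (hxy : ReflTransGen r x y) : ReflTransGen s x y := by
  induction hxy with
  | refl => exact .refl
  | tail _ hbc ih => exact ih.tail (h _ _ hbc)

lemma tg_mono {r s : V → V → Prop} (h : ∀ a b, r a b → s a b) {x y : V}
    (hxy : TransGen r x y) : TransGen s x y := by
  induction hxy with
  | single h' => exact .single (h _ _ h')
  | tail _ hbc ih => exact ih.tail (h _ _ hbc)

lemma exists_path {r : V → V → Prop} {x y : V} (h : ReflTransGen r x y) :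
    ∃ (n : ℕ) (v : ℕ → V), v 0 = x ∧ v n = y ∧ ∀ k < n, r (v k) (v (k + 1)) := by
  induction h with
  | refl => exact ⟨0, fun _ => x, rfl, rfl, by simp⟩
  | @tail b c _ hbc ih =>
    obtain ⟨n, v, h0, hn, hv⟩ := ih
    refine ⟨n + 1, fun k => if k ≤ n then v k else c, by simp [h0], by simp, ?_⟩
    intro k hk
    rcases Nat.lt_or_ge k n with h | h
    · have : k ≤ n := h.le
      have h' : k + 1 ≤ n := h
      simp [this, h', hv k h]
    · have : k = n := by omega
      subst this
      simpa [hn] using hbc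

/-- A cycle gives a periodic path. -/
lemma exists_periodic {r : V → V → Prop} {x : V} (h : TransGen r x x) :
    ∃ (n : ℕ) (v : ℕ → V), 0 < n ∧ v 0 = x ∧ (∀ k, v (k + n) = v k) ∧
      ∀ k, r (v k) (v (k + 1)) := by
  obtain ⟨z, h1, h2⟩ := TransGen.tail'_iff.1 h
  obtain ⟨n, v, h0, hn, hv⟩ := exists_path h1
  refine ⟨n + 1, fun k => v (k % (n + 1)), by omega, by simp [h0], by simp, ?_⟩
  intro k
  have hk : k % (n + 1) < n + 1 := Nat.mod_lt _ (by omega)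
  rcases Nat.lt_or_ge (k % (n + 1)) n with h | h
  · have : (k + 1) % (n + 1) = k % (n + 1) + 1 := by
      rw [Nat.add_mod, Nat.mod_eq_of_lt (a := 1) (by omega)]
      exact Nat.mod_eq_of_lt (by omega)
    simp only [this]
    exact hv _ h
  · have e : k % (n + 1) = n := by omega
    have : (k + 1) % (n + 1) = 0 := by
      rw [Nat.add_mod, e]
      rcases Nat.eq_zero_or_pos n with rfl | hn'
      · simp
      · rw [Nat.mod_eq_of_lt (a := 1) (by omega)]; simp
    simp only [this, e, h0, hn]
    exact h2

lemma rtg_of_periodic {r : V → V → Prop} {v : ℕ → V} (h : ∀ k, r (v k) (v (k + 1))) (i : ℕ) :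
    ∀ j, ReflTransGen r (v i) (v (i + j)) := by
  intro j
  induction j with
  | zero => exact .refl
  | succ j ih => exact ih.tail (h _)

namespace TQ

variable (T : TQ V)

/-- Backward claim. -/
lemma back {Y : V} (hY : TransGen T.Arrow Y Y) :
    (∃ Z, T.Tau Z Y ∧ ReflTransGen T.Arrow Y Z) ∨
      (∃ P, T.Proj P ∧ ReflTransGen T.Arrow Y P ∧ T.hom P Y) := by
  obtain ⟨n, v, hn, h0, hp, hv⟩ := exists_periodic hY
  set b : ℕ → V := fun k => v ((n - 1) * k) with hb
  have hb0 : b 0 = Y := by simp [hb, h0]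
  have hbn : ∀ k, b (k + n) = b k := fun k => by
    have := rev_periodic hn hp k n
    rw [hp] at this; exact this
  have hba : ∀ k, T.Arrow (b (k + 1)) (b k) := fun k => by
    have := hv ((n - 1) * (k + 1))
    rwa [rev_periodic hn hp k 1] at this
  have hYb : ∀ k, ReflTransGen T.Arrow Y (b k) := fun k => by
    have := rtg_of_periodic hv 0 ((n - 1) * k)
    simpa [h0] using this
  -- the tau case
  have key : ∀ k, (∀ j ≤ k, ¬ T.Proj (b j)) → T.Tau (b (k + 2)) (b k) →
      ∃ Z, T.Tau Z Y ∧ ReflTransGen T.Arrow Y Z := by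
    intro k hk ht
    have aux : ∀ j ≤ k, ∀ Z, T.Tau Z (b j) → ∃ Z', T.Tau Z' Y ∧ ReflTransGen T.Arrow Z Z' := by
      intro j
      induction j with
      | zero => intro _ Z hZ; exact ⟨Z, by rwa [hb0] at hZ, .refl⟩
      | succ j ih =>
        intro hj Z hZ
        obtain ⟨W, hW⟩ := T.tau_ex (b j) (hk j (by omega))
        obtain ⟨Z', h1, h2⟩ := ih (by omega) W hW
        refine ⟨Z', h1, .head ?_ h2⟩
        exact T.mesh_l (T.mesh_l (hba j) hW) hZ
    obtain ⟨Z', h1, h2⟩ := aux k le_rfl _ ht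
    exact ⟨Z', h1, (hYb _).trans h2⟩
  by_cases hpr : ∃ t, T.Proj (b t)
  · classical
    set t := Nat.find hpr with hte
    have htp : T.Proj (b t) := Nat.find_spec hpr
    have htm : ∀ j < t, ¬ T.Proj (b j) := fun j hj => Nat.find_min hpr hj
    by_cases hk : ∃ k, k + 2 ≤ t ∧ T.Tau (b (k + 2)) (b k)
    · obtain ⟨k, hk, ht⟩ := hk
      exact Or.inl (key k (fun j hj => htm j (by omega)) ht)
    · right
      push Not at hk
      refine ⟨b t, htp, hYb t, ?_⟩
      rw [← hb0]
      exact T.op.sec b t (fun k _ => hba k) hk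
  · push Not at hpr
    by_cases hk : ∃ k, T.Tau (b (k + 2)) (b k)
    · obtain ⟨k, hk⟩ := hk
      exact Or.inl (key k (fun j _ => hpr j) hk)
    · push Not at hk
      exact (T.op.per b n hn hbn hba hk).elim

lemma rtg_op {r : V → V → Prop} {x y : V} (h : ReflTransGen r x y) :
    ReflTransGen (fun a b => r b a) y x := h.swap

lemma tg_op {r : V → V → Prop} {x y : V} (h : TransGen r x y) :
    TransGen (fun a b => r b a) y x := h.swap

lemma rtg_hom {x y : V} (h : ReflTransGen T.Arrow x y) : ReflTransGen T.hom x y :=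
  rtg_mono (fun _ _ h => T.hom_of_arrow h) h

lemma step_back {X Y : V} (hX : TransGen T.Arrow X X) (hY : TransGen T.Arrow Y Y)
    (h : T.Arrow X Y) : ReflTransGen T.hom Y X := by
  rcases T.back hY with ⟨Z, h1, h2⟩ | ⟨P, hP, h1, h2⟩
  · exact T.rtg_hom (h2.tail (T.mesh_l h h1))
  rcases T.op.back (tg_op hX) with ⟨Z, h1', h2'⟩ | ⟨I, hI, h1', h2'⟩
  · have h2'' : ReflTransGen T.Arrow Z X := rtg_op h2'
    exact T.rtg_hom (.head (T.mesh_r h h1') h2'')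
  · have h1'' : ReflTransGen T.Arrow I X := rtg_op h1'
    rcases T.hom_pi h hP hI h2 h2' with h3 | h3
    · exact (T.rtg_hom h1).tail h3
    · exact .head h3 (T.rtg_hom h1'')

/-- cycle-finiteness of the vertex x0 -/
def CF (x0 : V) : Prop := ∀ y z, ReflTransGen T.hom x0 y → T.hom y z → y ≠ z →
  ReflTransGen T.hom z x0 → ReflTransGen T.Arrow y z

lemma CF.arrow {T : TQ V} {x0 : V} (h : T.CF x0) {u w : V} (h1 : ReflTransGen T.hom x0 u)
    (h2 : ReflTransGen T.hom u w) (h3 : ReflTransGen T.hom w x0) : ReflTransGen T.Arrow u w := by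
  induction h2 with
  | refl => exact .refl
  | @tail b c hub hbc ih =>
    refine (ih (.head hbc h3)).trans ?_
    by_cases e : b = c
    · subst e; exact .refl
    · exact h b c (h1.trans hub) hbc e h3

/-- Properties of Γ used in the main combinatorial argument. -/
structure Good (Γ : Set V) : Prop where
  between : ∀ x ∈ Γ, ∀ z, ∀ y ∈ Γ, ReflTransGen T.hom x z → ReflTransGen T.hom z y → z ∈ Γ
  conn : ∀ x ∈ Γ, ∀ y ∈ Γ, ReflTransGen (fun a b => a ∈ Γ ∧ b ∈ Γ ∧ T.Arrow a b) x y
  pred : ∀ x ∈ Γ, ∃ y ∈ Γ, T.Arrow y x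
  succ : ∀ x ∈ Γ, ∃ y ∈ Γ, T.Arrow x y

lemma Good.op {T : TQ V} {Γ : Set V} (h : T.Good Γ) : T.op.Good Γ where
  between x hx z y hy h1 h2 := h.between y hy z x hx (rtg_op h2) (rtg_op h1)
  conn x hx y hy := rtg_mono (fun _ _ h => ⟨h.2.1, h.1, h.2.2⟩) (rtg_op (h.conn y hy x hx))
  pred := h.succ
  succ := h.pred

lemma good_of_comp {Γ : Set V} {x0 : V} (hx0 : x0 ∈ Γ) (hcf : T.CF x0)
    (hsub : ∀ x ∈ Γ, TransGen T.Arrow x x)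
    (hcl : ∀ x ∈ Γ, ∀ y, TransGen T.Arrow y y → (T.Arrow x y ∨ T.Arrow y x) → y ∈ Γ)
    (hconn : ∀ x ∈ Γ, ∀ y ∈ Γ, ReflTransGen (fun a b => TransGen T.Arrow a a ∧
      TransGen T.Arrow b b ∧ (T.Arrow a b ∨ T.Arrow b a)) x y) : T.Good Γ := by
  have hcyc0 := hsub x0 hx0
  have hWΓ : ∀ u, ReflTransGen T.Arrow x0 u → ReflTransGen T.Arrow u x0 → u ∈ Γ := by
    intro u h1 h2
    induction h1 with
    | refl => exact hx0
    | @tail b c hb hbc ih =>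
      have hbΓ := ih (.head hbc h2)
      refine hcl b hbΓ c ?_ (Or.inl hbc)
      exact TransGen.head'_iff.2 (by
        rcases ReflTransGen.cases_head h2 with e | ⟨d, hd, hd2⟩
        · subst e
          obtain ⟨e, he1, he2⟩ := TransGen.head'_iff.1 hcyc0
          exact ⟨e, he1, he2⟩
        · exact ⟨d, hd, hd2.trans (hb.tail hbc)⟩)
  have hΓW : ∀ u ∈ Γ, ReflTransGen T.hom x0 u ∧ ReflTransGen T.hom u x0 := by
    intro u hu
    have := hconn x0 hx0 u hu
    clear hu
    induction this with
    | refl => exact ⟨.refl, .refl⟩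
    | @tail b c _ hbc ih =>
      obtain ⟨hb, hc, h | h⟩ := hbc
      · exact ⟨ih.1.tail (T.hom_of_arrow h), (T.step_back hb hc h).trans ih.2⟩
      · exact ⟨ih.1.trans (T.step_back hc hb h), .head (T.hom_of_arrow h) ih.2⟩
  have hbet : ∀ x ∈ Γ, ∀ z, ∀ y ∈ Γ, ReflTransGen T.hom x z → ReflTransGen T.hom z y → z ∈ Γ := by
    intro x hx z y hy h1 h2
    have a := (hΓW x hx).1.trans h1
    have b := h2.trans (hΓW y hy).2
    exact hWΓ z (hcf.arrow .refl a b) (hcf.arrow a b .refl)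
  refine ⟨hbet, ?_, ?_, ?_⟩
  · intro x hx y hy
    have h1 : ReflTransGen T.Arrow x y := hcf.arrow (hΓW x hx).1
      ((hΓW x hx).2.trans (hΓW y hy).1) (hΓW y hy).2
    have aux : ∀ u, ReflTransGen T.Arrow x u → ReflTransGen T.Arrow u y →
        ReflTransGen (fun a b => a ∈ Γ ∧ b ∈ Γ ∧ T.Arrow a b) x u := by
      intro u hxu
      induction hxu with
      | refl => intro _; exact .refl
      | @tail b c hb hbc ih =>
        intro hcy
        have hbΓ : b ∈ Γ := hbet x hx b y hy (T.rtg_hom hb) (T.rtg_hom (.head hbc hcy))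
        have hcΓ : c ∈ Γ := hbet x hx c y hy (T.rtg_hom (hb.tail hbc)) (T.rtg_hom hcy)
        exact (ih (.head hbc hcy)).tail ⟨hbΓ, hcΓ, hbc⟩
    exact aux y h1 .refl
  · intro x hx
    obtain ⟨y, h1, h2⟩ := TransGen.tail'_iff.1 (hsub x hx)
    exact ⟨y, hbet x hx y x hx (T.rtg_hom h1) (.single (T.hom_of_arrow h2)), h2⟩
  · intro x hx
    obtain ⟨y, h1, h2⟩ := TransGen.head'_iff.1 (hsub x hx)
    exact ⟨y, hbet x hx y x hx (.single (T.hom_of_arrow h1)) (T.rtg_hom h2), h1⟩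

end TQ

end ARx

namespace ARx

open Relation

namespace TQ

variable {V : Type*} (T : TQ V) (Γ : Set V)

open Classical in
/-- A total version of the translation. -/
noncomputable def t (x : V) : V := if h : ∃ z, T.Tau z x then h.choose else x

lemma t_spec {x : V} (h : ¬ T.Proj x) : T.Tau (T.t x) x := by
  have h' := T.tau_ex x h
  unfold t
  rw [dif_pos h']
  exact h'.choose_spec

lemma t_eq {z x : V} (h : T.Tau z x) : T.t x = z :=
  T.tau_fun (T.t_spec (T.tau_not_proj h)) h

lemma op_t {z x : V} (h : T.Tau z x) : T.op.t z = x := T.op.t_eq h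

/-- Left boundary of Γ. -/
def Bl : Set V := {y | y ∈ Γ ∧ (T.Proj y ∨ ∃ z, T.Tau z y ∧ z ∉ Γ)}

/-- The left stable part of Γ. -/
def Ls : Set V := {x | ∀ n, (T.t)^[n] x ∈ Γ ∧ (T.t)^[n] x ∉ T.Bl Γ}

variable {T Γ}

lemma not_proj_of {y : V} (h : y ∈ Γ) (h' : y ∉ T.Bl Γ) : ¬ T.Proj y :=
  fun hp => h' ⟨h, Or.inl hp⟩

lemma t_mem_of {y : V} (h : y ∈ Γ) (h' : y ∉ T.Bl Γ) : T.t y ∈ Γ := by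
  by_contra hc
  exact h' ⟨h, Or.inr ⟨_, T.t_spec (not_proj_of h h'), hc⟩⟩

lemma Ls_sub {x : V} (h : x ∈ T.Ls Γ) : x ∈ Γ := (h 0).1

lemma Ls_np {x : V} (h : x ∈ T.Ls Γ) : ¬ T.Proj x := not_proj_of (h 0).1 (h 0).2

lemma Ls_t {x : V} (h : x ∈ T.Ls Γ) : T.t x ∈ T.Ls Γ := fun n => by
  have := h (n + 1)
  rwa [Function.iterate_succ_apply] at this

lemma Ls_tk {x : V} (h : x ∈ T.Ls Γ) : ∀ k, (T.t)^[k] x ∈ T.Ls Γ := by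
  intro k
  induction k with
  | zero => exact h
  | succ k ih => rw [Function.iterate_succ_apply']; exact Ls_t ih

lemma not_Ls {y : V} (h : y ∈ Γ) (h' : y ∉ T.Ls Γ) :
    ∃ k, (∀ j < k, (T.t)^[j] y ∈ Γ ∧ (T.t)^[j] y ∉ T.Bl Γ) ∧ (T.t)^[k] y ∈ T.Bl Γ := by
  classical
  have hex : ∃ k, (T.t)^[k] y ∈ T.Bl Γ := by
    by_contra hc
    push Not at hc
    apply h'
    intro n
    refine ⟨?_, hc n⟩
    induction n with
    | zero => exact h
    | succ n ih => rw [Function.iterate_succ_apply']; exact t_mem_of ih (hc n)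
  refine ⟨Nat.find hex, ?_, Nat.find_spec hex⟩
  intro j hj
  refine ⟨?_, Nat.find_min hex hj⟩
  induction j with
  | zero => exact h
  | succ n ih =>
    rw [Function.iterate_succ_apply']
    exact t_mem_of (ih (by omega)) (Nat.find_min hex (by omega))

lemma shift {a b : V} (h : T.Arrow a b) (ha : ¬ T.Proj a) (hb : ¬ T.Proj b) :
    T.Arrow (T.t a) (T.t b) :=
  T.mesh_l (T.mesh_l h (T.t_spec hb)) (T.t_spec ha)

lemma shift_k {a b : V} (h : T.Arrow a b) (k : ℕ) (ha : ∀ j < k, ¬ T.Proj ((T.t)^[j] a))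
    (hb : ∀ j < k, ¬ T.Proj ((T.t)^[j] b)) : T.Arrow ((T.t)^[k] a) ((T.t)^[k] b) := by
  induction k with
  | zero => exact h
  | succ k ih =>
    rw [Function.iterate_succ_apply', Function.iterate_succ_apply']
    exact shift (ih (fun j hj => ha j (by omega)) (fun j hj => hb j (by omega)))
      (ha k (by omega)) (hb k (by omega))

lemma Bl_fin (hG : T.Good Γ) : (T.Bl Γ).Finite := by
  have h1 : T.Bl Γ ⊆ {x | T.Proj x} ∪ {y | y ∈ T.Bl Γ ∧ ¬ T.Proj y} := fun y hy => by
    by_cases h : T.Proj y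
    · exact Or.inl h
    · exact Or.inr ⟨hy, h⟩
  refine (T.fin_proj.union (T.rigid _ (fun y hy => hy.2) ?_)).subset h1
  rintro x ⟨hx, hx'⟩ y ⟨hy, hy'⟩ z hz hxz
  obtain ⟨hyΓ, h | ⟨z', hz', hzΓ⟩⟩ := hy
  · exact hy' h
  have : z' = z := T.tau_fun hz' hz
  subst this
  obtain ⟨e, heΓ, he⟩ := hG.pred y hyΓ
  exact hzΓ (hG.between x hx.1 z' e heΓ (.single hxz) (.single (T.hom_of_arrow (T.mesh_l he hz))))

/-- Arrows within the set `Ls`. -/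
def AL (T : TQ V) (Γ : Set V) (a b : V) : Prop := a ∈ T.Ls Γ ∧ b ∈ T.Ls Γ ∧ T.Arrow a b

lemma AL_t {a b : V} (h : T.AL Γ a b) : T.AL Γ (T.t a) (T.t b) :=
  ⟨Ls_t h.1, Ls_t h.2.1, shift h.2.2 (Ls_np h.1) (Ls_np h.2.1)⟩

lemma AL_tk {a b : V} (h : T.AL Γ a b) (k : ℕ) : T.AL Γ ((T.t)^[k] a) ((T.t)^[k] b) := by
  induction k with
  | zero => exact h
  | succ k ih => rw [Function.iterate_succ_apply', Function.iterate_succ_apply']; exact AL_t ih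

lemma RTG_tk {a b : V} (h : ReflTransGen (T.AL Γ) a b) (k : ℕ) :
    ReflTransGen (T.AL Γ) ((T.t)^[k] a) ((T.t)^[k] b) := by
  induction h with
  | refl => exact .refl
  | tail _ h ih => exact ih.tail (AL_tk h k)

lemma TG_tk {a b : V} (h : TransGen (T.AL Γ) a b) (k : ℕ) :
    TransGen (T.AL Γ) ((T.t)^[k] a) ((T.t)^[k] b) := by
  induction h with
  | single h => exact .single (AL_tk h k)
  | tail _ h ih => exact ih.tail (AL_tk h k)

lemma AL_back {a b : V} (h : T.AL Γ a b) : T.AL Γ (T.t b) a :=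
  ⟨Ls_t h.2.1, h.1, T.mesh_l h.2.2 (T.t_spec (Ls_np h.2.1))⟩

lemma RTG_back {u w : V} (h : ReflTransGen (T.AL Γ) u w) :
    ∃ a, ReflTransGen (T.AL Γ) ((T.t)^[a] w) u := by
  induction h with
  | refl => exact ⟨0, .refl⟩
  | @tail b c _ h ih =>
    obtain ⟨a, ha⟩ := ih
    refine ⟨a + 1, .head ?_ ha⟩
    rw [Function.iterate_succ_apply]
    exact AL_tk (AL_back h) a

lemma Ls_t_inj {x y : V} (hx : x ∈ T.Ls Γ) (hy : y ∈ T.Ls Γ) (h : T.t x = T.t y) : x = y := by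
  have h1 := T.t_spec (Ls_np hx)
  rw [h] at h1
  exact T.tau_inj h1 (T.t_spec (Ls_np hy))

lemma Ls_tk_inj (k : ℕ) : ∀ {x y : V}, x ∈ T.Ls Γ → y ∈ T.Ls Γ →
    (T.t)^[k] x = (T.t)^[k] y → x = y := by
  induction k with
  | zero => intro x y _ _ h; exact h
  | succ k ih =>
    intro x y hx hy h
    rw [Function.iterate_succ_apply, Function.iterate_succ_apply] at h
    exact Ls_t_inj hx hy (ih (Ls_t hx) (Ls_t hy) h)

lemma orbit_inj {x : V} (hx : x ∈ T.Ls Γ) (hn : ∀ n, 0 < n → (T.t)^[n] x ≠ x) :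
    Function.Injective (fun n => (T.t)^[n] x) := by
  have aux : ∀ n m, n < m → (T.t)^[n] x ≠ (T.t)^[m] x := by
    intro n m h e
    obtain ⟨k, rfl⟩ : ∃ k, m = n + k := ⟨m - n, by omega⟩
    rw [Function.iterate_add_apply] at e
    exact hn k (by omega) (Ls_tk_inj n hx (Ls_tk hx k) e).symm
  intro n m e
  rcases lt_trichotomy n m with h | h | h
  · exact (aux n m h e).elim
  · exact h
  · exact (aux m n h e.symm).elim

/-- Steps within the set `Ls`. -/
def SL (T : TQ V) (Γ : Set V) (a b : V) : Prop :=
  a ∈ T.Ls Γ ∧ b ∈ T.Ls Γ ∧ (T.Arrow a b ∨ T.Arrow b a)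

lemma SL_of_AL {a b : V} (h : ReflTransGen (T.AL Γ) a b) : ReflTransGen (T.SL Γ) a b :=
  rtg_mono (fun _ _ h => ⟨h.1, h.2.1, Or.inl h.2.2⟩) h

lemma SL_symm {a b : V} (h : ReflTransGen (T.SL Γ) a b) : ReflTransGen (T.SL Γ) b a :=
  rtg_mono (fun _ _ h => ⟨h.2.1, h.1, h.2.2.symm⟩) (rtg_op h)

/-- The conclusion of the combinatorial argument. -/
def Out (T : TQ V) (Γ : Set V) : Prop :=
  ∃ w x, {y | ReflTransGen (T.SL Γ) w y ∧ y ∈ Γ}.Infinite ∧ w ∈ T.Ls Γ ∧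
    ReflTransGen (T.SL Γ) w x ∧ TransGen (T.AL Γ) x x

lemma exists_good_start (hG : T.Good Γ) {x : V} (hx : x ∈ T.Ls Γ)
    (hn : ∀ n, 0 < n → (T.t)^[n] x ≠ x) :
    ∃ n0, ∀ n, n0 ≤ n → ∀ y ∈ Γ, (T.Arrow y ((T.t)^[n] x) ∨ T.Arrow ((T.t)^[n] x) y) →
      y ∈ T.Ls Γ := by
  have hfin : {z | ∃ b ∈ T.Bl Γ, T.Arrow b z ∨ T.Arrow z b}.Finite := by
    have : {z | ∃ b ∈ T.Bl Γ, T.Arrow b z ∨ T.Arrow z b} =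
        ⋃ b ∈ T.Bl Γ, ({z | T.Arrow b z} ∪ {z | T.Arrow z b}) := by
      ext z; simp
    rw [this]
    exact (Bl_fin hG).biUnion fun b _ => (T.fin_succ b).union (T.fin_pred b)
  have hfin2 := hfin.preimage (orbit_inj hx hn).injOn
  obtain ⟨N, hN⟩ := hfin2.bddAbove
  refine ⟨N + 1, fun n hn y hy hadj => ?_⟩
  by_contra hyL
  obtain ⟨k, hk1, hk2⟩ := not_Ls hy hyL
  have hxj : ∀ j < k, ¬ T.Proj ((T.t)^[j] ((T.t)^[n] x)) := fun j _ => Ls_np (Ls_tk (Ls_tk hx n) j)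
  have hyj : ∀ j < k, ¬ T.Proj ((T.t)^[j] y) := fun j hj => not_proj_of (hk1 j hj).1 (hk1 j hj).2
  have e : (T.t)^[k] ((T.t)^[n] x) = (T.t)^[k + n] x := by rw [Function.iterate_add_apply]
  have : k + n ∈ (fun n => (T.t)^[n] x) ⁻¹' {z | ∃ b ∈ T.Bl Γ, T.Arrow b z ∨ T.Arrow z b} := by
    refine ⟨_, hk2, ?_⟩
    show T.Arrow _ ((T.t)^[k + n] x) ∨ T.Arrow ((T.t)^[k + n] x) _
    rw [← e]
    rcases hadj with h | h
    · exact Or.inl (shift_k h k hyj hxj)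
    · exact Or.inr (shift_k h k hxj hyj)
  have := hN this
  omega

lemma case1 (hG : T.Good Γ) {x : V} (hx : x ∈ T.Ls Γ)
    (hn : ∀ n, 0 < n → (T.t)^[n] x ≠ x) : T.Out Γ := by
  obtain ⟨n0, hn0⟩ := exists_good_start hG hx hn
  have hinj := orbit_inj hx hn
  obtain ⟨x0, hx0, hnb, hinj⟩ : ∃ x0 ∈ T.Ls Γ, (∀ y ∈ Γ, T.Arrow y x0 → y ∈ T.Ls Γ) ∧
      Function.Injective (fun n => (T.t)^[n] x0) := by
    refine ⟨(T.t)^[n0] x, Ls_tk hx _, fun y hy h => hn0 n0 le_rfl y hy (Or.inl h), ?_⟩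
    intro n m e
    simp only [← Function.iterate_add_apply] at e
    have := hinj e
    omega
  have hstep0 : TransGen (T.AL Γ) (T.t x0) x0 := by
    obtain ⟨e, heΓ, he⟩ := hG.pred x0 (Ls_sub hx0)
    have : T.AL Γ e x0 := ⟨hnb e heΓ he, hx0, he⟩
    exact .head (AL_back this) (.single this)
  have hstep : ∀ n j, TransGen (T.AL Γ) ((T.t)^[n + (j + 1)] x0) ((T.t)^[n] x0) := by
    intro n j
    induction j with
    | zero => have := TG_tk hstep0 n; rwa [← Function.iterate_succ_apply] at this
    | succ j ih =>
      have := TG_tk hstep0 (n + (j + 1))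
      rw [← Function.iterate_succ_apply] at this
      exact this.trans ih
  have hstep' : ∀ n j, ReflTransGen (T.AL Γ) ((T.t)^[n + j] x0) ((T.t)^[n] x0) := by
    intro n j
    cases j with
    | zero => exact .refl
    | succ j => exact (hstep n j).to_reflTransGen
  have fin : ∀ z, TransGen (T.AL Γ) z z → ReflTransGen (T.SL Γ) x0 z → T.Out Γ := by
    intro z hz h
    refine ⟨x0, z, ?_, hx0, h, hz⟩
    refine (Set.infinite_range_of_injective hinj).mono ?_
    rintro _ ⟨n, rfl⟩
    have := hstep' 0 n
    rw [zero_add] at this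
    exact ⟨SL_symm (SL_of_AL this), Ls_sub (Ls_tk hx0 n)⟩
  by_cases hret : ∃ n, ReflTransGen (T.AL Γ) x0 ((T.t)^[n + 1] x0)
  · obtain ⟨n, hn⟩ := hret
    have := hstep 0 n
    rw [zero_add] at this
    exact fin x0 (TransGen.trans_right hn this) .refl
  push Not at hret
  set Nb : Set V := {z | z ∈ T.Ls Γ ∧ ∃ b ∈ T.Bl Γ, T.Arrow b z} with hNb
  have hNbfin : Nb.Finite := by
    refine ((Bl_fin hG).biUnion fun b _ => T.fin_succ b).subset ?_
    rintro z ⟨_, b, hb, h⟩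
    simp only [Set.mem_iUnion]
    exact ⟨b, hb, h⟩
  have claim : ∀ y ∈ T.Ls Γ, ReflTransGen (T.AL Γ) x0 y ∨
      ∃ z ∈ Nb, ∃ k, ReflTransGen (T.AL Γ) z ((T.t)^[k] y) := by
    intro y hy
    have hp := hG.conn x0 (Ls_sub hx0) y (Ls_sub hy)
    induction hp with
    | refl => exact Or.inl .refl
    | @tail b c _ hbc ih =>
      obtain ⟨hb, hc, h⟩ := hbc
      by_cases hbL : b ∈ T.Ls Γ
      · rcases ih hbL with h1 | ⟨z, hz, k, h1⟩
        · exact Or.inl (h1.tail ⟨hbL, hy, h⟩)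
        · exact Or.inr ⟨z, hz, k, h1.tail (AL_tk ⟨hbL, hy, h⟩ k)⟩
      · obtain ⟨k, hk1, hk2⟩ := not_Ls hb hbL
        refine Or.inr ⟨(T.t)^[k] c, ⟨Ls_tk hy k, _, hk2, ?_⟩, k, .refl⟩
        exact shift_k h k (fun j hj => not_proj_of (hk1 j hj).1 (hk1 j hj).2)
          (fun j _ => Ls_np (Ls_tk hy j))
  have claim2 : ∀ n, ∃ m, n ≤ m ∧ ∃ z ∈ Nb, ReflTransGen (T.AL Γ) z ((T.t)^[m] x0) := by
    intro n
    rcases claim ((T.t)^[n + 1] x0) (Ls_tk hx0 _) with h | ⟨z, hz, k, h⟩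
    · exact (hret n h).elim
    · rw [← Function.iterate_add_apply] at h
      exact ⟨_, by omega, z, hz, h⟩
  have claim3 : ∃ z ∈ Nb, {m | ReflTransGen (T.AL Γ) z ((T.t)^[m] x0)}.Infinite := by
    by_contra hc
    push Not at hc
    have : (⋃ z ∈ Nb, {m | ReflTransGen (T.AL Γ) z ((T.t)^[m] x0)}).Finite :=
      hNbfin.biUnion fun z hz => by simpa using hc z hz
    obtain ⟨N, hN⟩ := this.bddAbove
    obtain ⟨m, hm, z, hz, h⟩ := claim2 (N + 1)
    have : m ≤ N := hN (by simp only [Set.mem_iUnion]; exact ⟨z, hz, h⟩)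
    omega
  obtain ⟨z, hz, hinf⟩ := claim3
  obtain ⟨M, hM⟩ := hinf.nonempty
  obtain ⟨a, ha⟩ := RTG_back hM
  rw [← Function.iterate_add_apply] at ha
  obtain ⟨M', hM', hlt⟩ := hinf.exists_gt (a + M)
  obtain ⟨j, rfl⟩ : ∃ j, M' = (a + M) + (j + 1) := ⟨M' - (a + M) - 1, by omega⟩
  have hcyc : TransGen (T.AL Γ) z z :=
    (TransGen.trans_right hM' (hstep (a + M) j)).trans_left ha
  refine fin z hcyc ?_
  have := hstep' 0 M
  rw [zero_add] at this
  exact SL_symm (SL_of_AL (ReflTransGen.trans hM this))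

lemma case3 (hG : T.Good Γ) (hinf : Γ.Infinite) (hfin : (Γ \ T.Ls Γ).Finite)
    (hper : ∀ x ∈ T.Ls Γ, ∃ n, 0 < n ∧ (T.t)^[n] x = x) : T.Out Γ := by
  have hLinf : (T.Ls Γ).Infinite := by
    intro h
    exact hinf ((hfin.union h).subset fun x hx => by
      by_cases h : x ∈ T.Ls Γ
      · exact Or.inr h
      · exact Or.inl ⟨hx, h⟩)
  obtain ⟨w0, hw0⟩ := hLinf.nonempty
  set N : Set V := {z | (z ∈ T.Ls Γ ∧ ∃ b ∈ Γ \ T.Ls Γ, T.Arrow b z) ∨ z = w0} with hN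
  have hNfin : N.Finite := by
    refine ((hfin.biUnion fun b _ => T.fin_succ b).union (Set.finite_singleton w0)).subset ?_
    rintro z (⟨_, b, hb, h⟩ | rfl)
    · left
      simp only [Set.mem_iUnion]
      exact ⟨b, hb, h⟩
    · exact Or.inr rfl
  have claim : ∀ y ∈ T.Ls Γ, ∃ z ∈ N, ReflTransGen (T.SL Γ) z y := by
    intro y hy
    have hp := hG.conn w0 (Ls_sub hw0) y (Ls_sub hy)
    induction hp with
    | refl => exact ⟨w0, Or.inr rfl, .refl⟩
    | @tail b c _ hbc ih =>
      obtain ⟨hb, hc, h⟩ := hbc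
      by_cases hbL : b ∈ T.Ls Γ
      · obtain ⟨z, hz, h1⟩ := ih hbL
        exact ⟨z, hz, h1.tail ⟨hbL, hy, Or.inl h⟩⟩
      · exact ⟨c, Or.inl ⟨hy, b, ⟨hb, hbL⟩, h⟩, .refl⟩
  have claim3 : ∃ z ∈ N, {y | ReflTransGen (T.SL Γ) z y ∧ y ∈ T.Ls Γ}.Infinite := by
    by_contra hc
    push Not at hc
    have : (⋃ z ∈ N, {y | ReflTransGen (T.SL Γ) z y ∧ y ∈ T.Ls Γ}).Finite :=
      hNfin.biUnion fun z hz => by simpa using hc z hz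
    refine hLinf (this.subset fun y hy => ?_)
    obtain ⟨z, hz, h⟩ := claim y hy
    simp only [Set.mem_iUnion]
    exact ⟨z, hz, h, hy⟩
  obtain ⟨z, hz, hzinf⟩ := claim3
  have hzL : z ∈ T.Ls Γ := by
    rcases hz with h | rfl
    · exact h.1
    · exact hw0
  have cyc : ∀ a b, T.AL Γ a b → TransGen (T.AL Γ) b b := by
    intro a b h
    have h1 : TransGen (T.AL Γ) (T.t b) b := .head (AL_back h) (.single h)
    have h2 : ∀ n, TransGen (T.AL Γ) ((T.t)^[n + 1] b) b := by
      intro n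
      induction n with
      | zero => exact h1
      | succ n ih =>
        have := TG_tk h1 (n + 1)
        rw [← Function.iterate_succ_apply] at this
        exact this.trans ih
    obtain ⟨p, hp, e⟩ := hper b h.2.1
    obtain ⟨q, rfl⟩ : ∃ q, p = q + 1 := ⟨p - 1, by omega⟩
    have := h2 q
    rwa [e] at this
  obtain ⟨y, hy, hyz⟩ := (hzinf.sdiff (Set.finite_singleton z)).nonempty
  rcases ReflTransGen.cases_head hy.1 with e | ⟨c, hc, _⟩
  · exact (hyz e.symm).elim
  have hinf' := hzinf.mono (t := {y | ReflTransGen (T.SL Γ) z y ∧ y ∈ Γ})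
    fun y hy => ⟨hy.1, Ls_sub hy.2⟩
  rcases hc.2.2 with h | h
  · exact ⟨z, c, hinf', hzL, .single hc, cyc z c ⟨hc.1, hc.2.1, h⟩⟩
  · exact ⟨z, z, hinf', hzL, .refl, cyc c z ⟨hc.2.1, hc.1, h⟩⟩

lemma op_iter {x : V} (n : ℕ) (h : ∀ j < n, ¬ T.Proj ((T.t)^[j] x)) :
    ∀ i ≤ n, (T.op.t)^[i] ((T.t)^[n] x) = (T.t)^[n - i] x := by
  intro i
  induction i with
  | zero => intro _; rfl
  | succ i ih =>
    intro hi
    rw [Function.iterate_succ_apply', ih (by omega)]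
    have e : n - i = (n - (i + 1)) + 1 := by omega
    rw [e, Function.iterate_succ_apply']
    exact T.op_t (T.t_spec (h _ (by omega)))

lemma rest_fin (hG : T.Good Γ) : (Γ \ (T.Ls Γ ∪ T.op.Ls Γ)).Finite := by
  have hcov : (Γ \ (T.Ls Γ ∪ T.op.Ls Γ)) ⊆ ⋃ b ∈ T.Bl Γ, (fun n => (T.op.t)^[n] b) ''
      {n | (∀ i < n, (T.op.t)^[i] b ∉ T.op.Bl Γ) ∧ ∃ m, (T.op.t)^[n + m] b ∈ T.op.Bl Γ} := by
    rintro x ⟨hx, hx'⟩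
    have h1 : x ∉ T.Ls Γ := fun h => hx' (Or.inl h)
    have h2 : x ∉ T.op.Ls Γ := fun h => hx' (Or.inr h)
    obtain ⟨n, hn1, hn2⟩ := not_Ls hx h1
    obtain ⟨m, hm1, hm2⟩ := not_Ls hx h2
    have hnp : ∀ j < n, ¬ T.Proj ((T.t)^[j] x) := fun j hj => not_proj_of (hn1 j hj).1 (hn1 j hj).2
    have hop := op_iter (T := T) n hnp
    simp only [Set.mem_iUnion]
    refine ⟨_, hn2, n, ⟨?_, m, ?_⟩, ?_⟩
    · intro i hi
      rw [hop i hi.le]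
      have e : n - i = (n - (i + 1)) + 1 := by omega
      have ht := T.t_spec (hnp (n - (i + 1)) (by omega))
      rw [← Function.iterate_succ_apply' T.t, Nat.succ_eq_add_one, ← e] at ht
      rintro ⟨_, h | ⟨z, hz, hzΓ⟩⟩
      · exact T.tau_not_inj ht h
      · have : z = (T.t)^[n - (i + 1)] x := T.tau_inj hz ht
        rw [this] at hzΓ
        exact hzΓ (hn1 _ (by omega)).1
    · rw [add_comm, Function.iterate_add_apply, hop n le_rfl]
      simpa using hm2
    · show (T.op.t)^[n] _ = x
      rw [hop n le_rfl]; simp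
  refine ((Bl_fin hG).biUnion fun b _ => Set.Finite.image _ ?_).subset hcov
  by_cases hne : {n | (∀ i < n, (T.op.t)^[i] b ∉ T.op.Bl Γ) ∧
      ∃ m, (T.op.t)^[n + m] b ∈ T.op.Bl Γ}.Nonempty
  · obtain ⟨n0, hn0, m0, hm0⟩ := hne
    refine (Set.finite_le_nat (n0 + m0)).subset ?_
    rintro n ⟨hn, _⟩
    by_contra hc
    replace hc : n0 + m0 < n := not_le.1 hc
    exact hn _ hc hm0
  · rw [Set.not_nonempty_iff_eq_empty] at hne
    rw [hne]; exact Set.finite_empty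

lemma main (hG : T.Good Γ) (hinf : Γ.Infinite) : T.Out Γ ∨ T.op.Out Γ := by
  by_cases h1 : ∃ x ∈ T.Ls Γ, ∀ n, 0 < n → (T.t)^[n] x ≠ x
  · obtain ⟨x, hx, h⟩ := h1
    exact Or.inl (case1 hG hx h)
  by_cases h2 : ∃ x ∈ T.op.Ls Γ, ∀ n, 0 < n → (T.op.t)^[n] x ≠ x
  · obtain ⟨x, hx, h⟩ := h2
    exact Or.inr (case1 hG.op hx h)
  push Not at h1 h2
  left
  refine case3 hG hinf ?_ h1
  refine (rest_fin hG).subset ?_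
  rintro x ⟨hx, hxL⟩
  refine ⟨hx, ?_⟩
  rintro (h | h)
  · exact hxL h
  · apply hxL
    -- periodic elements of the right part
    have key : ∀ y ∈ T.op.Ls Γ, y ∉ T.Bl Γ ∧ T.t y ∈ T.op.Ls Γ := by
      intro y hy
      obtain ⟨n, hn, e⟩ := h2 y hy
      obtain ⟨q, rfl⟩ : ∃ q, n = q + 1 := ⟨n - 1, by omega⟩
      rw [Function.iterate_succ_apply'] at e
      have hq := Ls_tk hy q
      have ht := T.op.t_spec (Ls_np hq)
      rw [e] at ht
      have ht' : T.Tau ((T.op.t)^[q] y) y := ht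
      refine ⟨?_, by rw [T.t_eq ht']; exact hq⟩
      rintro ⟨_, h | ⟨z, hz, hzΓ⟩⟩
      · exact T.tau_not_proj ht' h
      · rw [T.tau_fun hz ht'] at hzΓ
        exact hzΓ (Ls_sub hq)
    have key2 : ∀ n, (T.t)^[n] x ∈ T.op.Ls Γ := by
      intro n
      induction n with
      | zero => exact h
      | succ n ih => rw [Function.iterate_succ_apply']; exact (key _ ih).2
    intro n
    exact ⟨Ls_sub (key2 n), (key _ (key2 n)).1⟩

end TQ

end ARx

/-! ## Part 3: basic module theory -/

namespace ARx


variable {R : Type u} [Ring R]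

instance instNoeth (X : ModA R) : IsNoetherian R X.M :=
  (isFiniteLength_iff_isNoetherian_isArtinian.mp X.finLen).1

instance instArt (X : ModA R) : IsArtinian R X.M :=
  (isFiniteLength_iff_isNoetherian_isArtinian.mp X.finLen).2

/-- Bundle a noetherian artinian module. -/
abbrev mkA (R : Type u) [Ring R] (M : Type u) [AddCommGroup M] [Module R M] [IsNoetherian R M]
    [IsArtinian R M] : ModA R :=
  ⟨M, isFiniteLength_iff_isNoetherian_isArtinian.mpr ⟨inferInstance, inferInstance⟩⟩

abbrev Indec (X : ModA R) : Prop := IsIndecMod R X.M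

lemma unit_iff {M : Type u} [AddCommGroup M] [Module R M] (f : Module.End R M) :
    IsUnit f ↔ Function.Bijective f := Module.End.isUnit_iff f

/-- Fitting. -/
lemma fitting {X : ModA R} (hX : X.IsIndec) (f : Module.End R X.M) :
    IsNilpotent f ∨ Function.Bijective f := by
  obtain ⟨n, hn⟩ := Filter.eventually_atTop.1 (LinearMap.eventually_isCompl_ker_pow_range_pow f)
  have h := hn (n + 1) (by omega)
  have hid := Submodule.isIdempotentElem_projection h
  rcases hX.2 _ hid with h0 | h1
  · right
    have hker : LinearMap.ker (f ^ (n + 1)) = ⊥ := by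
      rw [← Submodule.range_projection h, h0]; exact LinearMap.range_zero
    have hr : LinearMap.range (f ^ (n + 1)) = ⊤ := by
      rw [← Submodule.ker_projection h, h0]; exact LinearMap.ker_zero
    have : IsUnit (f ^ (n + 1)) :=
      (unit_iff _).2 ⟨LinearMap.ker_eq_bot.1 hker, LinearMap.range_eq_top.1 hr⟩
    exact (unit_iff _).1 ((isUnit_pow_iff (by omega)).1 this)
  · left
    refine ⟨n + 1, ?_⟩
    have : LinearMap.ker (f ^ (n + 1)) = ⊤ := by
      rw [← Submodule.range_projection h, h1]; exact LinearMap.range_eq_top.2 fun x => ⟨x, rfl⟩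
    exact LinearMap.ker_eq_top.1 this

lemma not_nilp_bij {X : ModA R} (hX : X.IsIndec) {f : Module.End R X.M} (h : IsNilpotent f)
    (h' : Function.Bijective f) : False := by
  have := hX.1
  exact ((unit_iff f).2 h').ne_zero (by
    have hu := (unit_iff f).2 h'
    obtain ⟨n, hn⟩ := h
    have := hu.pow n
    rw [hn] at this
    exact absurd this not_isUnit_zero)

/-- Local-ness -/
lemma sum_bij {X : ModA R} (hX : X.IsIndec) {a b : Module.End R X.M}
    (h : Function.Bijective (a + b)) : Function.Bijective a ∨ Function.Bijective b := by
  obtain ⟨u, hu⟩ := (unit_iff _).2 h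
  rcases fitting hX (↑u⁻¹ * a) with h1 | h1
  · right
    have : IsUnit (1 - ↑u⁻¹ * a) := h1.isUnit_one_sub
    have e : ↑u⁻¹ * b = 1 - ↑u⁻¹ * a := by
      have : (↑u⁻¹ : Module.End R X.M) * (a + b) = 1 := by rw [← hu]; simp
      rw [mul_add] at this
      rw [← this]; abel
    rw [← e] at this
    rw [← unit_iff]
    exact (Units.isUnit_units_mul _ _).1 this
  · left
    rw [← unit_iff] at h1 ⊢
    exact (Units.isUnit_units_mul _ _).1 h1

lemma fsum_bij {X : ModA R} (hX : X.IsIndec) {I : Type*} (s : Finset I) (a : I → Module.End R X.M)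
    (h : Function.Bijective (∑ i ∈ s, a i : Module.End R X.M)) :
    ∃ i ∈ s, Function.Bijective (a i) := by
  classical
  induction s using Finset.induction_on with
  | empty =>
    rw [Finset.sum_empty] at h
    exact (not_nilp_bij hX ⟨1, by simp⟩ h).elim
  | insert i s hi ih =>
    rw [Finset.sum_insert hi] at h
    rcases sum_bij hX h with h | h
    · exact ⟨i, Finset.mem_insert_self _ _, h⟩
    · obtain ⟨j, hj, hb⟩ := ih h
      exact ⟨j, Finset.mem_insert_of_mem hj, hb⟩

/-- if `g ∘ f` is bijective with nontrivial source and indecomposable middle term, both are. -/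
lemma comp_bij {X Y : Type u} [AddCommGroup X] [Module R X] [AddCommGroup Y] [Module R Y]
    [Nontrivial X] (hY : IsIndecMod R Y) {f : X →ₗ[R] Y} {g : Y →ₗ[R] X}
    (h : Function.Bijective (g.comp f)) : Function.Bijective f ∧ Function.Bijective g := by
  set e := LinearEquiv.ofBijective _ h with he
  have hes : ∀ x, e.symm (g (f x)) = x := fun x => e.symm_apply_apply x
  have hes' : ∀ x, g (f (e.symm x)) = x := fun x => e.apply_symm_apply x
  rcases hY.2 (f.comp (e.symm.toLinearMap.comp g)) (by ext y; simp [hes]) with h0 | h1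
  · exfalso
    obtain ⟨x, hx⟩ := exists_ne (0 : X)
    apply hx
    have := LinearMap.congr_fun h0 (f x)
    simp [hes] at this
    have h2 := hes x
    rw [this] at h2; simpa using h2.symm
  · have h1' : ∀ y, f (e.symm (g y)) = y := fun y => LinearMap.congr_fun h1 y
    refine ⟨⟨fun a b hab => ?_, fun y => ⟨_, h1' y⟩⟩, ⟨fun a b hab => ?_, fun x => ⟨_, hes' x⟩⟩⟩
    · rw [← hes a, ← hes b, hab]
    · rw [← h1' a, ← h1' b, hab]

lemma splitMono_bij {X Y : ModA R} (hX : X.IsIndec) (hY : Y.IsIndec) {f : X.M →ₗ[R] Y.M}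
    (h : SplitMonoMap f) : Function.Bijective f := by
  obtain ⟨r, hr⟩ := h
  have := hX.1
  exact (comp_bij hY (f := f) (g := r) (by rw [hr]; exact Function.bijective_id)).1

lemma splitEpi_bij {X Y : ModA R} (hX : X.IsIndec) (hY : Y.IsIndec) {f : X.M →ₗ[R] Y.M}
    (h : SplitEpiMap f) : Function.Bijective f := by
  obtain ⟨r, hr⟩ := h
  have := hY.1
  exact (comp_bij hX (f := r) (g := f) (by rw [hr]; exact Function.bijective_id)).2

lemma bij_splitMono {X Y : ModA R} {f : X.M →ₗ[R] Y.M} (h : Function.Bijective f) :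
    SplitMonoMap f :=
  ⟨(LinearEquiv.ofBijective f h).symm, by ext x; exact (LinearEquiv.ofBijective f h).symm_apply_apply x⟩

lemma bij_splitEpi {X Y : ModA R} {f : X.M →ₗ[R] Y.M} (h : Function.Bijective f) :
    SplitEpiMap f :=
  ⟨(LinearEquiv.ofBijective f h).symm, by ext x; exact (LinearEquiv.ofBijective f h).apply_symm_apply x⟩

lemma indec_of_equiv {X Y : ModA R} (hX : X.IsIndec) (e : X.M ≃ₗ[R] Y.M) : Y.IsIndec := by
  refine ⟨have := hX.1; e.symm.toEquiv.nontrivial, fun f hf => ?_⟩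
  have hf' : ∀ y, f (f y) = f y := fun y => LinearMap.congr_fun hf y
  rcases hX.2 (e.symm.toLinearMap.comp (f.comp e.toLinearMap)) (by ext x; simp [hf']) with h | h
  · left
    ext y
    have := LinearMap.congr_fun h (e.symm y)
    simpa using this
  · right
    ext y
    have := LinearMap.congr_fun h (e.symm y)
    simpa using this

/-- Decomposition into indecomposables. -/
structure Dec (X : ModA R) where
  I : Type
  [fI : Fintype I]
  [dI : DecidableEq I]
  Z : I → ModA R
  indec : ∀ i, (Z i).IsIndec
  ι : ∀ i, (Z i).M →ₗ[R] X.M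
  π : ∀ i, X.M →ₗ[R] (Z i).M
  one : ∀ i, (π i).comp (ι i) = LinearMap.id
  orth : ∀ i j, i ≠ j → (π i).comp (ι j) = 0
  total : ∑ i, (ι i).comp (π i) = LinearMap.id

attribute [instance] Dec.fI Dec.dI

lemma Dec.one' {X : ModA R} (D : Dec X) (i : D.I) (x : (D.Z i).M) : D.π i (D.ι i x) = x :=
  LinearMap.congr_fun (D.one i) x

lemma Dec.orth' {X : ModA R} (D : Dec X) {i j : D.I} (h : i ≠ j) (x : (D.Z j).M) :
    D.π i (D.ι j x) = 0 := LinearMap.congr_fun (D.orth i j h) x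

lemma Dec.total' {X : ModA R} (D : Dec X) (x : X.M) : ∑ i, D.ι i (D.π i x) = x := by
  have := LinearMap.congr_fun D.total x
  simpa using this

lemma exists_dec (X : ModA R) : Nonempty (Dec X) := by
  suffices H : ∀ n : ℕ, ∀ X : ModA R, Module.length R X.M ≤ n → Nonempty (Dec X) by
    obtain ⟨n, hn⟩ := ENat.ne_top_iff_exists.1 (Module.length_ne_top (R := R) (M := X.M))
    exact H n X hn.symm.le
  intro n
  induction n with
  | zero =>
    intro X h
    have : Subsingleton X.M := Module.length_eq_zero_iff.1 (le_antisymm h bot_le)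
    exact ⟨⟨Empty, fun i => i.elim, fun i => i.elim, fun i => i.elim, fun i => i.elim,
      fun i => i.elim, fun i => i.elim, by ext x; exact Subsingleton.elim _ _⟩⟩
  | succ n ih =>
    intro X h
    by_cases hX : X.IsIndec
    · exact ⟨⟨Unit, fun _ => X, fun _ => hX, fun _ => LinearMap.id, fun _ => LinearMap.id,
        fun _ => rfl, fun i j hij => (hij rfl).elim, by simp⟩⟩
    by_cases hs : Subsingleton X.M
    · exact ⟨⟨Empty, fun i => i.elim, fun i => i.elim, fun i => i.elim, fun i => i.elim,
        fun i => i.elim, fun i => i.elim, by ext x; exact Subsingleton.elim _ _⟩⟩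
    have hnt : Nontrivial X.M := not_subsingleton_iff_nontrivial.1 hs
    obtain ⟨f, hf, hf0, hf1⟩ : ∃ f : Module.End R X.M, f * f = f ∧ f ≠ 0 ∧ f ≠ 1 := by
      by_contra hc
      push Not at hc
      exact hX ⟨hnt, fun f hf => by by_contra hh; push Not at hh; exact hh.2 (hc f hf hh.1)⟩
    have hf' : ∀ x, f (f x) = f x := fun x => LinearMap.congr_fun hf x
    have hP : LinearMap.range f ≠ ⊤ := fun ht => hf1 (by
      ext x
      obtain ⟨y, rfl⟩ := LinearMap.range_eq_top.1 ht x
      exact hf' y)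
    have hQ : LinearMap.ker f ≠ ⊤ := fun ht => hf0 (LinearMap.ker_eq_top.1 ht)
    have hlt : ∀ N : Submodule R X.M, N ≠ ⊤ → Module.length R N ≤ n := fun N hN => by
      have h1 := (Submodule.length_lt hN).trans_le h
      exact ENat.lt_coe_add_one_iff.1 (by exact_mod_cast h1)
    obtain ⟨D1⟩ := ih (mkA R (LinearMap.range f)) (hlt _ hP)
    obtain ⟨D2⟩ := ih (mkA R (LinearMap.ker f)) (hlt _ hQ)
    let q : X.M →ₗ[R] LinearMap.ker f := (LinearMap.id - f).codRestrict _ (fun x => by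
      simp [hf'])
    let p : X.M →ₗ[R] LinearMap.range f := f.rangeRestrict
    have hp1 : ∀ x : LinearMap.range f, p x = x := by
      rintro ⟨_, y, rfl⟩; apply Subtype.ext; exact hf' y
    have hp2 : ∀ x : LinearMap.ker f, p x = 0 := by
      rintro ⟨y, hy⟩; apply Subtype.ext; exact hy
    have hq1 : ∀ x : LinearMap.range f, q x = 0 := by
      rintro ⟨_, y, rfl⟩; apply Subtype.ext; simp [q, hf']
    have hq2 : ∀ x : LinearMap.ker f, q x = x := by
      rintro ⟨y, hy⟩; apply Subtype.ext
      have hy' : f y = 0 := hy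
      simp [q, hy']
    refine ⟨⟨D1.I ⊕ D2.I, Sum.elim D1.Z D2.Z, ?_, Sum.rec (fun i => (LinearMap.range f).subtype.comp (D1.ι i))
      (fun i => (LinearMap.ker f).subtype.comp (D2.ι i)), Sum.rec (fun i => (D1.π i).comp p)
      (fun i => (D2.π i).comp q), ?_, ?_, ?_⟩⟩
    · rintro (i | i)
      · exact D1.indec i
      · exact D2.indec i
    · rintro (i | i) <;> ext x
      · show D1.π i (p (D1.ι i x)) = x
        rw [hp1]; exact D1.one' i x
      · show D2.π i (q (D2.ι i x)) = x
        rw [hq2]; exact D2.one' i x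
    · rintro (i | i) (j | j) hij <;> ext x
      · show D1.π i (p (D1.ι j x)) = 0
        rw [hp1]; exact D1.orth' (fun e => hij (by rw [e])) x
      · show D1.π i (p (D2.ι j x)) = 0
        rw [hp2]; simp
      · show D2.π i (q (D1.ι j x)) = 0
        rw [hq1]; simp
      · show D2.π i (q (D2.ι j x)) = 0
        rw [hq2]; exact D2.orth' (fun e => hij (by rw [e])) x
    · rw [Fintype.sum_sum_type]
      ext x
      have h1 : ∑ i, ((D1.ι i (D1.π i (p x)) : LinearMap.range f) : X.M) = f x := by
        have h := congrArg (LinearMap.range f).subtype (D1.total' (p x))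
        rw [map_sum] at h
        exact h
      have h2 : ∑ i, ((D2.ι i (D2.π i (q x)) : LinearMap.ker f) : X.M) = x - f x := by
        have h := congrArg (LinearMap.ker f).subtype (D2.total' (q x))
        rw [map_sum] at h
        exact h
      simp only [LinearMap.add_apply, LinearMap.sum_apply, LinearMap.comp_apply, LinearMap.id_apply]
      refine (congrArg₂ (· + ·) h1 h2).trans ?_
      simp

end ARx

/-! ## Part 4: pushouts and almost split sequences -/

namespace ARx


variable {R : Type u} [Ring R]

section
variable {X Y Z : Type*} [AddCommGroup X] [Module R X] [AddCommGroup Y] [Module R Y]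
  [AddCommGroup Z] [Module R Z]

lemma factor_surj {q : X →ₗ[R] Y} (hq : Function.Surjective q) {φ : X →ₗ[R] Z}
    (h : ∀ x, q x = 0 → φ x = 0) : ∃ ψ : Y →ₗ[R] Z, ψ.comp q = φ := by
  refine ⟨((LinearMap.ker q).liftQ φ h).comp (q.quotKerEquivOfSurjective hq).symm.toLinearMap, ?_⟩
  ext x
  have : (q.quotKerEquivOfSurjective hq).symm (q x) = Submodule.Quotient.mk x := by
    rw [LinearEquiv.symm_apply_eq]; rfl
  simp only [LinearMap.comp_apply, LinearEquiv.coe_coe, this]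
  rfl

lemma factor_inj {i : Y →ₗ[R] Z} (hi : Function.Injective i) {φ : X →ₗ[R] Z}
    (h : ∀ x, ∃ y, i y = φ x) : ∃ ψ : X →ₗ[R] Y, i.comp ψ = φ := by
  refine ⟨(LinearEquiv.ofInjective i hi).symm.toLinearMap.comp (φ.codRestrict (LinearMap.range i) h), ?_⟩
  ext x
  have := congrArg Subtype.val ((LinearEquiv.ofInjective i hi).apply_symm_apply
    (φ.codRestrict (LinearMap.range i) h x))
  exact this
end

section
variable {N W C : Type*} [AddCommGroup N] [Module R N] [AddCommGroup W] [Module R W]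
  [AddCommGroup C] [Module R C]

lemma retr_of_sec {i : N →ₗ[R] W} {q : W →ₗ[R] C} (hi : Function.Injective i)
    (hex : LinearMap.range i = LinearMap.ker q) {s : C →ₗ[R] W} (hs : q.comp s = LinearMap.id) :
    ∃ r : W →ₗ[R] N, r.comp i = LinearMap.id := by
  have hs' : ∀ c, q (s c) = c := fun c => LinearMap.congr_fun hs c
  have hqi : ∀ x, q (i x) = 0 := fun x => by
    have : i x ∈ LinearMap.ker q := hex ▸ ⟨x, rfl⟩
    exact this
  obtain ⟨r, hr⟩ := factor_inj hi (φ := LinearMap.id - s.comp q) (fun x => by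
    have : (LinearMap.id - s.comp q : W →ₗ[R] W) x ∈ LinearMap.range i := by
      rw [hex]; simp [hs']
    exact this)
  refine ⟨r, ?_⟩
  ext x
  apply hi
  have := LinearMap.congr_fun hr (i x)
  simp [hqi] at this
  exact this

lemma sec_of_retr {i : N →ₗ[R] W} {q : W →ₗ[R] C} (hq : Function.Surjective q)
    (hex : LinearMap.range i = LinearMap.ker q) {r : W →ₗ[R] N} (hr : r.comp i = LinearMap.id) :
    ∃ s : C →ₗ[R] W, q.comp s = LinearMap.id := by
  have hr' : ∀ c, r (i c) = c := fun c => LinearMap.congr_fun hr c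
  have hqi : ∀ x, q (i x) = 0 := fun x => by
    have : i x ∈ LinearMap.ker q := hex ▸ ⟨x, rfl⟩
    exact this
  obtain ⟨s, hs⟩ := factor_surj hq (φ := LinearMap.id - i.comp r) (fun x hx => by
    have : x ∈ LinearMap.range i := by rw [hex]; exact hx
    obtain ⟨y, rfl⟩ := this
    simp [hr'])
  refine ⟨s, ?_⟩
  ext c
  obtain ⟨w, rfl⟩ := hq c
  have := congrArg q (LinearMap.congr_fun hs w)
  simp [hqi] at this
  exact this
end

/-- Short exact sequences in `mod R`. -/
structure SES {N M C : ModA R} (f : N.M →ₗ[R] M.M) (g : M.M →ₗ[R] C.M) : Prop where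
  inj : Function.Injective f
  surj : Function.Surjective g
  exact : LinearMap.range f = LinearMap.ker g

namespace SES
variable {N M C : ModA R} {f : N.M →ₗ[R] M.M} {g : M.M →ₗ[R] C.M} (h : SES f g)
include h

lemma zero (x : N.M) : g (f x) = 0 := by
  have : f x ∈ LinearMap.ker g := h.exact ▸ ⟨x, rfl⟩
  exact this

lemma comp_zero : g.comp f = 0 := LinearMap.ext h.zero

lemma lift {Z : ModA R} {φ : Z.M →ₗ[R] M.M} (hφ : g.comp φ = 0) :
    ∃ ψ : Z.M →ₗ[R] N.M, f.comp ψ = φ := factor_inj h.inj (fun x => by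
  have : φ x ∈ LinearMap.range f := by rw [h.exact]; exact LinearMap.congr_fun hφ x
  exact this)

lemma desc {Z : ModA R} {φ : M.M →ₗ[R] Z.M} (hφ : φ.comp f = 0) :
    ∃ ψ : C.M →ₗ[R] Z.M, ψ.comp g = φ := factor_surj h.surj (fun x hx => by
  have : x ∈ LinearMap.range f := by rw [h.exact]; exact hx
  obtain ⟨y, rfl⟩ := this
  exact LinearMap.congr_fun hφ y)

lemma splitMono (hs : SplitEpiMap g) : SplitMonoMap f := by
  obtain ⟨s, hs⟩ := hs
  exact retr_of_sec h.inj h.exact hs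

lemma splitEpi (hs : SplitMonoMap f) : SplitEpiMap g := by
  obtain ⟨s, hs⟩ := hs
  exact sec_of_retr h.surj h.exact hs

/-- Pushout. -/
lemma push {N' : ModA R} (k : N.M →ₗ[R] N'.M) : ∃ (W : ModA R) (i : N'.M →ₗ[R] W.M)
    (q : W.M →ₗ[R] C.M) (j : M.M →ₗ[R] W.M), SES i q ∧ q.comp j = g ∧ j.comp f = i.comp k := by
  let ρ : N.M →ₗ[R] N'.M × M.M := k.prod (-f)
  let S := LinearMap.range ρ
  refine ⟨mkA R ((N'.M × M.M) ⧸ S), S.mkQ.comp (LinearMap.inl R _ _),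
    S.liftQ (g.comp (LinearMap.snd R _ _)) ?_, S.mkQ.comp (LinearMap.inr R _ _), ⟨?_, ?_, ?_⟩, ?_, ?_⟩
  · rintro _ ⟨x, rfl⟩
    show g (-f x) = 0
    rw [map_neg, h.zero, neg_zero]
  · rw [← LinearMap.ker_eq_bot, LinearMap.ker_eq_bot']
    intro x hx
    have : ((x, 0) : N'.M × M.M) ∈ S := (Submodule.Quotient.mk_eq_zero S).1 hx
    obtain ⟨y, hy⟩ := this
    have h2 : -f y = 0 := congrArg Prod.snd hy
    have h1 : k y = x := congrArg Prod.fst hy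
    have : y = 0 := h.inj (by rw [map_zero]; exact neg_eq_zero.1 h2)
    rw [← h1, this, map_zero]
  · intro c
    obtain ⟨m, rfl⟩ := h.surj c
    exact ⟨S.mkQ (0, m), rfl⟩
  · ext w
    obtain ⟨⟨a, m⟩, rfl⟩ := S.mkQ_surjective w
    constructor
    · rintro ⟨y, hy⟩
      rw [← hy]
      show g 0 = 0
      simp
    · intro hw
      have hm : g m = 0 := hw
      have : m ∈ LinearMap.range f := by rw [h.exact]; exact hm
      obtain ⟨y, rfl⟩ := this
      refine ⟨a + k y, ?_⟩
      show S.mkQ (a + k y, 0) = S.mkQ (a, f y)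
      rw [← sub_eq_zero, ← map_sub]
      refine (Submodule.Quotient.mk_eq_zero S).2 ⟨y, ?_⟩
      simp [ρ]
  · ext m; rfl
  · ext x
    show S.mkQ (0, f x) = S.mkQ (k x, 0)
    rw [← sub_eq_zero, ← map_sub]
    refine (Submodule.Quotient.mk_eq_zero S).2 ⟨-x, ?_⟩
    simp [ρ]

/-- Right almost split implies left almost split. -/
lemma left_almost (hN : N.IsIndec) (hns : ¬ SplitEpiMap g)
    (hr : ∀ (Z : ModA R) (k : Z.M →ₗ[R] C.M), ¬ SplitEpiMap k → ∃ k' : Z.M →ₗ[R] M.M, g.comp k' = k)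
    (Z : ModA R) (k : N.M →ₗ[R] Z.M) (hk : ¬ SplitMonoMap k) :
    ∃ k' : M.M →ₗ[R] Z.M, k'.comp f = k := by
  obtain ⟨W, i, q, j, hW, hqj, hjf⟩ := h.push k
  by_cases hq : SplitEpiMap q
  · obtain ⟨r, hr⟩ := hW.splitMono hq
    refine ⟨r.comp j, ?_⟩
    rw [LinearMap.comp_assoc, hjf, ← LinearMap.comp_assoc, hr, LinearMap.id_comp]
  exfalso
  obtain ⟨q', hq'⟩ := hr W q hq
  obtain ⟨m, hm⟩ := h.lift (φ := q'.comp j - LinearMap.id) (by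
    rw [LinearMap.comp_sub, ← LinearMap.comp_assoc, hq', hqj, LinearMap.comp_id, sub_self])
  obtain ⟨l, hl⟩ := h.lift (φ := q'.comp i) (by
    rw [← LinearMap.comp_assoc, hq', hW.comp_zero])
  have e1 : ∀ x, f (l (k x)) = q' (j (f x)) := fun x => by
    have a1 := LinearMap.congr_fun hl (k x)
    have a2 := LinearMap.congr_fun hjf x
    simp only [LinearMap.comp_apply] at a1 a2
    rw [a1, a2]
  have e2 : ∀ x, f (m (f x)) = q' (j (f x)) - f x := fun x => LinearMap.congr_fun hm (f x)
  have e3 : ∀ x, m (f x) = l (k x) - x := fun x => h.inj (by rw [e2, map_sub, e1])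
  rcases fitting hN (l.comp k) with h1 | h1
  · have hu := h1.isUnit_one_sub
    obtain ⟨v, hv⟩ := hu
    apply hns
    apply h.splitEpi
    refine ⟨-((↑v⁻¹ : Module.End R N.M).comp m), ?_⟩
    ext x
    have e4 : m (f x) = -((1 - l.comp k : Module.End R N.M) x) := by
      rw [e3]; simp
    have e5 : (↑v⁻¹ : Module.End R N.M) ((v : Module.End R N.M) x) = x := by
      rw [← Module.End.mul_apply]; simp
    simp only [LinearMap.neg_apply, LinearMap.comp_apply, e4, map_neg, neg_neg, LinearMap.id_apply]
    rw [← hv, e5]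
  · apply hk
    refine ⟨(LinearEquiv.ofBijective _ h1).symm.toLinearMap.comp l, ?_⟩
    ext x
    exact (LinearEquiv.ofBijective _ h1).symm_apply_apply x

end SES

/-- Constructor for almost split sequences. -/
def mkASS {N M C : ModA R} {f : N.M →ₗ[R] M.M} {g : M.M →ₗ[R] C.M} (h : SES f g) (hN : N.IsIndec)
    (hC : C.IsIndec) (hns : ¬ SplitEpiMap g)
    (hr : ∀ (Z : ModA R) (k : Z.M →ₗ[R] C.M), ¬ SplitEpiMap k →
      ∃ k' : Z.M →ₗ[R] M.M, g.comp k' = k) : AlmostSplitSeq R where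
  l := N
  m := M
  r := C
  f := f
  g := g
  inj := h.inj
  surj := h.surj
  exact := h.exact
  not_split := hns
  l_indec := hN
  r_indec := hC
  right_almost := hr
  left_almost := h.left_almost hN hns hr

lemma ASS_ses (s : AlmostSplitSeq R) : SES s.f s.g := ⟨s.inj, s.surj, s.exact⟩

end ARx

/-! ## Part 5: the Matlis module over a commutative artinian ring -/

namespace ARx


section hull
variable {K : Type u} [CommRing K]

lemma exists_injective_emb (S : Type u) [AddCommGroup S] [Module K S] :
    ∃ (Q : Type u) (_ : AddCommGroup Q) (_ : Module K Q) (_ : Module.Injective K Q)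
      (i : S →ₗ[K] Q), Function.Injective i := by
  have : CategoryTheory.EnoughInjectives (ModuleCat.{u} K) := inferInstance
  obtain ⟨⟨J, inj, f, mono⟩⟩ := this.presentation (ModuleCat.of K S)
  refine ⟨J, inferInstance, inferInstance, ?_, f.hom, ?_⟩
  · have : CategoryTheory.Injective (ModuleCat.of K J) := inj
    exact Module.injective_module_of_injective_object K J
  · exact (ModuleCat.mono_iff_injective f).1 mono

/-- Injective hulls, elementwise. -/
lemma exists_hull (S : Type u) [AddCommGroup S] [Module K S] :
    ∃ (E : Type u) (_ : AddCommGroup E) (_ : Module K E) (_ : Module.Injective K E)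
      (i : S →ₗ[K] E), Function.Injective i ∧
        ∀ x : E, x ≠ 0 → ∃ (a : K) (s : S), a • x = i s ∧ s ≠ 0 := by
  obtain ⟨Q, _, _, hQ, i, hi⟩ := exists_injective_emb (K := K) S
  let ess : Set (Submodule K Q) := {N | ∀ x ∈ N, x ≠ 0 → ∃ (a : K) (s : S), a • x = i s ∧ s ≠ 0}
  have hess0 : LinearMap.range i ∈ ess := by
    rintro _ ⟨s, rfl⟩ h
    exact ⟨1, s, by simp, fun e => h (by simp [e])⟩
  obtain ⟨E, hSE, hE⟩ := zorn_le_nonempty₀ ess (by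
    intro c hc hchain y hy
    refine ⟨sSup c, ?_, fun z hz => le_sSup hz⟩
    intro x hx h
    rw [Submodule.mem_sSup_of_directed ⟨y, hy⟩ hchain.directedOn] at hx
    obtain ⟨N, hN, hxN⟩ := hx
    exact hc hN x hxN h) _ hess0
  obtain ⟨N', -, hN'⟩ := zorn_le_nonempty₀ {N : Submodule K Q | ∀ x ∈ N, x ∈ E → x = 0} (by
    intro c hc hchain y hy
    refine ⟨sSup c, ?_, fun z hz => le_sSup hz⟩
    intro x hx h
    rw [Submodule.mem_sSup_of_directed ⟨y, hy⟩ hchain.directedOn] at hx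
    obtain ⟨N, hN, hxN⟩ := hx
    exact hc hN x hxN h) ⊥ (by intro x hx _; simpa using hx)
  obtain ⟨α, hα⟩ := hQ.out (N'.mkQ.comp E.subtype) (by
    rw [← LinearMap.ker_eq_bot, LinearMap.ker_eq_bot']
    rintro ⟨x, hx⟩ h
    have : x ∈ N' := (Submodule.Quotient.mk_eq_zero N').1 h
    exact Subtype.ext (hN'.prop x this hx)) E.subtype
  have hα' : ∀ x ∈ E, α (N'.mkQ x) = x := fun x hx => hα ⟨x, hx⟩
  have hEr : E ≤ LinearMap.range α := fun x hx => ⟨_, hα' x hx⟩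
  have hmem : LinearMap.range α ∈ ess := by
    rintro _ ⟨y, rfl⟩ h
    obtain ⟨q, rfl⟩ := N'.mkQ_surjective y
    have hq : q ∉ N' := fun hq => h (by
      have : N'.mkQ q = 0 := (Submodule.Quotient.mk_eq_zero N').2 hq
      rw [this, map_zero])
    have : ¬ (N' ⊔ Submodule.span K {q} : Submodule K Q) ∈
        {N : Submodule K Q | ∀ x ∈ N, x ∈ E → x = 0} := fun hm =>
      hq (hN'.le_of_ge hm le_sup_left (Submodule.mem_sup_right (Submodule.mem_span_singleton_self q)))
    have : ∃ x ∈ (N' ⊔ Submodule.span K {q} : Submodule K Q), x ∈ E ∧ x ≠ 0 := by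
      by_contra hc
      push Not at hc
      exact this hc
    obtain ⟨x, hx, hxE, hx0⟩ := this
    obtain ⟨n, hn, z, hz, rfl⟩ := Submodule.mem_sup.1 hx
    obtain ⟨a, rfl⟩ := Submodule.mem_span_singleton.1 hz
    have h1 : α (N'.mkQ (n + a • q)) = n + a • q := hα' _ hxE
    have h2 : N'.mkQ n = 0 := (Submodule.Quotient.mk_eq_zero N').2 hn
    rw [map_add, h2, zero_add, map_smul, map_smul] at h1
    obtain ⟨b, s, hs, hs0⟩ := hE.prop _ hxE hx0
    exact ⟨b * a, s, by rw [mul_smul, h1, hs], hs0⟩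
  have hrE : LinearMap.range α ≤ E := hE.le_of_ge hmem hEr
  let ρ : Q →ₗ[K] E := (α.comp N'.mkQ).codRestrict E (fun x => hrE ⟨_, rfl⟩)
  have hρ : ∀ x : E, ρ x = x := fun x => Subtype.ext (hα' x x.2)
  refine ⟨E, inferInstance, inferInstance, ⟨?_⟩, i.codRestrict E (fun s => hSE ⟨s, rfl⟩), ?_, ?_⟩
  · intro X Y _ _ _ _ f hf g
    obtain ⟨h, hh⟩ := hQ.out f hf (E.subtype.comp g)
    refine ⟨ρ.comp h, fun x => ?_⟩
    rw [LinearMap.comp_apply, hh]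
    exact hρ _
  · intro a b h
    exact hi (congrArg Subtype.val h)
  · rintro ⟨x, hx⟩ h
    obtain ⟨a, s, h1, h2⟩ := hE.prop x hx (fun e => h (Subtype.ext e))
    exact ⟨a, s, Subtype.ext h1, h2⟩

end hull

/-- Defining properties of the Matlis module. -/
structure Matlis (K : Type u) [CommRing K] (E : Type u) [AddCommGroup E] [Module K E] : Prop where
  inj : Module.Injective K E
  cogen : ∀ m : Ideal K, m.IsMaximal → ∃ e : E, e ≠ 0 ∧ ∀ a ∈ m, a • e = 0
  uniq : ∀ m : Ideal K, m.IsMaximal → ∀ e e' : E, e ≠ 0 → (∀ a ∈ m, a • e = 0) →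
    (∀ a ∈ m, a • e' = 0) → ∃ b : K, e' = b • e

lemma exists_matlis (K : Type u) [CommRing K] [IsArtinianRing K] :
    ∃ (E : Type u) (_ : AddCommGroup E) (_ : Module K E), Matlis K E := by
  set J : Ideal K := nilradical K with hJ
  obtain ⟨E, _, _, hinj, i, hi, hess⟩ := exists_hull (K := K) (K ⧸ J)
  have hred : ∀ x : K, x * x ∈ J → x ∈ J := fun x hx => by
    rw [mem_nilradical] at hx ⊢
    rw [← pow_two] at hx
    obtain ⟨n, hn⟩ := hx
    exact ⟨2 * n, by rw [pow_mul, hn]⟩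
  have key : ∀ m : Ideal K, m.IsMaximal → ∀ x y : K, x ∉ J → (∀ a ∈ m, a * x ∈ J) →
      (∀ a ∈ m, a * y ∈ J) → ∃ b, y - b * x ∈ J := by
    intro m hm x y hx h1 h2
    have hxm : x ∉ m := fun h => hx (hred x (h1 x h))
    obtain ⟨a, ha⟩ := hm.exists_inv hxm
    obtain ⟨c, hc, hac⟩ := ha
    refine ⟨a * y, ?_⟩
    have := h2 c hc
    have e : y - a * y * x = c * y := by
      have : c = 1 - a * x := by rw [← hac]; ring
      rw [this]; ring
    rw [e]; exact this
  have ess2 : ∀ m : Ideal K, m.IsMaximal → ∀ e : E, e ≠ 0 → (∀ a ∈ m, a • e = 0) →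
      ∃ x : K, x ∉ J ∧ i (Submodule.Quotient.mk x) = e ∧ ∀ a ∈ m, a * x ∈ J := by
    intro m hm e he hme
    obtain ⟨a, s, h1, h2⟩ := hess e he
    have ham : a ∉ m := fun h => h2 (hi (by rw [← h1, hme a h, map_zero]))
    obtain ⟨b, c, hc, hbc⟩ := hm.exists_inv ham
    have h3 : i (b • s) = e := by
      rw [map_smul, ← h1, ← mul_smul]
      have : b * a = 1 - c := by rw [← hbc]; ring
      rw [this, sub_smul, one_smul, hme c hc, sub_zero]
    obtain ⟨x, hx⟩ := Submodule.Quotient.mk_surjective J (b • s)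
    refine ⟨x, ?_, by rw [hx, h3], fun a' ha' => ?_⟩
    · intro hxJ
      apply he
      rw [← h3, ← hx, (Submodule.Quotient.mk_eq_zero J).2 hxJ, map_zero]
    · have h4 : i (a' • Submodule.Quotient.mk x) = 0 := by rw [map_smul, hx, h3, hme a' ha']
      have h5 : (a' • Submodule.Quotient.mk x : K ⧸ J) = 0 := hi (by rw [h4, map_zero])
      rw [← Submodule.Quotient.mk_smul] at h5
      exact (Submodule.Quotient.mk_eq_zero J).1 h5
  refine ⟨E, inferInstance, inferInstance, hinj, ?_, ?_⟩
  · intro m hm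
    -- find x killed by m modulo J and not in J
    have : ∃ x : K, x ∉ J ∧ ∀ a ∈ m, a * x ∈ J := by
      have hfin : Finite (MaximalSpectrum K) := inferInstance
      have : Fintype (MaximalSpectrum K) := Fintype.ofFinite _
      classical
      set s : Finset (MaximalSpectrum K) := Finset.univ.filter (fun p => p.asIdeal ≠ m) with hs
      have hp : ∀ p ∈ s, ∃ x ∈ p.asIdeal, x ∉ m := by
        intro p hp
        by_contra hc
        push Not at hc
        exact (Finset.mem_filter.1 hp).2 (p.isMaximal.eq_of_le hm.ne_top hc)
      choose! f hf1 hf2 using hp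
      have hxm : ∏ p ∈ s, f p ∉ m := by
        intro h
        have := hm.isPrime
        obtain ⟨p, hp, h⟩ := (Ideal.IsPrime.prod_mem_iff (p := m)).1 h
        exact hf2 p hp h
      have hJle : ∀ p : Ideal K, p.IsPrime → J ≤ p := fun p hp => nilradical_le_prime p
      refine ⟨∏ p ∈ s, f p, fun h => hxm (hJle m hm.isPrime h), fun a ha => ?_⟩
      rw [hJ, nilradical_eq_sInf, Ideal.mem_sInf]
      intro p hp
      have hp' : p.IsPrime := hp
      have hpm : p.IsMaximal := inferInstance
      by_cases e : p = m
      · rw [e]; exact m.mul_mem_right _ ha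
      · refine p.mul_mem_left _ ?_
        refine Ideal.mem_of_dvd p (Finset.dvd_prod_of_mem f (a := ⟨p, hpm⟩) ?_) (hf1 ⟨p, hpm⟩ ?_)
        all_goals exact Finset.mem_filter.2 ⟨Finset.mem_univ _, e⟩
    obtain ⟨x, hx, hxm⟩ := this
    refine ⟨i (Submodule.Quotient.mk x), fun h => hx ?_, fun a ha => ?_⟩
    · exact (Submodule.Quotient.mk_eq_zero J).1 (hi (by rw [h, map_zero]))
    · rw [← map_smul, ← Submodule.Quotient.mk_smul, (Submodule.Quotient.mk_eq_zero J).2, map_zero]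
      exact hxm a ha
  · intro m hm e e' he hme hme'
    by_cases he' : e' = 0
    · exact ⟨0, by rw [he', zero_smul]⟩
    obtain ⟨x, hx, rfl, hxm⟩ := ess2 m hm e he hme
    obtain ⟨y, hy, rfl, hym⟩ := ess2 m hm e' he' hme'
    obtain ⟨b, hb⟩ := key m hm x y hx hxm hym
    refine ⟨b, ?_⟩
    rw [← map_smul, ← Submodule.Quotient.mk_smul]
    congr 1
    exact (Submodule.Quotient.eq J).2 hb

end ARx

/-! ## Part 6: Matlis duality -/

namespace ARx


section
variable {K : Type u} [CommRing K] {E : Type u} [AddCommGroup E] [Module K E]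

lemma inj_ext (hE : Module.Injective K E) {X Y : Type u} [AddCommGroup X] [Module K X]
    [AddCommGroup Y] [Module K Y] (f : X →ₗ[K] Y) (v : X →ₗ[K] E) (h : ∀ x, f x = 0 → v x = 0) :
    ∃ w : Y →ₗ[K] E, ∀ x, w (f x) = v x := by
  obtain ⟨v', hv'⟩ := factor_surj (q := f.rangeRestrict) f.surjective_rangeRestrict (φ := v)
    (fun x hx => h x (congrArg Subtype.val hx))
  obtain ⟨w, hw⟩ := hE.out (LinearMap.range f).subtype (Submodule.subtype_injective _) v'
  exact ⟨w, fun x => by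
    exact (hw (f.rangeRestrict x)).trans (LinearMap.congr_fun hv' x)⟩

lemma Matlis.sep (hE : Matlis K E) {X : Type u} [AddCommGroup X] [Module K X] {x : X} (hx : x ≠ 0) :
    ∃ χ : X →ₗ[K] E, χ x ≠ 0 := by
  have hne : LinearMap.ker (LinearMap.toSpanSingleton K X x) ≠ ⊤ := by
    intro h
    have : (1 : K) ∈ LinearMap.ker (LinearMap.toSpanSingleton K X x) := by rw [h]; trivial
    simp at this
    exact hx this
  obtain ⟨m, hm, hle⟩ := Ideal.exists_le_maximal _ hne
  obtain ⟨e, he, hme⟩ := hE.cogen m hm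
  obtain ⟨w, hw⟩ := inj_ext hE.inj (LinearMap.toSpanSingleton K X x)
    (LinearMap.toSpanSingleton K E e) (fun a ha => by
      simpa using hme a (hle ha))
  refine ⟨w, ?_⟩
  have := hw 1
  simp at this
  rw [this]; exact he

lemma Matlis.len_simple (hE : Matlis K E) (X : Type u) [AddCommGroup X] [Module K X]
    [IsSimpleModule K X] : Module.length K (X →ₗ[K] E) ≤ 1 := by
  rcases subsingleton_or_nontrivial (X →ₗ[K] E) with h | h
  · rw [Module.length_eq_zero_iff.2 h]; exact zero_le
  suffices IsSimpleModule K (X →ₗ[K] E) by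
    rw [Module.length_eq_one]
  have := IsSimpleModule.nontrivial K X
  obtain ⟨x, hx⟩ := exists_ne (0 : X)
  have hspan := IsSimpleModule.toSpanSingleton_surjective K hx
  have hm : Ideal.IsMaximal (LinearMap.ker (LinearMap.toSpanSingleton K X x)) :=
    IsSimpleModule.ker_toSpanSingleton_isMaximal K hx
  rw [isSimpleModule_iff_toSpanSingleton_surjective]
  refine ⟨h, fun χ hχ χ' => ?_⟩
  have hz : ∀ (χ : X →ₗ[K] E), ∀ a ∈ LinearMap.ker (LinearMap.toSpanSingleton K X x),
      a • χ x = 0 := by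
    intro χ a ha
    rw [← map_smul]
    have : a • x = 0 := by simpa using ha
    rw [this, map_zero]
  have hχx : χ x ≠ 0 := by
    intro h0
    apply hχ
    ext y
    obtain ⟨a, rfl⟩ := hspan y
    simp [h0]
  obtain ⟨b, hb⟩ := hE.uniq _ hm (χ x) (χ' x) hχx (hz χ) (hz χ')
  refine ⟨b, ?_⟩
  ext y
  obtain ⟨a, rfl⟩ := hspan y
  simp [hb]

lemma Matlis.len_le (hE : Matlis K E) (X : Type u) [AddCommGroup X] [Module K X]
    (hX : IsFiniteLength K X) : Module.length K (X →ₗ[K] E) ≤ Module.length K X := by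
  induction hX with
  | of_subsingleton =>
    rename_i M _ _ _
    have : Subsingleton (M →ₗ[K] E) := inferInstance
    rw [Module.length_eq_zero_iff.2 this]; exact zero_le
  | of_simple_quotient h ih =>
    rename_i M _ _ N _
    have e1 := Module.length_eq_add_of_exact N.subtype N.mkQ N.subtype_injective N.mkQ_surjective
      (LinearMap.exact_subtype_mkQ N)
    have hq : Module.length K (M ⧸ N) = 1 := Module.length_eq_one K _
    let r : (M →ₗ[K] E) →ₗ[K] (N →ₗ[K] E) := LinearMap.lcomp K E N.subtype
    have e2 := Module.length_eq_add_of_exact (LinearMap.ker r).subtype r.rangeRestrict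
      (Submodule.subtype_injective _) r.surjective_rangeRestrict (by
        intro x; simp [LinearMap.rangeRestrict, LinearMap.codRestrict])
    have e3 : Module.length K (LinearMap.range r) ≤ Module.length K N :=
      (Module.length_le_of_injective _ (Submodule.subtype_injective _)).trans ih
    have hle := hE.len_simple (M ⧸ N)
    have e4 : Module.length K (LinearMap.ker r) ≤ 1 := by
      refine le_trans ?_ hle
      have hf : ∀ x ∈ LinearMap.ker r, N ≤ LinearMap.ker x := fun x hx y hy =>
        LinearMap.congr_fun (show r x = 0 from hx) ⟨y, hy⟩
      let l : LinearMap.ker r →ₗ[K] ((M ⧸ N) →ₗ[K] E) :=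
        { toFun := fun x => N.liftQ x.1 (hf x.1 x.2)
          map_add' := fun x y => by ext z; simp
          map_smul' := fun x y => by ext z; simp }
      refine Module.length_le_of_injective l ?_
      intro x y hxy
      apply Subtype.ext
      ext z
      exact LinearMap.congr_fun hxy (N.mkQ z)
    rw [e1, e2, hq, add_comm]
    exact add_le_add e3 e4

lemma fl_of_len {M : Type u} [AddCommGroup M] [Module K M] (h : Module.length K M ≠ ⊤) :
    IsFiniteLength K M := Module.length_ne_top_iff.1 h

lemma Matlis.dual_fl (hE : Matlis K E) (X : Type u) [AddCommGroup X] [Module K X]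
    (hX : IsFiniteLength K X) : IsFiniteLength K (X →ₗ[K] E) :=
  fl_of_len (ne_top_of_le_ne_top (Module.length_ne_top_iff.2 hX) (hE.len_le X hX))

lemma surj_of_len {X Y : Type u} [AddCommGroup X] [Module K X] [AddCommGroup Y] [Module K Y]
    (f : X →ₗ[K] Y) (hf : Function.Injective f) (hl : Module.length K Y ≤ Module.length K X)
    (hX : IsFiniteLength K X) : Function.Surjective f := by
  have e2 := Module.length_eq_add_of_exact f (LinearMap.range f).mkQ hf
    (Submodule.mkQ_surjective _) (by intro x; simp [LinearMap.mem_range])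
  have hfin := Module.length_ne_top_iff.2 hX
  have h0 : Module.length K (Y ⧸ LinearMap.range f) = 0 := by
    rw [e2] at hl
    generalize Module.length K (Y ⧸ LinearMap.range f) = b at *
    generalize Module.length K X = a at *
    have : a + b ≤ a + 0 := by simpa using hl
    exact le_antisymm (by simpa using (ENat.add_le_add_iff_left hfin).1 this) (zero_le)
  rw [Module.length_eq_zero_iff] at h0
  rw [← LinearMap.range_eq_top]
  exact Submodule.Quotient.subsingleton_iff.1 h0

lemma Matlis.refl (hE : Matlis K E) (X : Type u) [AddCommGroup X] [Module K X]
    (hX : IsFiniteLength K X) (Φ : (X →ₗ[K] E) →ₗ[K] E) : ∃ x : X, ∀ χ : X →ₗ[K] E, Φ χ = χ x := by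
  let ev : X →ₗ[K] ((X →ₗ[K] E) →ₗ[K] E) := LinearMap.id.flip
  have h1 : Function.Injective ev := by
    rw [← LinearMap.ker_eq_bot, LinearMap.ker_eq_bot']
    intro x hx
    by_contra h
    obtain ⟨χ, hχ⟩ := hE.sep h
    exact hχ (LinearMap.congr_fun hx χ)
  obtain ⟨x, hx⟩ := surj_of_len ev h1
    ((hE.len_le _ (hE.dual_fl X hX)).trans (hE.len_le X hX)) hX Φ
  exact ⟨x, fun χ => by rw [← hx]; rfl⟩

end

end ARx

/-! ## Part 7: the transpose-dual and almost split extensions -/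

namespace ARx


section
variable (K : Type u) [CommRing K] (R : Type u) [Ring R] [Algebra K R]
  (E : Type u) [AddCommGroup E] [Module K E]

/-- The dual of the regular right module, as a left module. -/
def DR : Type u := R →ₗ[K] E

instance : AddCommGroup (DR K R E) := inferInstanceAs (AddCommGroup (R →ₗ[K] E))
instance : Module K (DR K R E) := inferInstanceAs (Module K (R →ₗ[K] E))

variable {K R E}
/-- Evaluation. -/
def DR.ev (φ : DR K R E) : R →ₗ[K] E := φ

lemma DR.ext {φ ψ : DR K R E} (h : ∀ s, φ.ev s = ψ.ev s) : φ = ψ := LinearMap.ext h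

lemma DR.ev_add (φ ψ : DR K R E) (s : R) : (φ + ψ).ev s = φ.ev s + ψ.ev s := rfl
lemma DR.ev_zero (s : R) : (0 : DR K R E).ev s = 0 := rfl
lemma DR.ev_ksmul (k : K) (φ : DR K R E) (s : R) : (k • φ).ev s = k • φ.ev s := rfl

instance : Module R (DR K R E) where
  smul r φ := φ.ev.comp (LinearMap.mulRight K r)
  one_smul φ := DR.ext fun s => by
    show φ.ev (s * 1) = _
    rw [mul_one]
  mul_smul a b φ := DR.ext fun s => by
    show φ.ev (s * (a * b)) = φ.ev ((s * a) * b)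
    rw [mul_assoc]
  smul_zero a := rfl
  smul_add a φ ψ := rfl
  add_smul a b φ := DR.ext fun s => by
    show φ.ev (s * (a + b)) = φ.ev (s * a) + φ.ev (s * b)
    rw [mul_add, map_add]
  zero_smul φ := DR.ext fun s => by
    show φ.ev (s * 0) = 0
    rw [mul_zero, map_zero]

lemma DR.ev_smul (r : R) (φ : DR K R E) (s : R) : (r • φ).ev s = φ.ev (s * r) := rfl

instance : IsScalarTower K R (DR K R E) where
  smul_assoc k r φ := DR.ext fun s => by
    show φ.ev (s * (k • r)) = k • φ.ev (s * r)
    rw [mul_smul_comm, map_smul]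

/-- action of a matrix on tuples -/
def dact {m n : ℕ} (d : Fin m → Fin n → R) (Z : Type u) [AddCommGroup Z] [Module R Z] [Module K Z]
    [IsScalarTower K R Z] : (Fin n → Z) →ₗ[K] (Fin m → Z) where
  toFun z i := ∑ j, d i j • z j
  map_add' z w := by ext i; simp [Finset.sum_add_distrib]
  map_smul' k z := by
    ext i
    simp only [Pi.smul_apply, RingHom.id_apply, Finset.smul_sum]
    exact Finset.sum_congr rfl fun j _ => by rw [smul_comm]

/-- The transpose dual. -/
def Nd (K : Type u) [CommRing K] [Algebra K R]
  (E : Type u) [AddCommGroup E] [Module K E] {m n : ℕ} (d : Fin m → Fin n → R) : Submodule R (Fin m → DR K R E) where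
  carrier := {φ | ∀ j s, ∑ i, (φ i).ev (d i j * s) = 0}
  zero_mem' := fun j s => by simp [DR.ev_zero]
  add_mem' := fun {a b} ha hb j s => by
    simp only [Pi.add_apply, DR.ev_add, Finset.sum_add_distrib, ha j s, hb j s, add_zero]
  smul_mem' := fun r φ h j s => by
    simp only [Pi.smul_apply, DR.ev_smul, mul_assoc, h j (s * r)]

lemma mem_Nd {m n : ℕ} {d : Fin m → Fin n → R} {φ : Fin m → DR K R E} :
    φ ∈ Nd K E d ↔ ∀ j s, ∑ i, (φ i).ev (d i j * s) = 0 := Iff.rfl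

section
variable {m n : ℕ} {d : Fin m → Fin n → R} {Z : Type u} [AddCommGroup Z] [Module R Z] [Module K Z]
    [IsScalarTower K R Z]

/-- from functionals to maps -/
lemma toNd (w : (Fin m → Z) →ₗ[K] E) (hw : ∀ z, w (dact (K := K) d Z z) = 0) :
    ∃ ψ : Z →ₗ[R] Nd K E d, ∀ z : Fin m → Z, ∑ i, ((ψ (z i)).1 i).ev 1 = w z := by
  have key : ∀ (z : Z) (j : Fin n) (s : R), ∑ i, w (Pi.single i ((d i j * s) • z)) = 0 := by
    intro z j s
    have := hw (Pi.single j (s • z))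
    rw [← this, ← map_sum]
    congr 1
    ext i
    simp [dact, Finset.sum_apply, Pi.single_apply, mul_smul]
  refine ⟨{ toFun := fun z => ⟨fun i =>
              ((w.comp (LinearMap.single K (fun _ => Z) i)).comp
                (LinearMap.toSpanSingleton R Z z |>.restrictScalars K) : R →ₗ[K] E), ?_⟩
            map_add' := ?_, map_smul' := ?_ }, ?_⟩
  · intro j s
    exact key z j s
  · intro a b
    apply Subtype.ext
    funext i
    apply DR.ext
    intro s
    show w (Pi.single i (s • (a + b))) = w (Pi.single i (s • a)) + w (Pi.single i (s • b))
    rw [smul_add, Pi.single_add, map_add]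
  · intro r a
    apply Subtype.ext
    funext i
    apply DR.ext
    intro s
    show w (Pi.single i (s • (r • a))) = w (Pi.single i ((s * r) • a))
    rw [mul_smul]
  · intro z
    show ∑ i, w (Pi.single i ((1 : R) • z i)) = w z
    simp only [one_smul]
    rw [← map_sum, Finset.univ_sum_single]

/-- from maps to functionals -/
lemma ofNd (ψ : Z →ₗ[R] Nd K E d) :
    ∃ w : (Fin m → Z) →ₗ[K] E, (∀ z, w (dact (K := K) d Z z) = 0) ∧
      ∀ z : Fin m → Z, ∑ i, ((ψ (z i)).1 i).ev 1 = w z := by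
  refine ⟨{ toFun := fun z => ∑ i, ((ψ (z i)).1 i).ev 1, map_add' := ?_, map_smul' := ?_ }, ?_, ?_⟩
  · intro a b
    simp [DR.ev_add, Finset.sum_add_distrib]
  · intro k z
    rw [RingHom.id_apply, Finset.smul_sum]
    refine Finset.sum_congr rfl fun i _ => ?_
    have : ψ (k • z i) = k • ψ (z i) := by
      rw [← algebraMap_smul R k (z i), map_smul, algebraMap_smul]
    rw [Pi.smul_apply, this]
    rfl
  · intro z
    show ∑ i, ((ψ (∑ j, d i j • z j)).1 i).ev 1 = 0
    have : ∀ i, ((ψ (∑ j, d i j • z j)).1 i).ev 1 = ∑ j, ((ψ (z j)).1 i).ev (d i j * 1) := by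
      intro i
      have e : ψ (∑ j, d i j • z j) = ∑ j, d i j • ψ (z j) := by simp
      rw [e]
      have : ∀ s : Finset (Fin n), ((∑ j ∈ s, d i j • ψ (z j) : Nd K E d).1 i).ev 1 =
          ∑ j ∈ s, ((ψ (z j)).1 i).ev (d i j * 1) := by
        intro s
        classical
        induction s using Finset.induction_on with
        | empty => simp [DR.ev_zero]
        | insert a s ha ih =>
          rw [Finset.sum_insert ha, Finset.sum_insert ha, ← ih, Submodule.coe_add, Pi.add_apply,
            DR.ev_add]
          congr 1
          rw [Submodule.coe_smul, Pi.smul_apply, DR.ev_smul, one_mul, mul_one]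
      exact this _
    simp only [this]
    rw [Finset.sum_comm]
    exact Finset.sum_eq_zero fun j _ => (ψ (z j)).2 j 1
  · intro z; rfl

lemma Nd_ext {ψ ψ' : Z →ₗ[R] Nd K E d}
    (h : ∀ z : Fin m → Z, ∑ i, ((ψ (z i)).1 i).ev 1 = ∑ i, ((ψ' (z i)).1 i).ev 1) : ψ = ψ' := by
  refine LinearMap.ext fun z => ?_
  apply Subtype.ext
  funext i
  apply DR.ext
  intro s
  have := h (Pi.single i (s • z))
  have hs : ∀ ψ : Z →ₗ[R] Nd K E d, ∑ k, ((ψ (Pi.single (M := fun _ => Z) i (s • z) k)).1 k).ev 1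
      = ((ψ z).1 i).ev s := by
    intro ψ
    rw [Finset.sum_eq_single i]
    · rw [Pi.single_eq_same, map_smul, Submodule.coe_smul, Pi.smul_apply, DR.ev_smul, one_mul]
    · intro k _ hk
      rw [Pi.single_eq_of_ne hk]
      simp [DR.ev_zero]
    · simp
  rwa [hs, hs] at this

end

/-- extension criterion -/
lemma Nd_extend (hE : Module.Injective K E) {m n : ℕ} {d : Fin m → Fin n → R}
    {F : Type u} [AddCommGroup F] [Module R F] [Module K F] [IsScalarTower K R F]
    (Ω : Submodule R F) (ψ : Ω →ₗ[R] Nd K E d)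
    (h : ∀ (g : Fin n → F) (z : Fin m → Ω), (∀ i, dact (K := K) d F g i = z i) →
      ∑ i, ((ψ (z i)).1 i).ev 1 = 0) :
    ∃ θ : F →ₗ[R] Nd K E d, ∀ x : Ω, θ x = ψ x := by
  obtain ⟨w, hw, hψ⟩ := ofNd (K := K) ψ
  let T := LinearMap.range (dact (K := K) d F)
  let incl : (Fin m → Ω) →ₗ[K] (Fin m → F) :=
    { toFun := fun z i => z i, map_add' := fun _ _ => rfl, map_smul' := fun _ _ => rfl }
  obtain ⟨v, hv⟩ := inj_ext hE (T.mkQ.comp incl) w (by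
    intro z hz
    obtain ⟨g, hg⟩ := (Submodule.Quotient.mk_eq_zero T).1 hz
    rw [← hψ]
    exact h g z (fun i => congrFun hg i))
  obtain ⟨θ, hθ⟩ := toNd (K := K) (d := d) (v.comp T.mkQ) (fun z => by
    have : T.mkQ (dact (K := K) d F z) = 0 := (Submodule.Quotient.mk_eq_zero T).2 ⟨z, rfl⟩
    rw [LinearMap.comp_apply, this, map_zero])
  refine ⟨θ, ?_⟩
  have : θ.comp Ω.subtype = ψ := by
    apply Nd_ext (K := K)
    intro z
    rw [hψ, ← hv]
    exact hθ (fun i => z i)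
  exact fun x => LinearMap.congr_fun this x

/-- Presentations. -/
structure IsPres {m n : ℕ} (d : Fin m → Fin n → R) {C : Type u} [AddCommGroup C] [Module R C]
    (c : Fin n → C) : Prop where
  rel : ∀ i, ∑ j, d i j • c j = 0
  lift : ∀ (Z : Type u) [AddCommGroup Z] [Module R Z] (z : Fin n → Z), (∀ i, ∑ j, d i j • z j = 0) →
    ∃ a : C →ₗ[R] Z, ∀ j, a (c j) = z j
  span : Submodule.span R (Set.range c) = ⊤

lemma IsPres.hom_ext {m n : ℕ} {d : Fin m → Fin n → R} {C : Type u} [AddCommGroup C] [Module R C]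
    {c : Fin n → C} (h : IsPres d c) {Z : Type u} [AddCommGroup Z] [Module R Z] {a b : C →ₗ[R] Z}
    (hab : ∀ j, a (c j) = b (c j)) : a = b :=
  LinearMap.ext_on_range h.span hab

lemma pres_of_surj {n : ℕ} {C : Type u} [AddCommGroup C] [Module R C] (q : (Fin n → R) →ₗ[R] C)
    (hq : Function.Surjective q) {m : ℕ} (d : Fin m → Fin n → R)
    (hd : Submodule.span R (Set.range d) = LinearMap.ker q) :
    IsPres d (fun j => q (Pi.single j 1)) := by
  have hv : ∀ v : Fin n → R, v = ∑ j, v j • (Pi.single j 1 : Fin n → R) := fun v => by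
    funext i
    simp [Finset.sum_apply, Pi.single_apply]
  have hqv : ∀ v : Fin n → R, q v = ∑ j, v j • q (Pi.single j 1) := fun v => by
    conv_lhs => rw [hv v]
    simp
  refine ⟨fun i => ?_, fun Z _ _ z hz => ?_, ?_⟩
  · rw [← hqv]
    have : d i ∈ LinearMap.ker q := hd ▸ Submodule.subset_span ⟨i, rfl⟩
    exact this
  · let l : (Fin n → R) →ₗ[R] Z := Fintype.linearCombination R z
    have hl : ∀ v, l v = ∑ j, v j • z j := fun v => rfl
    have hk : LinearMap.ker q ≤ LinearMap.ker l := by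
      rw [← hd, Submodule.span_le]
      rintro _ ⟨i, rfl⟩
      exact hz i
    obtain ⟨a, ha⟩ := factor_surj hq (φ := l) (fun x hx => hk hx)
    refine ⟨a, fun j => ?_⟩
    have := LinearMap.congr_fun ha (Pi.single j 1)
    rw [LinearMap.comp_apply] at this
    rw [this, hl]
    simp [Pi.single_apply]
  · rw [eq_top_iff]
    intro x _
    obtain ⟨v, rfl⟩ := hq x
    rw [hqv]
    exact Submodule.sum_mem _ fun j _ => Submodule.smul_mem _ _ (Submodule.subset_span ⟨j, rfl⟩)

lemma exists_pres [IsNoetherianRing R] (C : Type u) [AddCommGroup C] [Module R C] [Module.Finite R C] :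
    ∃ (m n : ℕ) (d : Fin m → Fin n → R) (c : Fin n → C), IsPres d c := by
  obtain ⟨n, q, hq⟩ := Module.Finite.exists_fin' R C
  have hfg : (LinearMap.ker q).FG := IsNoetherian.noetherian _
  obtain ⟨m, d, hd⟩ := Submodule.fg_iff_exists_fin_generating_family.1 hfg
  exact ⟨m, n, d, _, pres_of_surj q hq d hd⟩

end

end ARx

/-! ## Part 8: existence of almost split sequences -/

namespace ARx


section
variable {K : Type u} [CommRing K] [IsArtinianRing K] {R : Type u} [Ring R] [Algebra K R]
  [Module.Finite K R] {E : Type u} [AddCommGroup E] [Module K E]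

/-- restriction of scalars -/
abbrev kmod (K : Type u) [CommRing K] {R : Type u} [Ring R] [Algebra K R] (M : Type u)
    [AddCommGroup M] [Module R M] : Module K M := Module.compHom M (algebraMap K R)

lemma ktower (K : Type u) [CommRing K] {R : Type u} [Ring R] [Algebra K R] (M : Type u)
    [AddCommGroup M] [Module R M] : letI := kmod K (R := R) M; IsScalarTower K R M :=
  letI := kmod K (R := R) M
  IsScalarTower.of_algebraMap_smul fun _ _ => rfl

lemma fl_K {M : Type u} [AddCommGroup M] [Module R M] [Module K M] [IsScalarTower K R M]
    [Module.Finite R M] : IsFiniteLength K M := by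
  have : Module.Finite K M := Module.Finite.trans R M
  exact isFiniteLength_iff_isNoetherian_isArtinian.2 ⟨inferInstance, inferInstance⟩

include K in
variable (K) in
lemma noethR : IsNoetherianRing R := isNoetherian_of_tower K inferInstance

include K in
variable (K) in
lemma artR : IsArtinianRing R := isArtinian_of_tower K inferInstance

instance [Fact (Matlis K E)] {m n : ℕ} (d : Fin m → Fin n → R) : IsNoetherian R (Nd K E d) := by
  have hE : Matlis K E := Fact.out
  have : IsFiniteLength K (DR K R E) := hE.dual_fl R (fl_K (R := R))
  have := (isFiniteLength_iff_isNoetherian_isArtinian.1 this).1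
  have : IsNoetherian R (DR K R E) := isNoetherian_of_tower K inferInstance
  infer_instance

instance [Fact (Matlis K E)] {m n : ℕ} (d : Fin m → Fin n → R) : IsArtinian R (Nd K E d) := by
  have hE : Matlis K E := Fact.out
  have : IsFiniteLength K (DR K R E) := hE.dual_fl R (fl_K (R := R))
  have := (isFiniteLength_iff_isNoetherian_isArtinian.1 this).2
  have : IsArtinian R (DR K R E) := isArtinian_of_tower K inferInstance
  infer_instance

/-- right almost split -/
def RAS {M C : ModA R} (g : M.M →ₗ[R] C.M) : Prop :=
  ∀ (Z : ModA R) (k : Z.M →ₗ[R] C.M), ¬ SplitEpiMap k → ∃ k' : Z.M →ₗ[R] M.M, g.comp k' = k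

/-- left almost split -/
def LAS {M C : ModA R} (g : C.M →ₗ[R] M.M) : Prop :=
  ∀ (Z : ModA R) (k : C.M →ₗ[R] Z.M), ¬ SplitMonoMap k → ∃ k' : M.M →ₗ[R] Z.M, k'.comp g = k

lemma exists_phi (hE : Matlis K E) (C : ModA R) (hC : C.IsIndec) [Module K C.M]
    [IsScalarTower K R C.M] : ∃ φ : Module.End R C.M →ₗ[K] E, φ 1 ≠ 0 ∧
      ∀ f : Module.End R C.M, ¬ Function.Bijective f → φ f = 0 := by
  let J : Submodule K (Module.End R C.M) :=
    { carrier := {f | ¬ Function.Bijective f}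
      zero_mem' := fun h => by
        have := hC.1
        obtain ⟨x, hx⟩ := exists_ne (0 : C.M)
        exact hx (h.1 rfl)
      add_mem' := fun {a b} ha hb h => by
        rcases sum_bij hC h with h | h
        · exact ha h
        · exact hb h
      smul_mem' := fun k f hf h => by
        refine hf ⟨fun x y hxy => h.1 ?_, fun y => ?_⟩
        · show k • f x = k • f y
          rw [hxy]
        · obtain ⟨x, hx⟩ := h.2 y
          refine ⟨algebraMap K R k • x, ?_⟩
          rw [map_smul, algebraMap_smul]
          exact hx }
  have h1 : (J.mkQ 1) ≠ 0 := fun h => by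
    have : (1 : Module.End R C.M) ∈ J := (Submodule.Quotient.mk_eq_zero J).1 h
    exact this Function.bijective_id
  obtain ⟨χ, hχ⟩ := hE.sep h1
  refine ⟨χ.comp J.mkQ, hχ, fun f hf => ?_⟩
  have : J.mkQ f = 0 := (Submodule.Quotient.mk_eq_zero J).2 hf
  rw [LinearMap.comp_apply, this, map_zero]

theorem ar_core [hEf : Fact (Matlis K E)] {m n : ℕ} {d : Fin m → Fin n → R} {C : Type u}
    [AddCommGroup C] [Module R C] {c : Fin n → C} (hp : IsPres d c) (C' : ModA R)
    (hC : C'.IsIndec) (hnp : ¬ Module.Projective R C'.M)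
    (ι : C'.M →ₗ[R] C) (π : C →ₗ[R] C'.M) (hπι : π.comp ι = LinearMap.id) :
    ∃ (W : ModA R) (i : (mkA R (Nd K E d)).M →ₗ[R] W.M) (q : W.M →ₗ[R] C'.M),
      SES (N := mkA R (Nd K E d)) i q ∧ ¬ SplitEpiMap q ∧ RAS q := by
  have hE : Matlis K E := hEf.out
  have := noethR K (R := R)
  have := artR K (R := R)
  let _ := kmod K (R := R) C'.M
  have := ktower K (R := R) C'.M
  obtain ⟨φ, hφ1, hφ⟩ := exists_phi (K := K) hE C' hC
  obtain ⟨r, p, hps⟩ := Module.Finite.exists_fin' R C'.M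
  let F := Fin r → R
  let Ω := LinearMap.ker p
  -- the space of tuples
  let X : Submodule K (Fin n → F) :=
    { carrier := {g | ∀ i, ∑ j, d i j • p (g j) = 0}
      zero_mem' := fun i => by simp
      add_mem' := fun {a b} ha hb i => by
        simp only [Pi.add_apply, map_add, smul_add, Finset.sum_add_distrib, ha i, hb i, add_zero]
      smul_mem' := fun k g hg i => by
        have : ∀ j, d i j • p ((k • g) j) = algebraMap K R k • (d i j • p (g j)) := fun j => by
          rw [Pi.smul_apply, ← algebraMap_smul R k (g j), map_smul, smul_smul, smul_smul,
            Algebra.commutes]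
        simp only [this]
        rw [← Finset.smul_sum, hg i, smul_zero] }
  have hX : ∀ g : X, ∀ i, ∑ j, d i j • p (g.1 j) = 0 := fun g => g.2
  have hdF : ∀ (g : Fin n → F) i, p (dact (K := K) d F g i) = ∑ j, d i j • p (g j) := fun g i => by
    simp [dact]
  have hlift : ∀ g : X, ∃ a : C →ₗ[R] C'.M, ∀ j, a (c j) = p (g.1 j) := fun g =>
    hp.lift C'.M (fun j => p (g.1 j)) (hX g)
  choose a ha using hlift
  let Φ : X →ₗ[K] E :=
    { toFun := fun g => φ ((a g).comp ι)
      map_add' := fun x y => by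
        have : a (x + y) = a x + a y := hp.hom_ext (fun j => by
          rw [LinearMap.add_apply, ha, ha, ha, Submodule.coe_add, Pi.add_apply, map_add])
        rw [this, LinearMap.add_comp, map_add]
      map_smul' := fun k x => by
        have : a (k • x) = k • a x := hp.hom_ext (fun j => by
          rw [LinearMap.smul_apply, ha, ha, Submodule.coe_smul, Pi.smul_apply,
            ← algebraMap_smul R k (x.1 j), map_smul, algebraMap_smul])
        rw [this, LinearMap.smul_comp, map_smul]; rfl }
  have hΦ : ∀ (g : X) (b : C →ₗ[R] C'.M), (∀ j, b (c j) = p (g.1 j)) → Φ g = φ (b.comp ι) :=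
    fun g b hb => by
      have : a g = b := hp.hom_ext (fun j => by rw [ha, hb])
      show φ ((a g).comp ι) = _
      rw [this]
  let U : X →ₗ[K] (Fin m → Ω) :=
    { toFun := fun g i => ⟨dact (K := K) d F g.1 i, by
        rw [LinearMap.mem_ker, hdF]; exact hX g i⟩
      map_add' := fun x y => by
        funext i; apply Subtype.ext; simp [map_add]
      map_smul' := fun k x => by
        funext i; apply Subtype.ext; simp [map_smul] }
  obtain ⟨w, hw⟩ := inj_ext hE.inj U Φ (by
    intro g hg
    have hg' : ∀ i, ∑ j, d i j • g.1 j = 0 := fun i => congrArg Subtype.val (congrFun hg i)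
    obtain ⟨b, hb⟩ := hp.lift F g.1 hg'
    rw [hΦ g (p.comp b) (fun j => by rw [LinearMap.comp_apply, hb])]
    apply hφ
    intro hbij
    apply hnp
    obtain ⟨s, hs⟩ := bij_splitEpi (X := C') (Y := C') hbij
    exact Module.Projective.of_split ((b.comp ι).comp s) p hs)
  obtain ⟨ψ, hψ⟩ := toNd (K := K) (d := d) w (fun z => by
    let g : X := ⟨fun j => (z j : F), fun i => by
      refine Finset.sum_eq_zero fun j _ => ?_
      have : p (z j : F) = 0 := (z j).2
      rw [this, smul_zero]⟩
    have e : U g = dact (K := K) d Ω z := by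
      funext i; apply Subtype.ext
      simp [U, g, dact]
    rw [← e, hw, hΦ g 0 (fun j => by
      have : p (z j : F) = 0 := (z j).2
      rw [LinearMap.zero_apply]; exact this.symm), LinearMap.zero_comp, map_zero])
  have hses : SES (N := mkA R Ω) (M := mkA R F) (C := C') Ω.subtype p :=
    ⟨Ω.subtype_injective, hps, by simp [Ω]⟩
  obtain ⟨W, i, q, j, hW, hqj, hjf⟩ := hses.push (N' := mkA R (Nd K E d)) ψ
  have hqj' : ∀ x, q (j x) = p x := fun x => LinearMap.congr_fun hqj x
  have hjf' : ∀ x : Ω, j (x : F) = i (ψ x) := fun x => LinearMap.congr_fun hjf x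
  refine ⟨W, i, q, hW, ?_, ?_⟩
  · intro hs
    obtain ⟨ρ, hρ⟩ := hW.splitMono hs
    obtain ⟨w', hw', hψ'⟩ := ofNd (K := K) (ρ.comp j : F →ₗ[R] Nd K E d)
    obtain ⟨σ, hσ⟩ : ∃ σ : Fin n → F, ∀ k, p (σ k) = π (c k) :=
      ⟨fun k => (hps (π (c k))).choose, fun k => (hps (π (c k))).choose_spec⟩
    let g : X := ⟨σ, fun k => by
      simp only [hσ]
      have := hp.rel k
      rw [← map_zero π, ← this]
      simp⟩
    have e1 : Φ g = φ 1 := by rw [hΦ g π (fun k => (hσ k).symm), hπι]; rfl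
    apply hφ1
    rw [← e1, ← hw, ← hψ, ← hw' σ, ← hψ']
    refine Finset.sum_congr rfl fun k _ => ?_
    have : (ρ.comp j : F →ₗ[R] Nd K E d) (dact (K := K) d F σ k) = ψ (U g k) := by
      have h1 := hjf' (U g k)
      rw [LinearMap.comp_apply]
      refine (congrArg ρ h1).trans ?_
      exact LinearMap.congr_fun hρ (ψ (U g k))
    rw [this]
  · intro Z h hh
    obtain ⟨t, pz, hpz⟩ := Module.Finite.exists_fin' R Z.M
    let FZ := Fin t → R
    obtain ⟨H, hH⟩ := Module.projective_lifting_property p (h.comp pz) hps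
    have hH' : ∀ x, p (H x) = h (pz x) := fun x => LinearMap.congr_fun hH x
    let ΩZ := LinearMap.ker pz
    let HΩ : ΩZ →ₗ[R] Ω := (H.comp ΩZ.subtype).codRestrict Ω (fun x => by
      have : pz (x : FZ) = 0 := x.2
      simp [Ω, hH', this])
    obtain ⟨θ, hθ⟩ := Nd_extend (K := K) hE.inj ΩZ (ψ.comp HΩ) (by
      intro g z hgz
      have hz : ∀ k, pz (z k : FZ) = 0 := fun k => (z k).2
      have hpg : ∀ k, ∑ l, d k l • pz (g l) = 0 := fun k => by
        rw [← hz k, ← hgz k]; simp [dact]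
      obtain ⟨b, hb⟩ := hp.lift Z.M (fun l => pz (g l)) hpg
      let g' : X := ⟨fun l => H (g l), fun k => by
        have : ∀ l, d k l • p (H (g l)) = h (d k l • pz (g l)) := fun l => by rw [hH', map_smul]
        simp only [this]
        rw [← map_sum, hpg, map_zero]⟩
      have e : U g' = fun k => HΩ (z k) := by
        funext k; apply Subtype.ext
        show ∑ l, d k l • H (g l) = H (z k : FZ)
        rw [← hgz k]
        simp [dact]
      have e2 := hψ (U g')
      rw [hw, hΦ g' (h.comp b) (fun l => by rw [LinearMap.comp_apply, hb]; exact (hH' _).symm),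
        hφ] at e2
      · rw [e] at e2
        exact e2
      · intro hbij
        apply hh
        obtain ⟨s, hs⟩ := bij_splitEpi (X := C') (Y := C') hbij
        exact ⟨(b.comp ι).comp s, hs⟩)
    let G : FZ →ₗ[R] W.M := j.comp H - i.comp θ
    obtain ⟨k', hk'⟩ := factor_surj hpz (φ := G) (by
      intro x hx
      have h1 := hθ ⟨x, hx⟩
      have h2 := hjf' (HΩ ⟨x, hx⟩)
      show j (H x) - i (θ x) = 0
      rw [sub_eq_zero]
      refine h2.trans ?_
      exact congrArg i h1.symm)
    refine ⟨k', ?_⟩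
    ext z
    obtain ⟨x, rfl⟩ := hpz z
    have h1 := LinearMap.congr_fun hk' x
    rw [LinearMap.comp_apply] at h1 ⊢
    rw [h1]
    show q (j (H x) - i (θ x)) = _
    rw [map_sub, hW.zero, sub_zero, hqj', hH']

end

end ARx

namespace ARx


section
variable {R : Type u} [Ring R]
lemma fsum_comp {I : Type*} {X Y Z : Type*} [AddCommGroup X] [Module R X] [AddCommGroup Y] [Module R Y]
    [AddCommGroup Z] [Module R Z] (s : Finset I) (f : I → Y →ₗ[R] Z) (g : X →ₗ[R] Y) :
    (∑ i ∈ s, f i).comp g = ∑ i ∈ s, (f i).comp g := by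
  ext x; simp

lemma comp_fsum {I : Type*} {X Y Z : Type*} [AddCommGroup X] [Module R X] [AddCommGroup Y] [Module R Y]
    [AddCommGroup Z] [Module R Z] (s : Finset I) (f : I → X →ₗ[R] Y) (g : Y →ₗ[R] Z) :
    g.comp (∑ i ∈ s, f i) = ∑ i ∈ s, g.comp (f i) := by
  ext x; simp

lemma inj_of_split {X Y : Type u} [AddCommGroup X] [Module R X] [AddCommGroup Y] [Module R Y]
    (hY : Module.Injective R Y) (i : X →ₗ[R] Y) (r : Y →ₗ[R] X) (h : r.comp i = LinearMap.id) :
    Module.Injective R X := ⟨fun A B _ _ _ _ f hf g => by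
  obtain ⟨l, hl⟩ := hY.out f hf (i.comp g)
  refine ⟨r.comp l, fun x => ?_⟩
  rw [LinearMap.comp_apply, hl]
  exact LinearMap.congr_fun h (g x)⟩
end

section
variable {K : Type u} [CommRing K] [IsArtinianRing K] {R : Type u} [Ring R] [Algebra K R]
  [Module.Finite K R] {E : Type u} [AddCommGroup E] [Module K E]

include K in
variable (K) in
theorem exists_ar_right (C : ModA R) (hC : C.IsIndec) (hnp : ¬ Module.Projective R C.M) :
    ∃ s : AlmostSplitSeq R, s.r = C := by
  obtain ⟨E, _, _, hE⟩ := exists_matlis K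
  have : Fact (Matlis K E) := ⟨hE⟩
  have := noethR K (R := R)
  obtain ⟨m, n, d, c, hp⟩ := exists_pres (R := R) C.M
  obtain ⟨W, i, q, hW, hns, hr⟩ := ar_core (K := K) (E := E) hp C hC hnp LinearMap.id LinearMap.id rfl
  obtain ⟨D⟩ := exists_dec (mkA R (Nd K E d))
  have hP : ∀ k : D.I, _ := fun k => hW.push (D.π k)
  choose V i' q' j hV hqj hji using hP
  have : ∃ k, ¬ SplitEpiMap (q' k) := by
    by_contra hc
    push Not at hc
    apply hns
    apply hW.splitEpi
    choose ρ hρ using fun k => (hV k).splitMono (hc k)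
    refine ⟨∑ k, (D.ι k).comp ((ρ k).comp (j k)), ?_⟩
    refine Eq.trans ?_ D.total
    rw [fsum_comp]
    refine Finset.sum_congr rfl fun k _ => ?_
    have h2 : (ρ k).comp ((i' k).comp (D.π k)) = D.π k := by
      rw [← LinearMap.comp_assoc, hρ, LinearMap.id_comp]
    rw [LinearMap.comp_assoc, LinearMap.comp_assoc, hji, h2]
  obtain ⟨k, hk⟩ := this
  refine ⟨mkASS (hV k) (D.indec k) hC hk ?_, rfl⟩
  intro Z h hh
  obtain ⟨h', hh'⟩ := hr Z h hh
  exact ⟨(j k).comp h', by rw [← LinearMap.comp_assoc, hqj, hh']⟩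

lemma Nd_inj (hE : Matlis K E) {m n : ℕ} {d : Fin m → Fin n → R} {C : Type u}
    [AddCommGroup C] [Module R C] {c : Fin n → C} (hp : IsPres d c) (hC : Module.Projective R C) :
    Module.Injective R (Nd K E d) := by
  apply Module.Baer.injective
  intro I ψ
  obtain ⟨θ, hθ⟩ := Nd_extend (K := K) hE.inj (F := R) I ψ (by
    intro g z hgz
    obtain ⟨w, hw, hψ⟩ := ofNd (K := K) ψ
    obtain ⟨a, ha⟩ := hp.lift (R ⧸ I) (fun j => I.mkQ (g j)) (fun i => by
      have : I.mkQ (dact (K := K) d R g i) = 0 := by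
        rw [hgz i]; exact (Submodule.Quotient.mk_eq_zero I).2 (z i).2
      rw [← this]; simp [dact]; rfl)
    obtain ⟨b, hb⟩ := Module.projective_lifting_property I.mkQ a I.mkQ_surjective
    have hd : ∀ j, g j - b (c j) ∈ I := fun j => by
      rw [← Submodule.Quotient.mk_eq_zero I, Submodule.Quotient.mk_sub, sub_eq_zero]
      have := LinearMap.congr_fun hb (c j)
      rw [ha] at this
      exact this.symm
    have : z = dact (K := K) d I (fun j => ⟨g j - b (c j), hd j⟩) := by
      funext i
      apply Subtype.ext
      rw [← hgz i]
      have h0 : ∑ j, d i j • b (c j) = 0 := by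
        rw [← map_zero b, ← hp.rel i]; simp
      simp only [smul_eq_mul] at h0
      simp [dact, mul_sub, Finset.sum_sub_distrib, h0]
    rw [hψ, this, hw])
  exact ⟨θ, fun x hx => hθ ⟨x, hx⟩⟩

lemma exists_Nd_iso (hE : Matlis K E) (N : Type u) [AddCommGroup N] [Module R N] [Module.Finite R N] :
    ∃ (m n : ℕ) (d : Fin m → Fin n → R), Nonempty (N ≃ₗ[R] Nd K E d) := by
  let _ := kmod K (R := R) N
  have := ktower K (R := R) N
  have hfl : IsFiniteLength K N := fl_K (R := R)
  have hdfl := hE.dual_fl N hfl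
  have := (isFiniteLength_iff_isNoetherian_isArtinian.1 hdfl).1
  obtain ⟨m, χ, hχ⟩ := Submodule.fg_iff_exists_fin_generating_family.1
    (Module.Finite.fg_top (R := K) (M := N →ₗ[K] E))
  -- relations
  let B : (Fin m → R) →ₗ[K] (N →ₗ[K] E) :=
    { toFun := fun r => ∑ i, (χ i).comp ((Algebra.lsmul K K N (r i)))
      map_add' := fun r s => by
        simp [LinearMap.comp_add, Finset.sum_add_distrib]
      map_smul' := fun k r => by
        simp [LinearMap.comp_smul, Finset.smul_sum] }
  have hB : ∀ r x, B r x = ∑ i, χ i (r i • x) := fun r x => by simp [B]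
  have hBs : Function.Surjective B := by
    rw [← LinearMap.range_eq_top, eq_top_iff, ← hχ, Submodule.span_le]
    rintro _ ⟨i, rfl⟩
    refine ⟨Pi.single i 1, ?_⟩
    ext x
    rw [hB, Finset.sum_eq_single i]
    · simp
    · intro k _ hk; simp [hk]
    · simp
  have : Module.Finite K (Fin m → R) := inferInstance
  obtain ⟨n, D, hD⟩ := Submodule.fg_iff_exists_fin_generating_family.1
    (IsNoetherian.noetherian (LinearMap.ker B))
  let d : Fin m → Fin n → R := fun i j => D j i
  have hDk : ∀ j x, ∑ i, χ i (d i j • x) = 0 := fun j x => by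
    have : D j ∈ LinearMap.ker B := hD ▸ Submodule.subset_span ⟨j, rfl⟩
    have := LinearMap.congr_fun (show B (D j) = 0 from this) x
    rw [hB] at this
    exact this
  let f : N →ₗ[R] Nd K E d :=
    { toFun := fun x => ⟨fun i => ((χ i).comp (LinearMap.toSpanSingleton R N x |>.restrictScalars K) :
          R →ₗ[K] E), fun j s => by
            have := hDk j (s • x)
            simp only [smul_smul] at this
            exact this⟩
      map_add' := fun x y => by
        apply Subtype.ext; funext i; apply DR.ext; intro s
        show χ i (s • (x + y)) = χ i (s • x) + χ i (s • y)
        rw [smul_add, map_add]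
      map_smul' := fun r x => by
        apply Subtype.ext; funext i; apply DR.ext; intro s
        show χ i (s • (r • x)) = χ i ((s * r) • x)
        rw [mul_smul] }
  have hf : ∀ x i s, ((f x).1 i).ev s = χ i (s • x) := fun x i s => rfl
  refine ⟨m, n, d, ⟨LinearEquiv.ofBijective f ⟨?_, ?_⟩⟩⟩
  · rw [← LinearMap.ker_eq_bot, LinearMap.ker_eq_bot']
    intro x hx
    by_contra h
    obtain ⟨η, hη⟩ := hE.sep h
    obtain ⟨r, rfl⟩ := hBs η
    apply hη
    rw [hB]
    refine Finset.sum_eq_zero fun i _ => ?_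
    rw [← hf, hx]
    rfl
  · rintro ⟨φ, hφ⟩
    let Q : (Fin m → R) →ₗ[K] E := ∑ i, ((φ i).ev).comp (LinearMap.proj i)
    have hQ : ∀ r, Q r = ∑ i, (φ i).ev (r i) := fun r => by simp [Q]
    have hk : LinearMap.ker B ≤ LinearMap.ker Q := by
      rw [← hD, Submodule.span_le]
      rintro _ ⟨j, rfl⟩
      show Q (D j) = 0
      rw [hQ]
      have := hφ j 1
      simpa using this
    obtain ⟨Q', hQ'⟩ := factor_surj hBs (φ := Q) (fun x hx => hk hx)
    obtain ⟨x, hx⟩ := hE.refl N hfl Q'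
    refine ⟨x, ?_⟩
    apply Subtype.ext; funext i; apply DR.ext; intro s
    have h1 := LinearMap.congr_fun hQ' (Pi.single i s)
    rw [LinearMap.comp_apply, hx, hB, hQ, Finset.sum_eq_single i, Finset.sum_eq_single i] at h1
    · rw [hf]
      simpa using h1
    · intro k _ hk; simp [hk]
    · simp
    · intro k _ hk; simp [hk]
    · simp

include K in
variable (K) in
theorem exists_ar_left (N : ModA R) (hN : N.IsIndec) (hni : ¬ Module.Injective R N.M) :
    ∃ s : AlmostSplitSeq R, s.l = N := by
  obtain ⟨E, _, _, hE⟩ := exists_matlis K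
  have : Fact (Matlis K E) := ⟨hE⟩
  have := noethR K (R := R)
  have := artR K (R := R)
  obtain ⟨m, n, d, ⟨e⟩⟩ := exists_Nd_iso (K := K) (R := R) hE N.M
  let S := Submodule.span R (Set.range d)
  have hp := pres_of_surj S.mkQ S.mkQ_surjective d (by simp [S])
  have : Module.Finite R ((Fin n → R) ⧸ S) := inferInstance
  obtain ⟨D⟩ := exists_dec (mkA R ((Fin n → R) ⧸ S))
  have : ∃ k, ¬ Module.Projective R (D.Z k).M := by
    by_contra hc
    push Not at hc
    apply hni
    have hproj : Module.Projective R ((Fin n → R) ⧸ S) := by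
      refine Module.Projective.of_split (M := (Π₀ k, (D.Z k).M)) (R := R)
        (DFinsupp.linearEquivFunOnFintype.symm.toLinearMap.comp (LinearMap.pi D.π))
        ((∑ k, (D.ι k).comp (LinearMap.proj k)).comp DFinsupp.linearEquivFunOnFintype.toLinearMap) ?_
      refine Eq.trans ?_ D.total
      ext x
      simp
      rfl
    have := Nd_inj hE hp hproj
    exact inj_of_split this e.toLinearMap e.symm.toLinearMap (by ext x; simp)
  obtain ⟨k, hk⟩ := this
  obtain ⟨W, i, q, hW, hns, hr⟩ := ar_core (K := K) (E := E) hp (D.Z k) (D.indec k) hk (D.ι k) (D.π k) (D.one k)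
  have hW' : SES (N := N) (i.comp e.toLinearMap) q := ⟨hW.inj.comp e.injective, hW.surj, by
    rw [← hW.exact, LinearMap.range_comp_of_range_eq_top _ (LinearEquiv.range e)]⟩
  exact ⟨mkASS hW' hN (D.indec k) hns hr, rfl⟩
end

end ARx

/-! ## Part 10: minimal almost split maps -/

namespace ARx


section
variable {R : Type u} [Ring R]

/-- left minimal almost split maps -/
structure LMAS {X E : ModA R} (g : X.M →ₗ[R] E.M) : Prop where
  ns : ¬ SplitMonoMap g
  las : LAS g
  min : ∀ θ : E.M →ₗ[R] E.M, θ.comp g = g → Function.Bijective θ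

/-- right minimal almost split maps -/
structure RMAS {E Y : ModA R} (f : E.M →ₗ[R] Y.M) : Prop where
  ns : ¬ SplitEpiMap f
  ras : RAS f
  min : ∀ θ : E.M →ₗ[R] E.M, f.comp θ = f → Function.Bijective θ

lemma inj_bij {X : ModA R} {θ : X.M →ₗ[R] X.M} (h : ∀ x, θ x = 0 → x = 0) : Function.Bijective θ :=
  IsArtinian.bijective_of_injective_endomorphism θ (by
    rw [← LinearMap.ker_eq_bot, LinearMap.ker_eq_bot']; exact h)

lemma ass_lmas (s : AlmostSplitSeq R) : LMAS s.f := by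
  have hs := ASS_ses s
  have hns : ¬ SplitMonoMap s.f := fun h => s.not_split (hs.splitEpi h)
  refine ⟨hns, s.left_almost, fun θ hθ => ?_⟩
  have hθ' : ∀ x, θ (s.f x) = s.f x := fun x => LinearMap.congr_fun hθ x
  obtain ⟨θ', h'⟩ := hs.desc (φ := s.g.comp θ) (by
    rw [LinearMap.comp_assoc, hθ, hs.comp_zero])
  have h'' : ∀ x, θ' (s.g x) = s.g (θ x) := fun x => LinearMap.congr_fun h' x
  rcases fitting s.r_indec θ' with hn | hb
  · obtain ⟨n, hn⟩ := hn
    exfalso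
    have e1 : ∀ n x, (θ' ^ n) (s.g x) = s.g ((θ ^ n : Module.End R s.m.M) x) := by
      intro n
      induction n with
      | zero => intro x; simp
      | succ n ih => intro x; rw [pow_succ', pow_succ', Module.End.mul_apply, ih, h'']; rfl
    have e2 : ∀ n x, (θ ^ n : Module.End R s.m.M) (s.f x) = s.f x := by
      intro n
      induction n with
      | zero => intro x; simp
      | succ n ih => intro x; rw [pow_succ', Module.End.mul_apply, ih, hθ']
    obtain ⟨ρ, hρ⟩ := hs.lift (φ := (θ ^ n : Module.End R s.m.M)) (by
      ext x
      rw [LinearMap.comp_apply, ← e1, hn]; rfl)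
    refine hns ⟨ρ, ?_⟩
    ext x
    apply s.inj
    have := LinearMap.congr_fun hρ (s.f x)
    rw [e2] at this
    exact this
  · apply inj_bij
    intro x hx
    have h1 : s.g x = 0 := hb.1 (by rw [h'', hx, map_zero, map_zero])
    have : x ∈ LinearMap.range s.f := by rw [s.exact]; exact h1
    obtain ⟨y, rfl⟩ := this
    rw [← hx, hθ']

lemma ass_rmas (s : AlmostSplitSeq R) : RMAS s.g := by
  have hs := ASS_ses s
  refine ⟨s.not_split, s.right_almost, fun θ hθ => ?_⟩
  have hθ' : ∀ x, s.g (θ x) = s.g x := fun x => LinearMap.congr_fun hθ x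
  obtain ⟨θ', h'⟩ := hs.lift (φ := θ.comp s.f) (by
    rw [← LinearMap.comp_assoc, hθ, hs.comp_zero])
  have h'' : ∀ x, s.f (θ' x) = θ (s.f x) := fun x => LinearMap.congr_fun h' x
  rcases fitting s.l_indec θ' with hn | hb
  · obtain ⟨n, hn⟩ := hn
    exfalso
    have e1 : ∀ n x, s.f ((θ' ^ n) x) = ((θ ^ n : Module.End R s.m.M) (s.f x)) := by
      intro n
      induction n with
      | zero => intro x; simp
      | succ n ih => intro x; rw [pow_succ', pow_succ', Module.End.mul_apply, h'', ih]; rfl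
    have e2 : ∀ n x, s.g ((θ ^ n : Module.End R s.m.M) x) = s.g x := by
      intro n
      induction n with
      | zero => intro x; simp
      | succ n ih => intro x; rw [pow_succ', Module.End.mul_apply, hθ', ih]
    obtain ⟨ρ, hρ⟩ := hs.desc (φ := (θ ^ n : Module.End R s.m.M)) (by
      ext x
      rw [LinearMap.comp_apply, ← e1, hn, LinearMap.zero_apply, map_zero]; rfl)
    refine s.not_split ⟨ρ, ?_⟩
    ext x
    obtain ⟨y, rfl⟩ := s.surj x
    have := LinearMap.congr_fun hρ y
    rw [LinearMap.comp_apply] at this ⊢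
    rw [this, e2]; rfl
  · apply inj_bij
    intro x hx
    have h1 : s.g x = 0 := by rw [← hθ', hx, map_zero]
    have : x ∈ LinearMap.range s.f := by rw [s.exact]; exact h1
    obtain ⟨y, rfl⟩ := this
    rw [← h''] at hx
    have : y = 0 := hb.1 (by rw [map_zero]; exact s.inj (by rw [hx, map_zero]))
    rw [this, map_zero]

/-- indecomposable injectives have a smallest nonzero submodule -/
lemma inj_socle {X : ModA R} (hX : X.IsIndec) (hi : Module.Injective R X.M) :
    ∃ S : Submodule R X.M, IsAtom S ∧ ∀ A : Submodule R X.M, A ≠ ⊥ → S ≤ A := by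
  have := hX.1
  have huni : ∀ A B : Submodule R X.M, A ≠ ⊥ → B ≠ ⊥ → A ⊓ B ≠ ⊥ := by
    intro A B hA hB hAB
    obtain ⟨φ, hφ⟩ := factor_surj (q := (A.subtype.coprod B.subtype).rangeRestrict)
      (LinearMap.surjective_rangeRestrict _) (φ := A.subtype.comp (LinearMap.fst R A B)) (by
        rintro ⟨a, b⟩ h
        have h1 : (a : X.M) + b = 0 := congrArg Subtype.val h
        have h2 : (a : X.M) ∈ A ⊓ B := ⟨a.2, by
          rw [eq_neg_of_add_eq_zero_left h1]; exact B.neg_mem b.2⟩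
        rw [hAB] at h2
        exact h2)
    obtain ⟨e, he⟩ := hi.out (LinearMap.range (A.subtype.coprod B.subtype)).subtype
      (Submodule.subtype_injective _) φ
    have hA' : ∀ a : A, e a = a := fun a => by
      have h1 := LinearMap.congr_fun hφ (a, 0)
      have h2 := he ((A.subtype.coprod B.subtype).rangeRestrict (a, 0))
      rw [LinearMap.comp_apply] at h1
      rw [h1] at h2
      simpa using h2
    have hB' : ∀ b : B, e b = 0 := fun b => by
      have h1 := LinearMap.congr_fun hφ (0, b)
      have h2 := he ((A.subtype.coprod B.subtype).rangeRestrict (0, b))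
      rw [LinearMap.comp_apply] at h1
      rw [h1] at h2
      simpa using h2
    rcases fitting hX e with ⟨n, hn⟩ | hb
    · obtain ⟨a, ha, ha0⟩ := Submodule.exists_mem_ne_zero_of_ne_bot hA
      apply ha0
      have : ∀ n, (e ^ n : Module.End R X.M) a = a := by
        intro n
        induction n with
        | zero => simp
        | succ n ih => rw [pow_succ', Module.End.mul_apply, ih]; exact hA' ⟨a, ha⟩
      rw [← this n, hn]; rfl
    · obtain ⟨b, hb', hb0⟩ := Submodule.exists_mem_ne_zero_of_ne_bot hB
      exact hb0 (hb.1 (by rw [map_zero]; exact hB' ⟨b, hb'⟩))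
  obtain ⟨S, hS, -⟩ := (eq_bot_or_exists_atom_le (⊤ : Submodule R X.M)).resolve_left top_ne_bot
  refine ⟨S, hS, fun A hA => ?_⟩
  have := huni A S hA hS.1
  rcases hS.le_iff.1 (inf_le_right : A ⊓ S ≤ S) with h | h
  · exact absurd h this
  · rw [← h]; exact inf_le_left

lemma proj_rad {Y : ModA R} (hY : Y.IsIndec) (hp : Module.Projective R Y.M) :
    ∃ S : Submodule R Y.M, IsCoatom S ∧ ∀ A : Submodule R Y.M, A ≠ ⊤ → A ≤ S := by
  have := hY.1
  have huni : ∀ A B : Submodule R Y.M, A ≠ ⊤ → B ≠ ⊤ → A ⊔ B ≠ ⊤ := by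
    intro A B hA hB hAB
    have hs : Function.Surjective (A.mkQ.comp B.subtype) := by
      intro y
      obtain ⟨y, rfl⟩ := A.mkQ_surjective y
      have : y ∈ A ⊔ B := by rw [hAB]; trivial
      obtain ⟨a, ha, b, hb, rfl⟩ := Submodule.mem_sup.1 this
      refine ⟨⟨b, hb⟩, ?_⟩
      have : A.mkQ a = 0 := (Submodule.Quotient.mk_eq_zero A).2 ha
      rw [map_add, this, zero_add]; rfl
    obtain ⟨e, he⟩ := Module.projective_lifting_property _ A.mkQ hs
    have hA' : ∀ y, y - e y ∈ A := fun y => by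
      rw [← Submodule.Quotient.mk_eq_zero A, Submodule.Quotient.mk_sub, sub_eq_zero]
      exact (LinearMap.congr_fun he y).symm
    rcases fitting hY (B.subtype.comp e) with hn | hb
    · have hu := (unit_iff _).1 hn.isUnit_one_sub
      apply hA
      rw [eq_top_iff]
      intro y _
      obtain ⟨x, rfl⟩ := hu.2 y
      exact hA' x
    · apply hB
      rw [eq_top_iff]
      intro y _
      obtain ⟨x, rfl⟩ := hb.2 y
      exact (e x).2
  obtain ⟨S, hS, -⟩ := (eq_top_or_exists_le_coatom (⊥ : Submodule R Y.M)).resolve_left bot_ne_top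
  refine ⟨S, hS, fun A hA => ?_⟩
  have := huni A S hA hS.1
  rcases hS.le_iff.1 (le_sup_right : S ≤ A ⊔ S) with h | h
  · exact absurd h this
  · rw [← h]; exact le_sup_left

lemma inj_lmas {X : ModA R} (hX : X.IsIndec) (hi : Module.Injective R X.M) :
    ∃ (E : ModA R) (g : X.M →ₗ[R] E.M), LMAS g ∧ Function.Surjective g := by
  obtain ⟨S, hS, hS'⟩ := inj_socle hX hi
  refine ⟨mkA R (X.M ⧸ S), S.mkQ, ⟨?_, ?_, ?_⟩, S.mkQ_surjective⟩
  · rintro ⟨r, hr⟩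
    obtain ⟨x, hx, hx0⟩ := Submodule.exists_mem_ne_zero_of_ne_bot hS.1
    apply hx0
    have h1 := LinearMap.congr_fun hr x
    have : S.mkQ x = 0 := (Submodule.Quotient.mk_eq_zero S).2 hx
    rw [LinearMap.comp_apply, this, map_zero] at h1
    exact h1.symm
  · intro Z k hk
    have : LinearMap.ker k ≠ ⊥ := by
      intro h
      obtain ⟨r, hr⟩ := hi.out k (LinearMap.ker_eq_bot.1 h) LinearMap.id
      exact hk ⟨r, LinearMap.ext hr⟩
    exact factor_surj S.mkQ_surjective (fun x hx => hS' _ this ((Submodule.Quotient.mk_eq_zero S).1 hx))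
  · intro θ hθ
    have : θ = LinearMap.id := by
      ext x
      exact LinearMap.congr_fun hθ x
    rw [this]; exact Function.bijective_id

lemma proj_rmas {Y : ModA R} (hY : Y.IsIndec) (hp : Module.Projective R Y.M) :
    ∃ (E : ModA R) (g : E.M →ₗ[R] Y.M), RMAS g ∧ Function.Injective g := by
  obtain ⟨S, hS, hS'⟩ := proj_rad hY hp
  refine ⟨mkA R S, S.subtype, ⟨?_, ?_, ?_⟩, S.subtype_injective⟩
  · rintro ⟨r, hr⟩
    apply hS.1
    rw [eq_top_iff]
    intro x _
    have h1 := LinearMap.congr_fun hr x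
    rw [LinearMap.comp_apply] at h1
    have h2 := (r x).2
    have h3 : ((r x : S) : Y.M) = x := h1
    rwa [h3] at h2
  · intro Z k hk
    have : LinearMap.range k ≠ ⊤ := by
      intro h
      obtain ⟨r, hr⟩ := Module.projective_lifting_property k LinearMap.id (LinearMap.range_eq_top.1 h)
      exact hk ⟨r, hr⟩
    exact factor_inj S.subtype_injective (fun x => ⟨⟨k x, hS' _ this ⟨x, rfl⟩⟩, rfl⟩)
  · intro θ hθ
    have : θ = LinearMap.id := by
      ext x
      exact LinearMap.congr_fun hθ x
    rw [this]; exact Function.bijective_id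

section K
variable (K : Type u) [CommRing K] [IsArtinianRing K] [Algebra K R] [Module.Finite K R]
include K

theorem exists_lmas (X : ModA R) (hX : X.IsIndec) :
    ∃ (E : ModA R) (g : X.M →ₗ[R] E.M), LMAS g := by
  by_cases h : Module.Injective R X.M
  · obtain ⟨E, g, hg, -⟩ := inj_lmas hX h
    exact ⟨E, g, hg⟩
  · obtain ⟨s, rfl⟩ := exists_ar_left K X hX h
    exact ⟨_, _, ass_lmas s⟩

theorem exists_rmas (X : ModA R) (hX : X.IsIndec) :
    ∃ (E : ModA R) (g : E.M →ₗ[R] X.M), RMAS g := by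
  by_cases h : Module.Projective R X.M
  · obtain ⟨E, g, hg, -⟩ := proj_rmas hX h
    exact ⟨E, g, hg⟩
  · obtain ⟨s, rfl⟩ := exists_ar_right K X hX h
    exact ⟨_, _, ass_rmas s⟩
end K

/-! irreducible maps -/

lemma LMAS.irr {X E : ModA R} {g : X.M →ₗ[R] E.M} (hg : LMAS g) (hX : X.IsIndec) (D : Dec E)
    (i : D.I) : IsIrred (Y := D.Z i) ((D.π i).comp g) := by
  have h1 : ¬ SplitMonoMap (Y := D.Z i) ((D.π i).comp g) := by
    rintro ⟨r, hr⟩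
    exact hg.ns ⟨r.comp (D.π i), hr⟩
  refine ⟨h1, fun h => h1 (bij_splitMono (splitEpi_bij hX (D.indec i) h)), fun Z k h hk => ?_⟩
  by_contra hc
  push Not at hc
  obtain ⟨k', hk'⟩ := hg.las Z k hc.1
  let θ : E.M →ₗ[R] E.M := LinearMap.id - (D.ι i).comp (D.π i) + (D.ι i).comp (h.comp k')
  have hθ : Function.Bijective θ := hg.min θ (by
    ext x
    have a1 := LinearMap.congr_fun hk x
    have a2 := LinearMap.congr_fun hk' x
    simp only [LinearMap.comp_apply] at a1 a2
    simp [θ, a2, a1])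
  let e := LinearEquiv.ofBijective θ hθ
  apply hc.2
  refine ⟨k'.comp (e.symm.toLinearMap.comp (D.ι i)), ?_⟩
  ext x
  have a1 : θ (e.symm (D.ι i x)) = D.ι i x := e.apply_symm_apply _
  have a2 : D.π i (θ (e.symm (D.ι i x))) = h (k' (e.symm (D.ι i x))) := by
    simp [θ, D.one']
  rw [a1, D.one'] at a2
  exact a2.symm

lemma RMAS.irr {Y E : ModA R} {g : E.M →ₗ[R] Y.M} (hg : RMAS g) (hY : Y.IsIndec) (D : Dec E)
    (i : D.I) : IsIrred (X := D.Z i) (g.comp (D.ι i)) := by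
  have h1 : ¬ SplitEpiMap (X := D.Z i) (g.comp (D.ι i)) := by
    rintro ⟨r, hr⟩
    exact hg.ns ⟨(D.ι i).comp r, hr⟩
  refine ⟨fun h => h1 (bij_splitEpi (splitMono_bij (D.indec i) hY h)), h1, fun Z k h hk => ?_⟩
  by_contra hc
  push Not at hc
  obtain ⟨h', hh'⟩ := hg.ras Z h hc.2
  let θ : E.M →ₗ[R] E.M := LinearMap.id - (D.ι i).comp (D.π i) + (h'.comp k).comp (D.π i)
  have hgh : ∀ x, g (h' x) = h x := fun x => LinearMap.congr_fun hh' x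
  have hhk : ∀ x, h (k x) = g (D.ι i x) := fun x => LinearMap.congr_fun hk x
  have hθ : Function.Bijective θ := hg.min θ (by
    ext x
    simp [θ, hgh, hhk])
  let e := LinearEquiv.ofBijective θ hθ
  apply hc.1
  refine ⟨(D.π i).comp (e.symm.toLinearMap.comp h'), ?_⟩
  ext x
  have a2 : θ (D.ι i x) = h' (k x) := by
    simp [θ, D.one']
  have a3 : e.symm (h' (k x)) = D.ι i x := by rw [← a2]; exact e.symm_apply_apply _
  simp [a3, D.one']

lemma LMAS.factor {X E Y : ModA R} {g : X.M →ₗ[R] E.M} (hg : LMAS g) (hY : Y.IsIndec)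
    {f : X.M →ₗ[R] Y.M} (hf : IsIrred f) (D : Dec E) : ∃ i, (D.Z i).Iso Y := by
  obtain ⟨f', hf'⟩ := hg.las Y f hf.1
  rcases hf.2.2 E g f' hf' with h | ⟨s, hs⟩
  · exact absurd h hg.ns
  have : (∑ i, (f'.comp (D.ι i)).comp ((D.π i).comp s) : Module.End R Y.M) = LinearMap.id := by
    rw [← hs]
    ext y
    simp only [LinearMap.sum_apply, LinearMap.comp_apply]
    rw [← map_sum, D.total']
  obtain ⟨i, -, hi⟩ := fsum_bij hY Finset.univ _ (by rw [this]; exact Function.bijective_id)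
  have := hY.1
  exact ⟨i, ⟨(LinearEquiv.ofBijective _ (comp_bij (D.indec i) hi).2)⟩⟩

lemma RMAS.factor {X E Y : ModA R} {g : E.M →ₗ[R] Y.M} (hg : RMAS g) (hX : X.IsIndec)
    {f : X.M →ₗ[R] Y.M} (hf : IsIrred f) (D : Dec E) : ∃ i, (D.Z i).Iso X := by
  obtain ⟨f', hf'⟩ := hg.ras X f hf.2.1
  rcases hf.2.2 E f' g hf' with ⟨s, hs⟩ | h
  swap
  · exact absurd h hg.ns
  have : (∑ i, (s.comp (D.ι i)).comp ((D.π i).comp f') : Module.End R X.M) = LinearMap.id := by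
    rw [← hs]
    ext y
    simp only [LinearMap.sum_apply, LinearMap.comp_apply]
    rw [← map_sum, D.total']
  obtain ⟨i, -, hi⟩ := fsum_bij hX Finset.univ _ (by rw [this]; exact Function.bijective_id)
  have := hX.1
  exact ⟨i, ⟨(LinearEquiv.ofBijective _ (comp_bij (D.indec i) hi).2)⟩⟩

lemma irr_mono_epi {X Y : ModA R} {f : X.M →ₗ[R] Y.M} (hf : IsIrred f) :
    Function.Injective f ∨ Function.Surjective f := by
  rcases hf.2.2 (mkA R (LinearMap.range f)) f.rangeRestrict (LinearMap.range f).subtype rfl with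
    ⟨r, hr⟩ | ⟨s, hs⟩
  · left
    intro x y hxy
    have h1 : f.rangeRestrict x = f.rangeRestrict y := Subtype.ext hxy
    have h2 := LinearMap.congr_fun hr x
    have h3 := LinearMap.congr_fun hr y
    rw [LinearMap.comp_apply] at h2 h3
    rw [h1] at h2
    exact h2.symm.trans h3
  · right
    intro y
    have := LinearMap.congr_fun hs y
    obtain ⟨x, hx⟩ := (s y).2
    exact ⟨x, hx.trans this⟩

lemma irr_ne_zero {X Y : ModA R} (hX : X.IsIndec) (hY : Y.IsIndec) {f : X.M →ₗ[R] Y.M}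
    (hf : IsIrred f) : f ≠ 0 := by
  rintro rfl
  have := hX.1
  have := hY.1
  rcases hf.2.2 (mkA R PUnit) 0 0 (by simp) with ⟨r, hr⟩ | ⟨s, hs⟩
  · obtain ⟨x, hx⟩ := exists_ne (0 : X.M)
    have h := LinearMap.congr_fun hr x
    simp at h
    exact hx h.symm
  · obtain ⟨x, hx⟩ := exists_ne (0 : Y.M)
    exact hx (LinearMap.congr_fun hs x).symm

lemma irr_not_bij {X Y : ModA R} {f : X.M →ₗ[R] Y.M} (hf : IsIrred f) : ¬ Function.Bijective f :=
  fun h => hf.1 (bij_splitMono h)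

lemma irr_comp_iso {X Y X' Y' : ModA R} {f : X.M →ₗ[R] Y.M} (hf : IsIrred f) (a : X'.M ≃ₗ[R] X.M)
    (b : Y.M ≃ₗ[R] Y'.M) : IsIrred (X := X') (Y := Y') (b.toLinearMap.comp (f.comp a.toLinearMap)) := by
  refine ⟨?_, ?_, ?_⟩
  · rintro ⟨r, hr⟩
    refine hf.1 ⟨a.toLinearMap.comp (r.comp b.toLinearMap), ?_⟩
    ext x
    have := LinearMap.congr_fun hr (a.symm x)
    simp at this
    simp [this]
  · rintro ⟨r, hr⟩
    refine hf.2.1 ⟨a.toLinearMap.comp (r.comp b.toLinearMap), ?_⟩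
    ext x
    have := LinearMap.congr_fun hr (b x)
    simp at this
    simp [this]
  · intro Z g h hgh
    rcases hf.2.2 Z (g.comp a.symm.toLinearMap) (b.symm.toLinearMap.comp h) (by
      ext x
      have := LinearMap.congr_fun hgh (a.symm x)
      simp at this
      simp [this]) with ⟨r, hr⟩ | ⟨s, hs⟩
    · left
      refine ⟨a.symm.toLinearMap.comp r, ?_⟩
      ext x
      have := LinearMap.congr_fun hr (a x)
      simp at this
      simp [this]
    · right
      refine ⟨s.comp b.symm.toLinearMap, ?_⟩
      ext x
      have := LinearMap.congr_fun hs (b.symm x)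
      simp at this
      simpa using this

end

end ARx

/-! ## Part 11: vertex level facts -/

namespace ARx

section
variable {R : Type u} [Ring R]

abbrev vx (X : ModA R) (hX : X.IsIndec) : ARVertex R := ARVertex.mk ⟨X, hX⟩

lemma vx_eq {X Y : ModA R} {hX : X.IsIndec} {hY : Y.IsIndec} : vx X hX = vx Y hY ↔ X.Iso Y :=
  Quotient.eq (r := isoSetoid R)

lemma vx_surj (x : ARVertex R) : ∃ X hX, vx X hX = x := by
  obtain ⟨⟨X, hX⟩, h⟩ := Quotient.exists_rep x
  exact ⟨X, hX, h⟩

lemma arrow_iff {X Y : ModA R} {hX : X.IsIndec} {hY : Y.IsIndec} :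
    ARArrow (vx X hX) (vx Y hY) ↔ ∃ f : X.M →ₗ[R] Y.M, IsIrred f := by
  constructor
  · rintro ⟨⟨X', hX'⟩, ⟨Y', hY'⟩, f, hf, h1, h2⟩
    obtain ⟨a⟩ := vx_eq.1 h1
    obtain ⟨b⟩ := vx_eq.1 h2
    exact ⟨_, irr_comp_iso hf a.symm b⟩
  · rintro ⟨f, hf⟩
    exact ⟨⟨X, hX⟩, ⟨Y, hY⟩, f, hf, rfl, rfl⟩

lemma tau_iff {x y : ARVertex R} :
    TauRel x y ↔ ∃ s : AlmostSplitSeq R, vx s.l s.l_indec = x ∧ vx s.r s.r_indec = y := by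
  constructor
  · rintro ⟨⟨X, hX⟩, ⟨Y, hY⟩, rfl, rfl, s, h1, h2⟩
    exact ⟨s, vx_eq.2 h1, vx_eq.2 h2⟩
  · rintro ⟨s, rfl, rfl⟩
    exact ⟨_, _, rfl, rfl, s, ⟨LinearEquiv.refl R _⟩, ⟨LinearEquiv.refl R _⟩⟩

lemma proj_iff {X : ModA R} {hX : X.IsIndec} :
    IsProjVertex (vx X hX) ↔ Module.Projective R X.M := by
  constructor
  · rintro ⟨⟨X', hX'⟩, h, hp⟩
    obtain ⟨e⟩ := vx_eq.1 h
    have : Module.Projective R X'.M := hp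
    exact Module.Projective.of_equiv e
  · exact fun h => ⟨⟨X, hX⟩, rfl, h⟩

lemma inj_iff {X : ModA R} {hX : X.IsIndec} :
    IsInjVertex (vx X hX) ↔ Module.Injective R X.M := by
  constructor
  · rintro ⟨⟨X', hX'⟩, h, hp⟩
    obtain ⟨e⟩ := vx_eq.1 h
    exact inj_of_split hp e.symm.toLinearMap e.toLinearMap (by ext; simp)
  · exact fun h => ⟨⟨X, hX⟩, rfl, h⟩

def HomV (x y : ARVertex R) : Prop :=
  ∃ (X Y : ModA R) (hX : X.IsIndec) (hY : Y.IsIndec), vx X hX = x ∧ vx Y hY = y ∧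
    ∃ f : X.M →ₗ[R] Y.M, f ≠ 0

lemma homV_iff {X Y : ModA R} {hX : X.IsIndec} {hY : Y.IsIndec} :
    HomV (vx X hX) (vx Y hY) ↔ ∃ f : X.M →ₗ[R] Y.M, f ≠ 0 := by
  constructor
  · rintro ⟨X', Y', hX', hY', h1, h2, f, hf⟩
    obtain ⟨a⟩ := vx_eq.1 h1
    obtain ⟨b⟩ := vx_eq.1 h2
    refine ⟨b.toLinearMap.comp (f.comp a.symm.toLinearMap), fun h => hf ?_⟩
    ext x
    have := LinearMap.congr_fun h (a x)
    simpa using this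
  · exact fun h => ⟨_, _, _, _, rfl, rfl, h⟩

lemma ass_l {s s' : AlmostSplitSeq R} (h : s.r.Iso s'.r) : s.l.Iso s'.l := by
  obtain ⟨e⟩ := h
  have hs := ASS_ses s
  have hs' := ASS_ses s'
  obtain ⟨a, ha⟩ := s'.right_almost s.m (e.toLinearMap.comp s.g) (fun ⟨t, ht⟩ =>
    s.not_split ⟨t.comp e.toLinearMap, by
      ext x
      have := LinearMap.congr_fun ht (e x)
      simpa using this⟩)
  obtain ⟨b, hb⟩ := s.right_almost s'.m (e.symm.toLinearMap.comp s'.g) (fun ⟨t, ht⟩ =>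
    s'.not_split ⟨t.comp e.symm.toLinearMap, by
      ext x
      have := LinearMap.congr_fun ht (e.symm x)
      simpa using this⟩)
  have ha' : ∀ x, s'.g (a x) = e (s.g x) := fun x => LinearMap.congr_fun ha x
  have hb' : ∀ x, s.g (b x) = e.symm (s'.g x) := fun x => LinearMap.congr_fun hb x
  have hba := (ass_rmas s).min (b.comp a) (by ext x; simp [hb', ha'])
  obtain ⟨c, hc⟩ := hs'.lift (φ := a.comp s.f) (by ext x; simp [ha', hs.zero])
  obtain ⟨d, hd⟩ := hs.lift (φ := b.comp s'.f) (by ext x; simp [hb', hs'.zero])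
  have hc' : ∀ x, s'.f (c x) = a (s.f x) := fun x => LinearMap.congr_fun hc x
  have hd' : ∀ x, s.f (d x) = b (s'.f x) := fun x => LinearMap.congr_fun hd x
  have := s.l_indec.1
  have hdc : Function.Bijective (d.comp c) := inj_bij fun x hx => by
    have h1 : b (a (s.f x)) = 0 := by
      rw [← hc', ← hd']
      have : d (c x) = 0 := hx
      rw [this, map_zero]
    have h2 : s.f x = 0 := hba.1 (by simpa using h1)
    exact s.inj (by rw [h2, map_zero])
  exact ⟨LinearEquiv.ofBijective c (comp_bij s'.l_indec hdc).1⟩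

lemma ass_r {s s' : AlmostSplitSeq R} (h : s.l.Iso s'.l) : s.r.Iso s'.r := by
  obtain ⟨e⟩ := h
  have hs := ASS_ses s
  have hs' := ASS_ses s'
  obtain ⟨a, ha⟩ := s.left_almost s'.m (s'.f.comp e.toLinearMap) (fun ⟨t, ht⟩ =>
    (ass_lmas s').ns ⟨e.toLinearMap.comp t, by
      ext x
      have := congrArg e (LinearMap.congr_fun ht (e.symm x))
      simpa using this⟩)
  obtain ⟨b, hb⟩ := s'.left_almost s.m (s.f.comp e.symm.toLinearMap) (fun ⟨t, ht⟩ =>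
    (ass_lmas s).ns ⟨e.symm.toLinearMap.comp t, by
      ext x
      have := congrArg e.symm (LinearMap.congr_fun ht (e x))
      simpa using this⟩)
  have ha' : ∀ x, a (s.f x) = s'.f (e x) := fun x => LinearMap.congr_fun ha x
  have hb' : ∀ x, b (s'.f x) = s.f (e.symm x) := fun x => LinearMap.congr_fun hb x
  have hba := (ass_lmas s).min (b.comp a) (by ext x; simp [hb', ha'])
  obtain ⟨c, hc⟩ := hs.desc (φ := s'.g.comp a) (by ext x; simp [ha', hs'.zero])
  obtain ⟨d, hd⟩ := hs'.desc (φ := s.g.comp b) (by ext x; simp [hb', hs.zero])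
  have hc' : ∀ x, c (s.g x) = s'.g (a x) := fun x => LinearMap.congr_fun hc x
  have hd' : ∀ x, d (s'.g x) = s.g (b x) := fun x => LinearMap.congr_fun hd x
  have := s.r_indec.1
  have hdc : Function.Bijective (d.comp c) :=
    IsNoetherian.bijective_of_surjective_endomorphism _ fun y => by
      obtain ⟨m, rfl⟩ := s.surj y
      obtain ⟨x, rfl⟩ := hba.2 m
      exact ⟨s.g x, by simp [hc', hd']⟩
  exact ⟨LinearEquiv.ofBijective c (comp_bij s'.r_indec hdc).1⟩

lemma tau_fun' {x x' y : ARVertex R} (h : TauRel x y) (h' : TauRel x' y) : x = x' := by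
  obtain ⟨s, rfl, rfl⟩ := tau_iff.1 h
  obtain ⟨s', rfl, h2⟩ := tau_iff.1 h'
  exact vx_eq.2 (ass_l (vx_eq.1 h2.symm))

lemma tau_inj' {x y y' : ARVertex R} (h : TauRel x y) (h' : TauRel x y') : y = y' := by
  obtain ⟨s, rfl, rfl⟩ := tau_iff.1 h
  obtain ⟨s', h2, rfl⟩ := tau_iff.1 h'
  exact vx_eq.2 (ass_r (vx_eq.1 h2.symm))

lemma tau_not_proj' {x y : ARVertex R} (h : TauRel x y) : ¬ IsProjVertex y := by
  obtain ⟨s, rfl, rfl⟩ := tau_iff.1 h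
  rw [proj_iff]
  intro hp
  obtain ⟨t, ht⟩ := Module.projective_lifting_property s.g LinearMap.id s.surj
  exact s.not_split ⟨t, ht⟩

lemma tau_not_inj' {x y : ARVertex R} (h : TauRel x y) : ¬ IsInjVertex x := by
  obtain ⟨s, rfl, rfl⟩ := tau_iff.1 h
  rw [inj_iff]
  intro hp
  obtain ⟨t, ht⟩ := hp.out s.f s.inj LinearMap.id
  exact (ass_lmas s).ns ⟨t, LinearMap.ext ht⟩

lemma mesh_l' {x y z : ARVertex R} (h : ARArrow x y) (h' : TauRel z y) : ARArrow z x := by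
  obtain ⟨s, rfl, rfl⟩ := tau_iff.1 h'
  obtain ⟨X, hX, rfl⟩ := vx_surj x
  obtain ⟨f, hf⟩ := arrow_iff.1 h
  obtain ⟨D⟩ := exists_dec s.m
  obtain ⟨i, hi⟩ := (ass_rmas s).factor hX hf D
  rw [← vx_eq (hX := D.indec i) (hY := hX)] at hi
  rw [← hi]
  exact arrow_iff.2 ⟨_, (ass_lmas s).irr s.l_indec D i⟩

lemma mesh_r' {x y z : ARVertex R} (h : ARArrow x y) (h' : TauRel x z) : ARArrow y z := by
  obtain ⟨s, rfl, rfl⟩ := tau_iff.1 h'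
  obtain ⟨X, hX, rfl⟩ := vx_surj y
  obtain ⟨f, hf⟩ := arrow_iff.1 h
  obtain ⟨D⟩ := exists_dec s.m
  obtain ⟨i, hi⟩ := (ass_lmas s).factor hX hf D
  rw [← vx_eq (hX := D.indec i) (hY := hX)] at hi
  rw [← hi]
  exact arrow_iff.2 ⟨_, (ass_rmas s).irr s.r_indec D i⟩

lemma hom_of_arrow' {x y : ARVertex R} (h : ARArrow x y) : HomV x y := by
  obtain ⟨X, hX, rfl⟩ := vx_surj x
  obtain ⟨Y, hY, rfl⟩ := vx_surj y
  obtain ⟨f, hf⟩ := arrow_iff.1 h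
  exact homV_iff.2 ⟨f, irr_ne_zero hX hY hf⟩

lemma hom_pi' {x y p i : ARVertex R} (h : ARArrow x y) (hp : IsProjVertex p) (hi : IsInjVertex i)
    (h1 : HomV p y) (h2 : HomV x i) : HomV p x ∨ HomV y i := by
  obtain ⟨X, hX, rfl⟩ := vx_surj x
  obtain ⟨Y, hY, rfl⟩ := vx_surj y
  obtain ⟨P, hP, rfl⟩ := vx_surj p
  obtain ⟨I, hI, rfl⟩ := vx_surj i
  obtain ⟨f, hf⟩ := arrow_iff.1 h
  obtain ⟨a, ha⟩ := homV_iff.1 h1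
  obtain ⟨b, hb⟩ := homV_iff.1 h2
  rw [proj_iff] at hp
  rw [inj_iff] at hi
  rcases irr_mono_epi hf with hm | he
  · right
    obtain ⟨t, ht⟩ := hi.out f hm b
    refine homV_iff.2 ⟨t, ?_⟩
    rintro rfl
    exact hb (LinearMap.ext fun x => (ht x).symm)
  · left
    obtain ⟨t, ht⟩ := Module.projective_lifting_property f a he
    refine homV_iff.2 ⟨t, ?_⟩
    rintro rfl
    exact ha (by rw [← ht, LinearMap.comp_zero])

variable (K : Type u) [CommRing K] [IsArtinianRing K] [Algebra K R] [Module.Finite K R]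
include K

lemma tau_ex' (y : ARVertex R) (h : ¬ IsProjVertex y) : ∃ x, TauRel x y := by
  obtain ⟨Y, hY, rfl⟩ := vx_surj y
  rw [proj_iff] at h
  obtain ⟨s, rfl⟩ := exists_ar_right K Y hY h
  exact ⟨_, tau_iff.2 ⟨s, rfl, rfl⟩⟩

lemma taui_ex' (x : ARVertex R) (h : ¬ IsInjVertex x) : ∃ y, TauRel x y := by
  obtain ⟨Y, hY, rfl⟩ := vx_surj x
  rw [inj_iff] at h
  obtain ⟨s, rfl⟩ := exists_ar_left K Y hY h
  exact ⟨_, tau_iff.2 ⟨s, rfl, rfl⟩⟩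

lemma fin_succ' (x : ARVertex R) : {y | ARArrow x y}.Finite := by
  obtain ⟨X, hX, rfl⟩ := vx_surj x
  obtain ⟨E, g, hg⟩ := exists_lmas K X hX
  obtain ⟨D⟩ := exists_dec E
  refine (Set.finite_range (fun i : D.I => vx (D.Z i) (D.indec i))).subset ?_
  intro y hy
  obtain ⟨Y, hY, rfl⟩ := vx_surj y
  obtain ⟨f, hf⟩ := arrow_iff.1 hy
  obtain ⟨i, hi⟩ := hg.factor hY hf D
  exact ⟨i, vx_eq.2 hi⟩

lemma fin_pred' (x : ARVertex R) : {y | ARArrow y x}.Finite := by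
  obtain ⟨X, hX, rfl⟩ := vx_surj x
  obtain ⟨E, g, hg⟩ := exists_rmas K X hX
  obtain ⟨D⟩ := exists_dec E
  refine (Set.finite_range (fun i : D.I => vx (D.Z i) (D.indec i))).subset ?_
  intro y hy
  obtain ⟨Y, hY, rfl⟩ := vx_surj y
  obtain ⟨f, hf⟩ := arrow_iff.1 hy
  obtain ⟨i, hi⟩ := hg.factor hY hf D
  exact ⟨i, vx_eq.2 hi⟩

end

end ARx

/-! ## Part 12: finitely many projectives, injectives, simples -/

namespace ARx

section
variable {R : Type u} [Ring R]

/-- an indecomposable retract of `E` is one of its summands -/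
lemma retract_dec {P E : ModA R} (hP : P.IsIndec) (f : P.M →ₗ[R] E.M) (g : E.M →ₗ[R] P.M)
    (h : Function.Bijective (g.comp f)) (D : Dec E) : ∃ i, (D.Z i).Iso P := by
  have := hP.1
  have h1 : (∑ i, (g.comp (D.ι i)).comp ((D.π i).comp f) : Module.End R P.M) = g.comp f := by
    ext x
    simp only [LinearMap.sum_apply, LinearMap.comp_apply]
    rw [← map_sum, D.total']
  have h2 : Function.Bijective (∑ i, (g.comp (D.ι i)).comp ((D.π i).comp f) : Module.End R P.M) := by
    rw [h1]; exact h
  obtain ⟨i, -, hi⟩ := fsum_bij hP _ _ h2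
  exact ⟨i, ⟨LinearEquiv.ofBijective _ (comp_bij (D.indec i) hi).2⟩⟩

lemma proj_retract {P : ModA R} (hP : P.IsIndec) (hp : Module.Projective R P.M) :
    ∃ (f : P.M →ₗ[R] R) (g : R →ₗ[R] P.M), Function.Bijective (g.comp f) := by
  obtain ⟨n, q, hq⟩ := Module.Finite.exists_fin' R P.M
  obtain ⟨s, hs⟩ := Module.projective_lifting_property q LinearMap.id hq
  have h1 : (∑ i, (q.comp (LinearMap.single R (fun _ => R) i)).comp ((LinearMap.proj i).comp s) :
      Module.End R P.M) = LinearMap.id := by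
    rw [← hs]
    ext x
    simp only [LinearMap.sum_apply, LinearMap.comp_apply]
    rw [← map_sum]
    congr 1
    funext j
    simp [Finset.sum_apply, Pi.single_apply]
  have h2 : Function.Bijective (∑ i, (q.comp (LinearMap.single R (fun _ => R) i)).comp
      ((LinearMap.proj i).comp s) : Module.End R P.M) := by
    rw [h1]; exact Function.bijective_id
  obtain ⟨i, -, hi⟩ := fsum_bij hP _ _ h2
  exact ⟨_, _, hi⟩

variable (K : Type u) [CommRing K] [IsArtinianRing K] [Algebra K R] [Module.Finite K R]
include K

lemma fin_proj' : {x : ARVertex R | IsProjVertex x}.Finite := by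
  have := noethR K (R := R)
  have := artR K (R := R)
  obtain ⟨D⟩ := exists_dec (mkA R R)
  refine (Set.finite_range (fun i : D.I => vx (D.Z i) (D.indec i))).subset ?_
  intro y hy
  obtain ⟨Y, hY, rfl⟩ := vx_surj y
  have hy' : Module.Projective R Y.M := proj_iff.1 hy
  obtain ⟨f, g, h⟩ := proj_retract hY hy'
  obtain ⟨i, hi⟩ := retract_dec (E := mkA R R) hY f g h D
  exact ⟨i, vx_eq.2 hi⟩

/-- finitely many simples -/
lemma exists_simples : ∃ (n : ℕ) (S : Fin n → ModA R), (∀ i, IsSimpleModule R (S i).M) ∧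
    ∀ (M : Type u) [AddCommGroup M] [Module R M], IsSimpleModule R M →
      ∃ i, Nonempty (M ≃ₗ[R] (S i).M) := by
  have := noethR K (R := R)
  have := artR K (R := R)
  obtain ⟨D⟩ := exists_dec (mkA R R)
  have hpr : ∀ i, Module.Projective R (D.Z i).M := fun i =>
    Module.Projective.of_split (M := R) (D.ι i) (D.π i) (D.one i)
  choose c hc1 hc2 using fun i => proj_rad (D.indec i) (hpr i)
  let e := Fintype.equivFin D.I
  refine ⟨Fintype.card D.I, fun k => mkA R ((D.Z (e.symm k)).M ⧸ c (e.symm k)), fun k => ?_,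
    fun M _ _ hM => ?_⟩
  · exact isSimpleModule_iff_isCoatom.2 (hc1 _)
  · have : Nontrivial M := IsSimpleModule.nontrivial R M
    obtain ⟨x, hx⟩ := exists_ne (0 : M)
    have : ∃ i, (LinearMap.toSpanSingleton R M x).comp (D.ι i) ≠ 0 := by
      by_contra hcon
      push Not at hcon
      apply hx
      have h1 := D.total' (1 : R)
      have h2 := congrArg (LinearMap.toSpanSingleton R M x) h1
      rw [map_sum] at h2
      have h3 : (LinearMap.toSpanSingleton R M x) 1 = 0 :=
        h2.symm.trans (Finset.sum_eq_zero (fun i _ => LinearMap.congr_fun (hcon i) _))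
      exact (one_smul R x).symm.trans h3
    obtain ⟨i, hi⟩ := this
    set φ : (D.Z i).M →ₗ[R] M := (LinearMap.toSpanSingleton R M x).comp (D.ι i)
    have hs : Function.Surjective φ := (LinearMap.surjective_or_eq_zero φ).resolve_right hi
    have hk : LinearMap.ker φ = c i := by
      have h1 : IsCoatom (LinearMap.ker φ) := by
        rw [← isSimpleModule_iff_isCoatom]
        exact IsSimpleModule.congr (φ.quotKerEquivOfSurjective hs)
      have h2 := hc2 i _ h1.1
      rcases h2.eq_or_lt with h | h
      · exact h
      · exact absurd (h1.2 _ h) (hc1 i).1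
    refine ⟨e i, ?_⟩
    show Nonempty (M ≃ₗ[R] ((D.Z (e.symm (e i))).M ⧸ c (e.symm (e i))))
    rw [e.symm_apply_apply]
    exact ⟨(φ.quotKerEquivOfSurjective hs).symm.trans (Submodule.quotEquivOfEq _ _ hk)⟩

lemma fin_inj' : {x : ARVertex R | IsInjVertex x}.Finite := by
  obtain ⟨n, S, hS, hS'⟩ := exists_simples K (R := R)
  have key : ∀ x : {x : ARVertex R | IsInjVertex x}, ∃ (k : Fin n) (X : ModA R) (hX : X.IsIndec)
      (A : Submodule R X.M), vx X hX = x.1 ∧ Module.Injective R X.M ∧ IsAtom A ∧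
      (∀ B : Submodule R X.M, B ≠ ⊥ → A ≤ B) ∧ Nonempty (A ≃ₗ[R] (S k).M) := by
    rintro ⟨x, hx⟩
    obtain ⟨X, hX, rfl⟩ := vx_surj x
    have hi : Module.Injective R X.M := inj_iff.1 hx
    obtain ⟨A, hA, hA'⟩ := inj_socle hX hi
    obtain ⟨k, hk⟩ := hS' A (isSimpleModule_iff_isAtom.2 hA)
    exact ⟨k, X, hX, A, rfl, hi, hA, hA', hk⟩
  choose k X hX A h1 h2 h3 h4 h5 using key
  refine Finite.of_injective k fun x y hxy => ?_
  obtain ⟨a⟩ := h5 x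
  obtain ⟨b⟩ := h5 y
  rw [← hxy] at b
  obtain ⟨t, ht⟩ := (h2 y).out (A x).subtype (A x).subtype_injective
    ((A y).subtype.comp (a.trans b.symm).toLinearMap)
  have hinj : Function.Injective t := by
    rw [← LinearMap.ker_eq_bot]
    by_contra hc
    have hle := h4 x _ hc
    apply (h3 x).1
    rw [eq_bot_iff]
    intro z hz
    have h6 := ht ⟨z, hz⟩
    have h7 : t z = 0 := hle hz
    have h8 : (a.trans b.symm) ⟨z, hz⟩ = 0 := Subtype.ext (by
      have : t ((A x).subtype ⟨z, hz⟩) = 0 := h7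
      rw [this] at h6
      exact h6.symm)
    have h9 : (⟨z, hz⟩ : A x) = 0 := by simpa using h8
    exact congrArg Subtype.val h9
  obtain ⟨r, hr⟩ := (h2 x).out t hinj LinearMap.id
  have hb := splitMono_bij (hX x) (hX y) (f := t) ⟨r, LinearMap.ext hr⟩
  apply Subtype.ext
  rw [← h1 x, ← h1 y]
  exact vx_eq.2 ⟨LinearEquiv.ofBijective t hb⟩

end

end ARx

/-! ## Part 13: sectional paths -/

namespace ARx

section
variable {R : Type u} [Ring R]

lemma LMAS.irr' {X E Y : ModA R} {g : X.M →ₗ[R] E.M} (hg : LMAS g) (hX : X.IsIndec) (hY : Y.IsIndec)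
    {ι : Y.M →ₗ[R] E.M} {π : E.M →ₗ[R] Y.M} (h : π.comp ι = LinearMap.id) :
    IsIrred (π.comp g) := by
  have h1 : ¬ SplitMonoMap (π.comp g) := by
    rintro ⟨r, hr⟩
    exact hg.ns ⟨r.comp π, hr⟩
  have h' : ∀ x, π (ι x) = x := fun x => LinearMap.congr_fun h x
  refine ⟨h1, fun h => h1 (bij_splitMono (splitEpi_bij hX hY h)), fun Z k l hk => ?_⟩
  by_cases hs : SplitMonoMap k
  · exact Or.inl hs
  right
  obtain ⟨k', hk'⟩ := hg.las Z k hs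
  have hk1 : ∀ x, k' (g x) = k x := fun x => LinearMap.congr_fun hk' x
  have hk2 : ∀ x, l (k x) = π (g x) := fun x => LinearMap.congr_fun hk x
  have hb := hg.min (LinearMap.id - ι.comp (π - l.comp k')) (by
    ext x
    simp [hk1, hk2])
  let e := LinearEquiv.ofBijective _ hb
  refine ⟨k'.comp (e.symm.toLinearMap.comp ι), ?_⟩
  ext y
  have h3 : ∀ x, l (k' x) = π (e x) := fun x => by
    show _ = π ((LinearMap.id - ι.comp (π - l.comp k') : E.M →ₗ[R] E.M) x)
    simp [h']
  simp [h3, h']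

lemma exists_pi {X W E : ModA R} (hX : X.IsIndec) (hW : W.IsIndec) (hn : ¬ W.Iso X)
    {ι : X.M →ₗ[R] E.M} {κ : W.M →ₗ[R] E.M} (h1 : SplitMonoMap ι) (h2 : SplitMonoMap κ) :
    ∃ π : E.M →ₗ[R] X.M, π.comp ι = LinearMap.id ∧ π.comp κ = 0 := by
  obtain ⟨r, hr⟩ := h1
  obtain ⟨r', hr'⟩ := h2
  have := hX.1
  have hrι : ∀ x, r (ι x) = x := fun x => LinearMap.congr_fun hr x
  have hrκ : ∀ x, r' (κ x) = x := fun x => LinearMap.congr_fun hr' x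
  let a : Module.End R X.M := (r.comp κ).comp (r'.comp ι)
  have ha : IsNilpotent a := (fitting hX a).resolve_right fun hb =>
    hn ⟨LinearEquiv.ofBijective _ (comp_bij hW hb).2⟩
  have hu := (unit_iff _).1 ha.isUnit_one_sub
  let e := LinearEquiv.ofBijective _ hu
  have he : ∀ x, e x = x - r (κ (r' (ι x))) := fun x => rfl
  refine ⟨e.symm.toLinearMap.comp (r - (r.comp κ).comp r'), ?_, ?_⟩
  · ext x
    simp only [LinearMap.comp_apply, LinearMap.sub_apply, LinearEquiv.coe_coe, LinearMap.id_apply]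
    rw [LinearEquiv.symm_apply_eq, he, hrι]
  · ext x
    simp [hrκ]

variable (K : Type u) [CommRing K] [IsArtinianRing K] [Algebra K R] [Module.Finite K R]

include K in
lemma sec_core {N X Y W : ModA R} (hX : X.IsIndec) (hY : Y.IsIndec) {f : X.M →ₗ[R] Y.M}
    {f' : W.M →ₗ[R] Y.M}
    (H : ∀ (E : ModA R) (g : E.M →ₗ[R] Y.M), RMAS g → ∃ (ι : X.M →ₗ[R] E.M) (κ : W.M →ₗ[R] E.M)
      (π : E.M →ₗ[R] X.M), g.comp ι = f ∧ g.comp κ = f' ∧ π.comp ι = LinearMap.id ∧ π.comp κ = 0)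
    {u : N.M →ₗ[R] X.M} (hu0 : u ≠ 0)
    (hu : ∀ s : AlmostSplitSeq R, s.r = Y → ∀ p : s.l.M →ₗ[R] X.M, IsIrred p →
      ∀ z : N.M →ₗ[R] s.l.M, u ≠ p.comp z) (w : N.M →ₗ[R] W.M) : f.comp u ≠ f'.comp w := by
  intro heq
  by_cases hp : Module.Projective R Y.M
  · obtain ⟨E, g, hg, hgi⟩ := proj_rmas hY hp
    obtain ⟨ι, κ, π, h1, h2, h3, h4⟩ := H E g hg
    apply hu0
    have h5 : ι.comp u = κ.comp w := by
      ext x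
      apply hgi
      have := LinearMap.congr_fun heq x
      rw [← h1, ← h2] at this
      exact this
    have h6 := congrArg (fun t => π.comp t) h5
    simp only [← LinearMap.comp_assoc, h3, h4] at h6
    simpa using h6
  · obtain ⟨s, rfl⟩ := exists_ar_right K Y hY hp
    obtain ⟨ι, κ, π, h1, h2, h3, h4⟩ := H _ _ (ass_rmas s)
    obtain ⟨z, hz⟩ := (ASS_ses s).lift (φ := ι.comp u - κ.comp w) (by
      rw [LinearMap.comp_sub, ← LinearMap.comp_assoc, ← LinearMap.comp_assoc, h1, h2, heq, sub_self])
    refine hu s rfl _ ((ass_lmas s).irr' s.l_indec hX h3) z ?_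
    rw [LinearMap.comp_assoc, hz, LinearMap.comp_sub, ← LinearMap.comp_assoc, ← LinearMap.comp_assoc,
      h3, h4]
    simp

/-- composites along a path -/
def cmp (X : ℕ → ModA R) (f : ∀ k, (X k).M →ₗ[R] (X (k + 1)).M) (a : ℕ) :
    ∀ m, (X a).M →ₗ[R] (X (a + m)).M
  | 0 => LinearMap.id
  | m + 1 => (f (a + m)).comp (cmp X f a m)

def upath (X : ℕ → ModA R) (f : ∀ k, (X k).M →ₗ[R] (X (k + 1)).M) :
    ∀ m, (X 0).M →ₗ[R] (X m).M
  | 0 => LinearMap.id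
  | m + 1 => (f m).comp (upath X f m)

lemma upath_add (X : ℕ → ModA R) (f : ∀ k, (X k).M →ₗ[R] (X (k + 1)).M) (a m : ℕ) :
    upath X f (a + m) = (cmp X f a m).comp (upath X f a) := by
  induction m with
  | zero => rfl
  | succ m ih =>
    show (f (a + m)).comp (upath X f (a + m)) = ((f (a + m)).comp (cmp X f a m)).comp _
    rw [ih, LinearMap.comp_assoc]

include K in
lemma sec_main (X : ℕ → ModA R) (hX : ∀ k, (X k).IsIndec) (f : ∀ k, (X k).M →ₗ[R] (X (k + 1)).M)
    (t : ℕ) (hf : ∀ k < t, IsIrred (f k))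
    (hs : ∀ k, k + 2 ≤ t → ¬ TauRel (vx (X k) (hX k)) (vx (X (k + 2)) (hX (k + 2)))) :
    upath X f t ≠ 0 := by
  have H : ∀ m, m + 1 ≤ t → upath X f (m + 1) ≠ 0 ∧ ∀ (W : ModA R), W.IsIndec → ¬ W.Iso (X m) →
      ∀ (f' : W.M →ₗ[R] (X (m + 1)).M), IsIrred f' → ∀ w : (X 0).M →ₗ[R] W.M,
      upath X f (m + 1) ≠ f'.comp w := by
    intro m
    induction m with
    | zero =>
      intro ht
      have h0 := hf 0 (by omega)
      have hu : upath X f (0 + 1) = f 0 := by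
        show (f 0).comp LinearMap.id = f 0
        simp
      refine ⟨by rw [hu]; exact irr_ne_zero (hX 0) (hX 1) h0, ?_⟩
      intro W hW hn f' hf' w h
      rw [hu] at h
      rcases h0.2.2 W w f' h.symm with h1 | h1
      · exact hn ⟨(LinearEquiv.ofBijective w (splitMono_bij (hX 0) hW h1)).symm⟩
      · exact hf'.2.1 h1
    | succ m ih =>
      intro ht
      obtain ⟨ih1, ih2⟩ := ih (by omega)
      have hfm := hf (m + 1) (by omega)
      have hu : ∀ s : AlmostSplitSeq R, s.r = X (m + 1 + 1) → ∀ p : s.l.M →ₗ[R] (X (m + 1)).M,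
          IsIrred p → ∀ z : (X 0).M →ₗ[R] s.l.M, upath X f (m + 1) ≠ p.comp z := by
        intro s hsr p hp z
        refine ih2 s.l s.l_indec (fun hiso => ?_) p hp z
        apply hs m (by omega)
        refine tau_iff.2 ⟨s, vx_eq.2 hiso, vx_eq.2 ?_⟩
        rw [hsr]
        exact ⟨LinearEquiv.refl R _⟩
      constructor
      · have := sec_core K (W := X (m + 1)) (hX (m + 1)) (hX (m + 1 + 1)) (f := f (m + 1)) (f' := 0) (fun E g hg => by
          obtain ⟨ι, hι⟩ := hg.ras _ _ hfm.2.1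
          obtain ⟨r, hr⟩ := (hfm.2.2 E ι g hι).resolve_right hg.ns
          exact ⟨ι, 0, r, hι, by simp, hr, by simp⟩) ih1 hu 0
        rw [LinearMap.zero_comp] at this
        exact this
      · intro W hW hn f' hf' w
        exact sec_core K (hX (m + 1)) (hX (m + 1 + 1)) (f := f (m + 1)) (f' := f') (fun E g hg => by
          obtain ⟨ι, hι⟩ := hg.ras _ _ hfm.2.1
          have h1 := (hfm.2.2 E ι g hι).resolve_right hg.ns
          obtain ⟨κ, hκ⟩ := hg.ras _ _ hf'.2.1
          have h2 := (hf'.2.2 E κ g hκ).resolve_right hg.ns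
          obtain ⟨π, hπ, hπ'⟩ := exists_pi (hX (m + 1)) hW hn h1 h2
          exact ⟨ι, κ, π, hι, hκ, hπ, hπ'⟩) ih1 hu w
  rcases t with _ | t
  · intro h
    have := (hX 0).1
    obtain ⟨x, hx⟩ := exists_ne (0 : (X 0).M)
    exact hx (LinearMap.congr_fun h x)
  · exact (H t le_rfl).1

lemma exists_path_maps (v : ℕ → ARVertex R) : ∃ (X : ℕ → ModA R) (hX : ∀ k, (X k).IsIndec)
    (f : ∀ k, (X k).M →ₗ[R] (X (k + 1)).M), (∀ k, vx (X k) (hX k) = v k) ∧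
    ∀ k, ARArrow (v k) (v (k + 1)) → IsIrred (f k) := by
  choose X hX hv using fun k => vx_surj (v k)
  have : ∀ k, ∃ f : (X k).M →ₗ[R] (X (k + 1)).M, ARArrow (v k) (v (k + 1)) → IsIrred f := by
    intro k
    by_cases h : ARArrow (v k) (v (k + 1))
    · have h' := h
      rw [← hv k, ← hv (k + 1)] at h
      obtain ⟨f, hf⟩ := arrow_iff.1 h
      exact ⟨f, fun _ => hf⟩
    · exact ⟨0, fun h' => absurd h' h⟩
  choose f hf using this
  exact ⟨X, hX, f, hv, hf⟩

include K in
lemma sec' (v : ℕ → ARVertex R) (t : ℕ) (h1 : ∀ k < t, ARArrow (v k) (v (k + 1)))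
    (h2 : ∀ k, k + 2 ≤ t → ¬ TauRel (v k) (v (k + 2))) : HomV (v 0) (v t) := by
  obtain ⟨X, hX, f, hv, hf⟩ := exists_path_maps v
  rw [← hv 0, ← hv t]
  exact homV_iff.2 ⟨_, sec_main K X hX f t (fun k hk => hf k (h1 k hk)) (fun k hk => by
    rw [hv, hv]; exact h2 k hk)⟩

lemma finite_End (M : Type u) [AddCommGroup M] [Module R M] [Module.Finite R M] [Module K M]
    [IsScalarTower K R M] : Module.Finite K (Module.End R M) := by
  have : Module.Finite K M := Module.Finite.trans R M
  have : IsNoetherianRing K := inferInstance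
  exact Module.Finite.of_injective
    ({ toFun := fun f => (f.restrictScalars K), map_add' := fun _ _ => rfl, map_smul' := fun _ _ => rfl } :
      Module.End R M →ₗ[K] Module.End K M) (fun f g h => by
      ext x; exact LinearMap.congr_fun h x)

include K in
lemma art_End (M : Type u) [AddCommGroup M] [Module R M] [Module.Finite R M] :
    IsArtinianRing (Module.End R M) := by
  let _ := kmod K (R := R) M
  have := ktower K (R := R) M
  have := finite_End K (R := R) M
  exact isArtinian_of_tower K inferInstance

lemma nonunit_jac {X : ModA R} (hX : X.IsIndec) {f : Module.End R X.M} (hf : ¬ Function.Bijective f) :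
    f ∈ Ring.jacobson (Module.End R X.M) := by
  rw [← Ideal.jacobson_bot, Ideal.mem_jacobson_iff]
  intro y
  have := hX.1
  have hn : IsNilpotent (y * f) := (fitting hX _).resolve_right fun hb => hf (comp_bij hX hb).1
  obtain ⟨z, hz⟩ := hn.isUnit_one_add
  refine ⟨↑z⁻¹, ?_⟩
  have h1 : (↑z⁻¹ : Module.End R X.M) * (1 + y * f) = 1 := by rw [← hz]; exact z.inv_mul
  rw [mul_add, mul_one, ← mul_assoc] at h1
  rw [Submodule.mem_bot, add_comm, h1, sub_self]

include K in
lemma per' (v : ℕ → ARVertex R) (n : ℕ) (hn : 0 < n) (hp : ∀ k, v (k + n) = v k)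
    (h1 : ∀ k, ARArrow (v k) (v (k + 1))) (h2 : ∀ k, ¬ TauRel (v k) (v (k + 2))) : False := by
  obtain ⟨X, hX, f, hv, hf⟩ := exists_path_maps v
  have hu : ∀ t, upath X f t ≠ 0 := fun t => sec_main K X hX f t (fun k _ => hf k (h1 k))
    (fun k _ => by rw [hv, hv]; exact h2 k)
  have hp2 : ∀ j, v (n * j) = v 0 := by
    intro j
    induction j with
    | zero => rfl
    | succ j ih => rw [mul_add, mul_one, hp, ih]
  have he : ∀ j, Nonempty ((X (n * j)).M ≃ₗ[R] (X 0).M) := fun j =>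
    vx_eq (hX := hX (n * j)) (hY := hX 0) |>.1 (by rw [hv, hv, hp2])
  let e : ∀ j, (X (n * j)).M ≃ₗ[R] (X 0).M := fun j => (he j).some
  have := art_End K (R := R) (X 0).M
  obtain ⟨N, hN⟩ := IsSemiprimaryRing.isNilpotent (R := Module.End R (X 0).M)
  let J : Ideal (Module.End R (X 0).M) := Ring.jacobson (Module.End R (X 0).M)
  have hN' : J ^ N = ⊥ := hN
  have key : ∀ j, ((e j).toLinearMap.comp (upath X f (n * j)) : Module.End R (X 0).M) ∈
      J ^ j := by
    intro j
    induction j with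
    | zero => rw [Submodule.pow_zero, Ideal.one_eq_top]; trivial
    | succ j ih =>
      have hps : J ^ (j + 1) = J * J ^ j := Ideal.IsTwoSided.pow_succ _
      rw [hps]
      have hnb : ¬ Function.Bijective (cmp X f (n * j) n) := by
        obtain ⟨m, rfl⟩ : ∃ m, n = m + 1 := ⟨n - 1, by omega⟩
        intro hb
        obtain ⟨s, hs⟩ := bij_splitEpi (X := X ((m + 1) * j)) (Y := X ((m + 1) * j + (m + 1))) hb
        exact (hf _ (h1 ((m + 1) * j + m))).2.1 ⟨(cmp X f ((m + 1) * j) m).comp s, hs⟩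
      have hj : ((e (j + 1)).toLinearMap.comp ((cmp X f (n * j) n).comp (e j).symm.toLinearMap)) ∈
          Ring.jacobson (Module.End R (X 0).M) := by
        refine nonunit_jac (hX 0) fun hb => hnb ?_
        have h3 : (cmp X f (n * j) n : (X (n * j)).M → (X (n * j + n)).M) =
          (e (j + 1)).symm ∘ ((e (j + 1)).toLinearMap.comp
            ((cmp X f (n * j) n).comp (e j).symm.toLinearMap)) ∘ (e j) := by
          funext x
          simp
        rw [h3]
        exact (e (j + 1)).symm.bijective.comp (hb.comp (e j).bijective)
      have := Ideal.mul_mem_mul (I := J) hj ih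
      convert this using 1
      ext x
      have h4 := LinearMap.congr_fun (upath_add X f (n * j) n) x
      show (e (j + 1)) (upath X f (n * j + n) x) = _
      rw [h4]
      simp
  have h5 := key N
  rw [hN'] at h5
  have h6 : (e N).toLinearMap.comp (upath X f (n * N)) = 0 := h5
  apply hu (n * N)
  ext x
  have := LinearMap.congr_fun h6 x
  simpa using this

end

end ARx

/-! ## Part 14: tau-rigid families are finite -/

namespace ARx

section
variable {R : Type u} [Ring R]

/-- `X` has no nonzero maps to the left end of `s` -/
def Tz (s : AlmostSplitSeq R) (X : ModA R) : Prop := ∀ g : X.M →ₗ[R] s.l.M, g = 0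

lemma Tz.quot {s : AlmostSplitSeq R} {X X' : ModA R} (h : Tz s X) (q : X.M →ₗ[R] X'.M)
    (hq : Function.Surjective q) : Tz s X' := by
  intro g
  ext y
  obtain ⟨x, rfl⟩ := hq y
  exact LinearMap.congr_fun (h (g.comp q)) x

lemma Tz.ext {s : AlmostSplitSeq R} {X W : ModA R} (h : Tz s X) {i : X.M →ₗ[R] W.M}
    {q : W.M →ₗ[R] s.r.M} (hs : SES i q) : SplitEpiMap q := by
  by_contra hns
  obtain ⟨a, ha⟩ := s.right_almost W q hns
  obtain ⟨b, hb⟩ := (ASS_ses s).lift (φ := a.comp i) (by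
    rw [← LinearMap.comp_assoc, ha]; exact hs.comp_zero)
  have hb0 : b = 0 := h b
  obtain ⟨c, hc⟩ := hs.desc (φ := a) (by rw [← hb, hb0, LinearMap.comp_zero])
  apply s.not_split
  refine ⟨c, ?_⟩
  ext y
  obtain ⟨w, rfl⟩ := hs.surj y
  have h1 := LinearMap.congr_fun hc w
  have h2 := LinearMap.congr_fun ha w
  simp only [LinearMap.comp_apply, LinearMap.id_apply] at *
  rw [h1, h2]

lemma Tz.extend {s : AlmostSplitSeq R} {X N P : ModA R} (h : Tz s X) {i : N.M →ₗ[R] P.M}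
    {p : P.M →ₗ[R] s.r.M} (hs : SES i p) (k : N.M →ₗ[R] X.M) :
    ∃ k' : P.M →ₗ[R] X.M, k'.comp i = k := by
  obtain ⟨W, i', q, j, hW, hqj, hji⟩ := hs.push k
  obtain ⟨r, hr⟩ := hW.splitMono (h.ext hW)
  refine ⟨r.comp j, ?_⟩
  rw [LinearMap.comp_assoc, hji, ← LinearMap.comp_assoc, hr, LinearMap.id_comp]

lemma ses_ker {P Y : ModA R} (p : P.M →ₗ[R] Y.M) (hp : Function.Surjective p) :
    SES (N := mkA R (LinearMap.ker p)) (LinearMap.ker p).subtype p :=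
  ⟨Submodule.subtype_injective _, hp, Submodule.range_subtype _⟩

lemma ses_quot {X : ModA R} (N : Submodule R X.M) :
    SES (N := mkA R N) (C := mkA R (X.M ⧸ N)) N.subtype N.mkQ :=
  ⟨Submodule.subtype_injective _, Submodule.mkQ_surjective _, by simp⟩

lemma exists_free [IsNoetherianRing R] [IsArtinianRing R] (Y : ModA R) :
    ∃ (P : ModA R) (π : P.M →ₗ[R] Y.M), Module.Projective R P.M ∧ Function.Surjective π := by
  obtain ⟨n, q, hq⟩ := Module.Finite.exists_fin' R Y.M
  exact ⟨mkA R (Fin n → R), q, by dsimp; infer_instance, hq⟩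

lemma exists_pcover [IsNoetherianRing R] [IsArtinianRing R] (Y : ModA R) :
    ∃ (P : ModA R) (π : P.M →ₗ[R] Y.M), Module.Projective R P.M ∧ Function.Surjective π ∧
      ∀ N : Submodule R P.M, N ⊔ LinearMap.ker π = ⊤ → N = ⊤ := by
  classical
  have hex : ∃ (l : ℕ) (P : ModA R) (π : P.M →ₗ[R] Y.M), Module.Projective R P.M ∧
      Function.Surjective π ∧ Module.length R P.M = l := by
    obtain ⟨P, π, h1, h2⟩ := exists_free Y
    have : Module.length R P.M ≠ ⊤ := Module.length_ne_top
    obtain ⟨l, hl⟩ := ENat.ne_top_iff_exists.1 this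
    exact ⟨l, P, π, h1, h2, hl.symm⟩
  obtain ⟨P, π, hP, hπ, hl⟩ := Nat.find_spec hex
  have hmin := fun m => Nat.find_min hex (m := m)
  refine ⟨P, π, hP, hπ, fun N hN => ?_⟩
  have hsN : Function.Surjective (π.comp N.subtype) := by
    intro y
    obtain ⟨x, rfl⟩ := hπ y
    have hx : x ∈ N ⊔ LinearMap.ker π := hN ▸ trivial
    obtain ⟨a, ha, b, hb, rfl⟩ := Submodule.mem_sup.1 hx
    refine ⟨⟨a, ha⟩, ?_⟩
    have : π b = 0 := hb
    simp [this]
  obtain ⟨t, ht⟩ := Module.projective_lifting_property (π.comp N.subtype) π hsN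
  let φ : Module.End R P.M := N.subtype.comp t
  have hφ : ∀ x, π (φ x) = π x := fun x => LinearMap.congr_fun ht x
  have hφn : ∀ (n : ℕ) x, π ((φ ^ n) x) = π x := by
    intro n
    induction n with
    | zero => intro x; rfl
    | succ n ih => intro x; rw [pow_succ, Module.End.mul_apply, ih, hφ]
  obtain ⟨n, hn1, hn⟩ := (((Filter.eventually_ge_atTop 1).and
    (LinearMap.eventually_isCompl_ker_pow_range_pow φ))).exists
  set Q := LinearMap.range (φ ^ n)
  have hQp : Module.Projective R Q :=
    Module.Projective.of_split Q.subtype (Q.projectionOnto _ hn.symm) (by ext x; simp)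
  have hQs : Function.Surjective (π.comp Q.subtype) := by
    intro y
    obtain ⟨x, rfl⟩ := hπ y
    exact ⟨⟨(φ ^ n) x, x, rfl⟩, hφn n x⟩
  have hQt : Q = ⊤ := by
    by_contra hne
    have hlt := Submodule.length_lt hne
    rw [hl] at hlt
    obtain ⟨m, hm⟩ := ENat.ne_top_iff_exists.1 (ne_top_of_lt hlt)
    rw [← hm] at hlt
    exact hmin m (by exact_mod_cast hlt) ⟨mkA R Q, π.comp Q.subtype, hQp, hQs, hm.symm⟩
  rw [eq_top_iff]
  intro x _
  have hx : x ∈ Q := hQt ▸ trivial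
  obtain ⟨y, rfl⟩ := hx
  obtain ⟨m, rfl⟩ : ∃ m, n = m + 1 := ⟨n - 1, by omega⟩
  rw [pow_succ', Module.End.mul_apply]
  exact (t ((φ ^ m) y)).2

lemma Tz.surj {s : AlmostSplitSeq R} {P0 P1 : ModA R} (hp0 : Module.Projective R P0.M)
    (p : P0.M →ₗ[R] s.r.M) (hp : Function.Surjective p)
    (π : P1.M →ₗ[R] LinearMap.ker p) (hπ : Function.Surjective π)
    (hsm : ∀ N : Submodule R P1.M, N ⊔ LinearMap.ker π = ⊤ → N = ⊤) {X : ModA R} (hX : Tz s X)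
    (h : P1.M →ₗ[R] X.M) : ∃ k : P0.M →ₗ[R] X.M, k.comp ((LinearMap.ker p).subtype.comp π) = h := by
  suffices H : ∀ (B : Submodule R X.M) (h : P1.M →ₗ[R] X.M), LinearMap.range h = B →
      ∃ k : P0.M →ₗ[R] X.M, k.comp ((LinearMap.ker p).subtype.comp π) = h from H _ h rfl
  intro B
  induction B using WellFoundedLT.induction with
  | ind B ih =>
  rintro h rfl
  by_cases h0 : h = 0
  · exact ⟨0, by rw [h0, LinearMap.zero_comp]⟩
  let N := (LinearMap.ker π).map h
  have hq : Tz s (mkA R (X.M ⧸ N)) := hX.quot N.mkQ N.mkQ_surjective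
  obtain ⟨ψ, hψ⟩ := factor_surj hπ (φ := N.mkQ.comp h) (fun x hx => by
    show N.mkQ (h x) = 0
    rw [Submodule.mkQ_apply, Submodule.Quotient.mk_eq_zero]
    exact ⟨x, hx, rfl⟩)
  obtain ⟨k', hk'⟩ := hq.extend (ses_ker p hp) ψ
  obtain ⟨k, hk⟩ := Module.projective_lifting_property N.mkQ k' N.mkQ_surjective
  have hle : LinearMap.range (h - k.comp ((LinearMap.ker p).subtype.comp π)) ≤ N := by
    rintro _ ⟨x, rfl⟩
    rw [← Submodule.Quotient.mk_eq_zero, ← Submodule.mkQ_apply, LinearMap.sub_apply, map_sub]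
    have h1 := LinearMap.congr_fun hψ x
    have h2 := LinearMap.congr_fun hk' (π x)
    have h3 := LinearMap.congr_fun hk (π x)
    simp only [LinearMap.comp_apply] at h1 h2 h3 ⊢
    rw [← h1, ← h2, sub_eq_zero]
    exact h3.symm
  have hlt : N < LinearMap.range h := by
    refine lt_of_le_of_ne (LinearMap.map_le_range) fun heq => h0 ?_
    have : LinearMap.ker h ⊔ LinearMap.ker π = ⊤ := by
      rw [eq_top_iff]
      intro x _
      have : h x ∈ N := heq ▸ ⟨x, rfl⟩
      obtain ⟨y, hy, hxy⟩ := this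
      rw [Submodule.mem_sup]
      exact ⟨x - y, by rw [LinearMap.mem_ker, map_sub, hxy, sub_self], y, hy, sub_add_cancel _ _⟩
    exact LinearMap.ker_eq_top.1 (hsm _ this)
  obtain ⟨k2, hk2⟩ := ih _ (hle.trans_lt hlt) _ rfl
  exact ⟨k + k2, by rw [LinearMap.add_comp, hk2]; abel⟩

/-! lengths of Hom -/

variable (K : Type u) [CommRing K] [IsArtinianRing K] [Algebra K R] [Module.Finite K R]

lemma finite_Hom (X Y : ModA R) :
    @Module.Finite K (X.M →ₗ[R] Y.M) _ _ (homKModule K R X.M Y.M) := by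
  let _ := homKModule K R X.M Y.M
  let _ := kmod K (R := R) X.M
  let _ := kmod K (R := R) Y.M
  have := ktower K (R := R) X.M
  have := ktower K (R := R) Y.M
  have : Module.Finite K X.M := Module.Finite.trans R X.M
  have : Module.Finite K Y.M := Module.Finite.trans R Y.M
  have : IsNoetherianRing K := inferInstance
  exact Module.Finite.of_injective
    ({ toFun := fun f => (f.restrictScalars K), map_add' := fun _ _ => rfl, map_smul' := fun _ _ => rfl } :
      (X.M →ₗ[R] Y.M) →ₗ[K] (X.M →ₗ[K] Y.M)) (fun f g h => by
      ext x; exact LinearMap.congr_fun h x)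

attribute [local instance] homKModule

omit [IsArtinianRing K] [Module.Finite K R] in
lemma hk_smul {X Y : ModA R} (k : K) (f : X.M →ₗ[R] Y.M) (x : X.M) :
    (k • f) x = algebraMap K R k • f x := rfl

/-- precomposition -/
def preK {X X' Y : ModA R} (a : X.M →ₗ[R] X'.M) :
    (X'.M →ₗ[R] Y.M) →ₗ[K] (X.M →ₗ[R] Y.M) where
  toFun f := f.comp a
  map_add' _ _ := rfl
  map_smul' _ _ := rfl

/-- postcomposition -/
def postK {X Y Y' : ModA R} (a : Y.M →ₗ[R] Y'.M) :
    (X.M →ₗ[R] Y.M) →ₗ[K] (X.M →ₗ[R] Y'.M) where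
  toFun f := a.comp f
  map_add' _ _ := LinearMap.comp_add _ _ _
  map_smul' k f := by
    ext x
    simp only [LinearMap.comp_apply, hk_smul, map_smul, RingHom.id_apply]

/-- K-length of Hom as rational -/
noncomputable def hl (X Y : ModA R) : ℚ := ((Module.length K (X.M →ₗ[R] Y.M)).toNat : ℚ)

lemma hl_nonneg (X Y : ModA R) : 0 ≤ hl K X Y := Nat.cast_nonneg _

lemma hl_top (X Y : ModA R) : Module.length K (X.M →ₗ[R] Y.M) ≠ ⊤ := by
  have := finite_Hom K X Y
  exact Module.length_ne_top

lemma hl_zero {X Y : ModA R} : hl K X Y = 0 ↔ ∀ f : X.M →ₗ[R] Y.M, f = 0 := by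
  unfold hl
  rw [Nat.cast_eq_zero, ENat.toNat_eq_zero]
  constructor
  · rintro (h | h) f
    · rw [Module.length_eq_zero_iff] at h
      exact Subsingleton.elim _ _
    · exact absurd h (hl_top K X Y)
  · intro h
    left
    rw [Module.length_eq_zero_iff]
    exact ⟨fun a b => (h a).trans (h b).symm⟩

lemma hl_add {X Y X' Y' X'' Y'' : ModA R} (a : (X.M →ₗ[R] Y.M) →ₗ[K] (X'.M →ₗ[R] Y'.M))
    (b : (X'.M →ₗ[R] Y'.M) →ₗ[K] (X''.M →ₗ[R] Y''.M)) (ha : Function.Injective a)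
    (hb : Function.Surjective b) (hab : Function.Exact a b) :
    hl K X' Y' = hl K X Y + hl K X'' Y'' := by
  unfold hl
  rw [Module.length_eq_add_of_exact a b ha hb hab, ENat.toNat_add (hl_top K _ _) (hl_top K _ _)]
  push_cast
  rfl

lemma hl_proj {P N M C : ModA R} (hP : Module.Projective R P.M) {f : N.M →ₗ[R] M.M}
    {g : M.M →ₗ[R] C.M} (h : SES f g) : hl K P M = hl K P N + hl K P C := by
  refine hl_add K (postK K f) (postK K g) (fun a b hab => ?_) (fun c => ?_) (fun c => ⟨fun hc => ?_, ?_⟩)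
  · ext x
    exact h.inj (LinearMap.congr_fun hab x)
  · obtain ⟨k, hk⟩ := Module.projective_lifting_property g c h.surj
    exact ⟨k, hk⟩
  · obtain ⟨k, hk⟩ := h.lift (φ := c) hc
    exact ⟨k, hk⟩
  · rintro ⟨k, rfl⟩
    ext x
    exact h.zero _

lemma hl_iso {X Y Y' : ModA R} (e : Y.M ≃ₗ[R] Y'.M) : hl K X Y = hl K X Y' := by
  unfold hl
  rw [(LinearEquiv.ofLinearMap (postK K (X := X) e.toLinearMap) (postK K e.symm.toLinearMap)
    (by ext f x; simp [postK]) (by ext f x; simp [postK])).length_eq]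

include K in
lemma Tz.pres (s : AlmostSplitSeq R) : ∃ P0 P1 : ModA R, Module.Projective R P0.M ∧
    Module.Projective R P1.M ∧ ∀ X, Tz s X → hl K P0 X = hl K s.r X + hl K P1 X := by
  have := noethR K (R := R)
  have := artR K (R := R)
  obtain ⟨P0, p, hp0, hp⟩ := exists_free s.r
  obtain ⟨P1, π, hp1, hπ, hsm⟩ := exists_pcover (mkA R (LinearMap.ker p))
  refine ⟨P0, P1, hp0, hp1, fun X hX => ?_⟩
  refine hl_add K (preK K p) (preK K ((LinearMap.ker p).subtype.comp π)) (fun a b hab => ?_)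
    (fun c => ?_) (fun c => ⟨fun hc => ?_, ?_⟩)
  · ext y
    obtain ⟨x, rfl⟩ := hp y
    exact LinearMap.congr_fun hab x
  · exact Tz.surj hp0 p hp π hπ hsm hX c
  · obtain ⟨k, hk⟩ := factor_surj hp (φ := c) (fun x hx => by
      obtain ⟨y, hy⟩ := hπ ⟨x, hx⟩
      have h1 := LinearMap.congr_fun hc y
      have h2 : c (π y : P0.M) = 0 := h1
      rw [hy] at h2
      exact h2)
    exact ⟨k, hk⟩
  · rintro ⟨k, rfl⟩
    ext x
    show k (p (π x : P0.M)) = 0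
    have : p (π x : P0.M) = 0 := (π x).2
    rw [this, map_zero]

end

end ARx

/-! ## Part 15: tau-rigid families are finite, conclusion -/

namespace ARx

section
variable {R : Type u} [Ring R]
variable (K : Type u) [CommRing K] [IsArtinianRing K] [Algebra K R] [Module.Finite K R]

lemma dep {n : ℕ} (S : Fin n → ModA R)
    (hS : ∀ (M : Type u) [AddCommGroup M] [Module R M], IsSimpleModule R M →
      ∃ i, Nonempty (M ≃ₗ[R] (S i).M)) (s : Fin (n + 1) → AlmostSplitSeq R) :
    ∃ a : Fin (n + 1) → ℚ, (∃ i, a i ≠ 0) ∧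
      ∀ X, (∀ k, Tz (s k) X) → ∑ i, a i * hl K (s i).r X = 0 := by
  choose P0 P1 h0 h1 h2 using fun i => Tz.pres K (s i)
  have hnl : ¬ LinearIndependent ℚ
      (fun i : Fin (n + 1) => (fun j : Fin n => hl K (P0 i) (S j) - hl K (P1 i) (S j))) := by
    intro h
    have := h.fintype_card_le_finrank
    simp at this
  rw [Fintype.not_linearIndependent_iff] at hnl
  obtain ⟨a, ha, hane⟩ := hnl
  refine ⟨a, hane, fun X hX => ?_⟩
  have ha' : ∀ j, ∑ i, a i * (hl K (P0 i) (S j) - hl K (P1 i) (S j)) = 0 := by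
    intro j
    have := congrFun ha j
    simpa using this
  have key : ∀ (M : Type u) [AddCommGroup M] [Module R M] (h : IsFiniteLength R M),
      ∑ i, a i * (hl K (P0 i) ⟨M, h⟩ - hl K (P1 i) ⟨M, h⟩) = 0 := by
    intro M _ _ h
    induction h with
    | of_subsingleton =>
      refine Finset.sum_eq_zero fun i _ => ?_
      rw [(hl_zero K).2, (hl_zero K).2, sub_zero, mul_zero]
      · intro f; ext x; exact Subsingleton.elim _ _
      · intro f; ext x; exact Subsingleton.elim _ _
    | @of_simple_quotient M _ _ N hs hN ih =>
      have hM := IsFiniteLength.of_simple_quotient hN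
      let X : ModA R := ⟨M, hM⟩
      obtain ⟨j, ⟨e⟩⟩ := hS (M ⧸ N) hs
      have hses := ses_quot (X := X) N
      have hadd : ∀ P : ModA R, Module.Projective R P.M → hl K P X = hl K P ⟨N, hN⟩ + hl K P (S j) := by
        intro P hP
        have h3 := hl_proj K hP hses
        rw [hl_iso K (Y := mkA R (M ⧸ N)) (Y' := S j) e] at h3
        exact h3
      have h4 : ∀ i, a i * (hl K (P0 i) X - hl K (P1 i) X) =
          a i * (hl K (P0 i) ⟨N, hN⟩ - hl K (P1 i) ⟨N, hN⟩) +
          a i * (hl K (P0 i) (S j) - hl K (P1 i) (S j)) := by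
        intro i
        rw [hadd _ (h0 i), hadd _ (h1 i)]
        ring
      rw [Finset.sum_congr rfl (fun i _ => h4 i), Finset.sum_add_distrib, ih, ha', add_zero]
  rw [← key X.M X.finLen]
  refine Finset.sum_congr rfl fun i _ => ?_
  have h5 := h2 i X (hX i)
  have h6 : hl K (P0 i) ⟨X.M, X.finLen⟩ - hl K (P1 i) ⟨X.M, X.finLen⟩ = hl K (s i).r X := by
    show hl K (P0 i) X - hl K (P1 i) X = hl K (s i).r X
    rw [h5]; ring
  rw [h6]

lemma jac_map {Y Y' : ModA R} (hY : Y.IsIndec) (hY' : Y'.IsIndec) (hne : ¬ Y.Iso Y')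
    (f : Y.M →ₗ[R] Y'.M) (Z : Type u) [AddCommGroup Z] [Module R Z] (i : Y'.M →ₗ[R] Z)
    (p : Z →ₗ[R] Y.M) : (i.comp (f.comp p) : Module.End R Z) ∈ Ring.jacobson (Module.End R Z) := by
  rw [← Ideal.jacobson_bot, Ideal.mem_jacobson_iff]
  intro y
  have := hY.1
  have := hY'.1
  let b : Z →ₗ[R] Y'.M := f.comp p
  let a : Y'.M →ₗ[R] Z := y.comp i
  have hn : IsNilpotent (f.comp (p.comp a) : Module.End R Y'.M) := by
    refine (fitting hY' _).resolve_right fun hb => hne ?_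
    exact ⟨LinearEquiv.ofBijective f (comp_bij hY hb).2⟩
  obtain ⟨z, hz⟩ := hn.isUnit_one_add
  let w : Module.End R Y'.M := ↑z⁻¹
  have h1 : w * (1 + f.comp (p.comp a)) = 1 := by rw [← hz]; exact z.inv_mul
  have h1' : ∀ x, w x + w (b (a x)) = x := by
    intro x
    have := LinearMap.congr_fun h1 x
    rw [Module.End.mul_apply, LinearMap.add_apply, map_add] at this
    exact this
  refine ⟨1 - a.comp (w.comp b), ?_⟩
  rw [Submodule.mem_bot]
  ext x
  have h2 := h1' (b x)
  show (a (b x) - a (w (b (a (b x))))) + (x - a (w (b x))) - x = 0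
  have h3 : a (w (b x)) + a (w (b (a (b x)))) = a (b x) := by rw [← map_add, h2]
  rw [sub_eq_of_eq_add h3.symm]
  abel

include K in
lemma no_gen {I : Type} [Fintype I] [DecidableEq I] (Y : I → ModA R) (hY : ∀ i, (Y i).IsIndec)
    (hne : ∀ i j, i ≠ j → ¬ (Y i).Iso (Y j)) (i0 : I)
    (h : ∀ i, Submodule.span R {x | ∃ j, j ≠ i ∧ ∃ (f : (Y j).M →ₗ[R] (Y i).M) (z : (Y j).M), f z = x}
      = ⊤) : False := by
  let Z := ∀ i, (Y i).M
  have := art_End K (R := R) Z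
  obtain ⟨N, hN⟩ := IsSemiprimaryRing.isNilpotent (R := Module.End R Z)
  let J : Ideal (Module.End R Z) := Ring.jacobson (Module.End R Z)
  have hN' : J ^ N = ⊥ := hN
  let Q : ℕ → Submodule R Z := fun k => Submodule.span R {x | ∃ g ∈ J ^ k, ∃ z : Z, g z = x}
  have hmem : ∀ i (y : (Y i).M), (LinearMap.single R (fun i => (Y i).M) i) y ∈
      Submodule.span R {x | ∃ g ∈ J, ∃ z : Z, g z = x} := by
    intro i y
    have hy : y ∈ Submodule.span R {x | ∃ j, j ≠ i ∧ ∃ (f : (Y j).M →ₗ[R] (Y i).M) (z : (Y j).M),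
      f z = x} := by rw [h i]; trivial
    induction hy using Submodule.span_induction with
    | mem x hx =>
      obtain ⟨j, hj, f, z, rfl⟩ := hx
      refine Submodule.subset_span ⟨(LinearMap.single R (fun i => (Y i).M) i).comp
        (f.comp (LinearMap.proj j)), jac_map (hY j) (hY i) (hne j i hj) f Z _ _,
        LinearMap.single R (fun i => (Y i).M) j z, ?_⟩
      have : (LinearMap.single R (fun i => (Y i).M) j z) j = z :=
        Pi.single_eq_same (M := fun i => (Y i).M) j z
      exact congrArg (fun w => LinearMap.single R (fun i => (Y i).M) i (f w)) this
    | zero => rw [map_zero]; exact zero_mem _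
    | add x y _ _ hx hy => rw [map_add]; exact add_mem hx hy
    | smul a x _ hx => rw [map_smul]; exact Submodule.smul_mem _ _ hx
  have hone : ∀ z : Z, z ∈ Submodule.span R {x | ∃ g ∈ J, ∃ z : Z, g z = x} := by
    intro z
    have : z = ∑ i, (LinearMap.single R (fun i => (Y i).M) i) (z i) := by
      simp only [LinearMap.coe_single]
      exact (Finset.univ_sum_single z).symm
    rw [this]
    exact sum_mem fun i _ => hmem i _
  have key : ∀ k, ∀ z : Z, z ∈ Q k := by
    intro k
    induction k with
    | zero =>
      intro z
      refine Submodule.subset_span ⟨1, ?_, z, rfl⟩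
      rw [Submodule.pow_zero, Ideal.one_eq_top]; trivial
    | succ k ih =>
      intro z
      have hps : J ^ (k + 1) = J * J ^ k := Ideal.IsTwoSided.pow_succ _
      have hz := hone z
      induction hz using Submodule.span_induction with
      | mem x hx =>
        obtain ⟨g, hg, z, rfl⟩ := hx
        have hz := ih z
        induction hz using Submodule.span_induction with
        | mem x hx =>
          obtain ⟨g', hg', z, rfl⟩ := hx
          refine Submodule.subset_span ⟨g * g', ?_, z, rfl⟩
          rw [hps]
          exact Ideal.mul_mem_mul hg hg'
        | zero => rw [map_zero]; exact zero_mem _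
        | add x y _ _ hx hy => rw [map_add]; exact add_mem hx hy
        | smul a x _ hx => rw [map_smul]; exact Submodule.smul_mem _ _ hx
      | zero => exact zero_mem _
      | add x y _ _ hx hy => exact add_mem hx hy
      | smul a x _ hx => exact Submodule.smul_mem _ _ hx
  have hz0 : ∀ z : Z, z = 0 := by
    intro z
    have hz := key N z
    have : Q N = ⊥ := by
      rw [Submodule.span_eq_bot]
      rintro x ⟨g, hg, z, rfl⟩
      rw [hN'] at hg
      have hg0 : g = 0 := hg
      rw [hg0]; rfl
    rw [this] at hz
    exact hz
  have := (hY i0).1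
  obtain ⟨y, hy⟩ := exists_ne (0 : (Y i0).M)
  apply hy
  have := congrFun (hz0 (LinearMap.single R (fun i => (Y i).M) i0 y)) i0
  exact (Pi.single_eq_same (M := fun i => (Y i).M) i0 y).symm.trans this

/-- one side of the sign argument -/
lemma half {m : ℕ} (s : Fin m → AlmostSplitSeq R) (hs : ∀ i j, Tz (s j) (s i).r)
    (a : Fin m → ℚ) (ha : ∀ X, (∀ k, Tz (s k) X) → ∑ i, a i * hl K (s i).r X = 0)
    (i : Fin m) (hi : 0 < a i) :
    Submodule.span R {x | ∃ j, a j < 0 ∧ ∃ (f : (s j).r.M →ₗ[R] (s i).r.M) (z : (s j).r.M), f z = x}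
      = ⊤ := by
  set G := {x | ∃ j, a j < 0 ∧ ∃ (f : (s j).r.M →ₗ[R] (s i).r.M) (z : (s j).r.M), f z = x} with hG
  set t := Submodule.span R G with ht
  have hf : ∀ j, a j < 0 → ∀ (f : (s j).r.M →ₗ[R] (s i).r.M) z, f z ∈ t := fun j hj f z =>
    Submodule.subset_span ⟨j, hj, f, z, rfl⟩
  have htT : ∀ k, Tz (s k) (mkA R t) := by
    intro k g
    have : ∀ x (hx : x ∈ t), g ⟨x, hx⟩ = 0 := by
      intro x hx
      induction hx using Submodule.span_induction with
      | mem x hx =>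
        obtain ⟨j, hj, f, z, rfl⟩ := hx
        exact LinearMap.congr_fun (hs j k (g.comp (f.codRestrict t (hf j hj f)))) z
      | zero => exact map_zero g
      | add x y hx' hy' hx hy =>
        have := map_add g ⟨x, hx'⟩ ⟨y, hy'⟩
        rw [hx, hy, add_zero] at this
        exact this
      | smul a x hx' hx =>
        have := map_smul g a ⟨x, hx'⟩
        rw [hx, smul_zero] at this
        exact this
    ext ⟨x, hx⟩
    exact this x hx
  let X := mkA R ((s i).r.M ⧸ t)
  have hXT : ∀ k, Tz (s k) X := fun k => (hs i k).quot t.mkQ t.mkQ_surjective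
  have hneg : ∀ j, a j < 0 → hl K (s j).r X = 0 := by
    intro j hj
    rw [hl_zero]
    intro g
    let E : Submodule R ((s i).r.M × (s j).r.M) :=
      LinearMap.eqLocus (t.mkQ.comp (LinearMap.fst R _ _)) (g.comp (LinearMap.snd R _ _))
    let ii : t →ₗ[R] E := (t.subtype.prod 0).codRestrict E (fun x => by
      show t.mkQ (x : (s i).r.M) = g 0
      rw [map_zero, Submodule.mkQ_apply, Submodule.Quotient.mk_eq_zero]
      exact x.2)
    let q : E →ₗ[R] (s j).r.M := (LinearMap.snd R _ _).comp E.subtype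
    have hses : SES (N := mkA R t) (M := mkA R E) (C := (s j).r) ii q := by
      refine ⟨fun x y hxy => ?_, fun y => ?_, ?_⟩
      · have := congrArg (fun w : E => w.1.1) hxy
        exact Subtype.ext this
      · obtain ⟨x, hx⟩ := t.mkQ_surjective (g y)
        exact ⟨⟨(x, y), hx⟩, rfl⟩
      · ext ⟨⟨x, y⟩, hxy⟩
        have hxy' : t.mkQ x = g y := hxy
        constructor
        · rintro ⟨z, hz⟩
          have := congrArg (fun w : E => w.1.2) hz
          exact this.symm
        · intro hy
          have hy' : y = 0 := hy
          subst hy'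
          rw [map_zero, Submodule.mkQ_apply, Submodule.Quotient.mk_eq_zero] at hxy'
          exact ⟨⟨x, hxy'⟩, rfl⟩
    obtain ⟨σ, hσ⟩ := (htT j).ext hses
    ext y
    have h5 : t.mkQ (σ y).1.1 = g (σ y).1.2 := (σ y).2
    have h6 : (σ y).1.2 = y := LinearMap.congr_fun hσ y
    rw [h6] at h5
    show g y = 0
    rw [← h5, Submodule.mkQ_apply, Submodule.Quotient.mk_eq_zero]
    exact hf j hj ((LinearMap.fst R _ _).comp (E.subtype.comp σ)) y
  have hsum := ha X hXT
  have hnn : ∀ k ∈ Finset.univ, 0 ≤ a k * hl K (s k).r X := by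
    intro k _
    rcases lt_or_ge (a k) 0 with h | h
    · rw [hneg k h, mul_zero]
    · exact mul_nonneg h (hl_nonneg K _ _)
  have h1 := (Finset.sum_eq_zero_iff_of_nonneg hnn).1 hsum i (Finset.mem_univ _)
  have h2 : hl K (s i).r X = 0 := (mul_eq_zero.1 h1).resolve_left hi.ne'
  rw [hl_zero] at h2
  have h3 := h2 t.mkQ
  have h4 := t.ker_mkQ
  rw [← h4, h3]
  exact LinearMap.ker_zero

include K in
lemma rigid1 (S : Set (ARVertex R)) (hp : ∀ y ∈ S, ¬ IsProjVertex y)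
    (h : ∀ x ∈ S, ∀ y ∈ S, ∀ z, TauRel z y → ¬ HomV x z) : S.Finite := by
  by_contra hinf
  obtain ⟨n, T, -, hT⟩ := exists_simples K (R := R)
  let e := Set.Infinite.natEmbedding S hinf
  have : ∀ i : Fin (n + 1), ∃ s : AlmostSplitSeq R, vx s.r s.r_indec = (e i).1 := by
    intro i
    obtain ⟨x, hx⟩ := tau_ex' K _ (hp _ (e i).2)
    obtain ⟨s, -, hs⟩ := tau_iff.1 hx
    exact ⟨s, hs⟩
  choose s hs using this
  have hTz : ∀ i j, Tz (s j) (s i).r := by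
    intro i j g
    by_contra hg
    refine h _ (e i).2 _ (e j).2 (vx (s j).l (s j).l_indec) (tau_iff.2 ⟨s j, rfl, hs j⟩) ?_
    rw [← hs i]
    exact homV_iff.2 ⟨g, hg⟩
  have hne : ∀ i j, i ≠ j → ¬ (s i).r.Iso (s j).r := by
    intro i j hij hiso
    have h1 : (e i).1 = (e j).1 := by
      rw [← hs i, ← hs j]; exact vx_eq.2 hiso
    have h2 := e.injective (Subtype.ext h1)
    exact hij (Fin.ext h2)
  obtain ⟨a, ⟨i0, hi0⟩, ha⟩ := dep K T hT s
  classical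
  have ha2 : ∀ X, (∀ k, Tz (s k) X) → ∑ i, (-a) i * hl K (s i).r X = 0 := by
    intro X hX
    simp only [Pi.neg_apply, neg_mul, Finset.sum_neg_distrib, ha X hX, neg_zero]
  refine no_gen K (I := {i // a i ≠ 0}) (fun i => (s i.1).r) (fun i => (s i.1).r_indec)
    (fun i j hij => hne _ _ fun hh => hij (Subtype.ext hh)) ⟨i0, hi0⟩ ?_
  rintro ⟨i, hi⟩
  rw [eq_top_iff]
  rcases lt_or_gt_of_ne hi with h1 | h1
  · rw [← half K s hTz (-a) ha2 i (by simpa using h1)]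
    refine Submodule.span_mono ?_
    rintro x ⟨j, hj, f, z, rfl⟩
    have hj' : 0 < a j := by simpa using hj
    exact ⟨⟨j, hj'.ne'⟩, fun hh => by
      have := congrArg Subtype.val hh
      simp only at this
      rw [this] at hj'
      exact lt_asymm hj' h1, f, z, rfl⟩
  · rw [← half K s hTz a ha i h1]
    refine Submodule.span_mono ?_
    rintro x ⟨j, hj', f, z, rfl⟩
    exact ⟨⟨j, hj'.ne⟩, fun hh => by
      have := congrArg Subtype.val hh
      simp only at this
      rw [this] at hj'
      exact lt_asymm hj' h1, f, z, rfl⟩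

include K in
lemma rigid2 (S : Set (ARVertex R)) (hp : ∀ y ∈ S, ¬ IsInjVertex y)
    (h : ∀ x ∈ S, ∀ y ∈ S, ∀ z, TauRel y z → ¬ HomV z x) : S.Finite := by
  have hf : {z | ∃ y ∈ S, TauRel y z}.Finite := by
    refine rigid1 K _ ?_ ?_
    · rintro z ⟨y, hy, hyz⟩
      exact tau_not_proj' hyz
    · rintro x ⟨x', hx', hx⟩ y ⟨y', hy', hy⟩ z hz
      have := tau_fun' hz hy
      subst this
      exact h _ hy' _ hx' _ hx
  rcases S.eq_empty_or_nonempty with rfl | ⟨y0, hy0⟩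
  · exact Set.finite_empty
  have : Nonempty (ARVertex R) := ⟨y0⟩
  choose! g hg using fun y (hy : y ∈ S) => taui_ex' K y (hp y hy)
  refine Set.Finite.of_injOn (f := g) (t := {z | ∃ y ∈ S, TauRel y z}) ?_ ?_ hf
  · intro y hy
    exact ⟨y, hy, hg y hy⟩
  · intro y hy y' hy' hyy
    have h1 := hg y hy
    rw [hyy] at h1
    exact tau_fun' h1 (hg y' hy')

end

end ARx

/-! ## Part 16: bridge -/

namespace ARx

open Relation

section
variable {V : Type*} {T : TQ V} {Γ : Set V}

lemma Ls_stable {x y : V} (hx : x ∈ T.Ls Γ)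
    (h : ReflTransGen (fun a b => T.Tau a b ∨ T.Tau b a) x y) : ¬ T.Proj y := by
  have key : ∃ v : ℕ → V, v 0 = y ∧ ∀ k, T.Tau (v (k + 1)) (v k) := by
    induction h with
    | refl =>
      refine ⟨fun k => (T.t)^[k] x, rfl, fun k => ?_⟩
      show T.Tau ((T.t)^[k + 1] x) ((T.t)^[k] x)
      rw [Function.iterate_succ_apply']
      exact T.t_spec (TQ.Ls_np (TQ.Ls_tk hx k))
    | @tail b c _ hbc ih =>
      obtain ⟨v, rfl, hv⟩ := ih
      rcases hbc with h | h
      · refine ⟨fun k => Nat.casesOn k c v, rfl, fun k => ?_⟩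
        cases k with
        | zero => exact h
        | succ k => exact hv k
      · exact ⟨fun k => v (k + 1), T.tau_fun (hv 0) h, fun k => hv (k + 1)⟩
  obtain ⟨v, rfl, hv⟩ := key
  exact T.tau_not_proj (hv 0)

lemma Out_comp {C S : Set V} (hO : T.Out Γ) (hsub : Γ ⊆ C)
    (hS : ∀ x, x ∈ S ↔ x ∈ C ∧ ¬∃ y, ReflTransGen (fun a b => T.Tau a b ∨ T.Tau b a) x y ∧ T.Proj y) :
    ∃ D : Set V, (D ⊆ S ∧ D.Nonempty ∧
      (∀ x ∈ D, ∀ y ∈ S, (T.Arrow x y ∨ T.Arrow y x) → y ∈ D) ∧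
      ∀ x ∈ D, ∀ y ∈ D, ReflTransGen (fun a b => a ∈ S ∧ b ∈ S ∧ (T.Arrow a b ∨ T.Arrow b a)) x y) ∧
      (∃ x ∈ D, TransGen (fun a b => a ∈ D ∧ b ∈ D ∧ T.Arrow a b) x x) ∧ (D ∩ Γ).Infinite := by
  obtain ⟨w, x, hinf, hw, hwx, hxx⟩ := hO
  have hLs : ∀ y, y ∈ T.Ls Γ → y ∈ S := fun y hy =>
    (hS y).2 ⟨hsub (TQ.Ls_sub hy), fun ⟨z, hz, hp⟩ => Ls_stable hy hz hp⟩
  let r : V → V → Prop := fun a b => a ∈ S ∧ b ∈ S ∧ (T.Arrow a b ∨ T.Arrow b a)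
  have hr : ∀ a b, T.SL Γ a b → r a b := fun a b h => ⟨hLs _ h.1, hLs _ h.2.1, h.2.2⟩
  have hsym : ∀ {a b}, ReflTransGen r a b → ReflTransGen r b a := by
    intro a b h
    induction h with
    | refl => exact .refl
    | tail _ h ih => exact .head ⟨h.2.1, h.1, h.2.2.symm⟩ ih
  let D : Set V := {y | ReflTransGen r w y}
  have hDS : D ⊆ S := by
    intro y hy
    rcases ReflTransGen.cases_tail hy with h | ⟨c, _, h⟩
    · rw [h]; exact hLs _ hw
    · exact h.2.1
  have hxD : x ∈ D := rtg_mono hr hwx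
  have hDL : ∀ a b, a ∈ D → T.AL Γ a b → b ∈ D := fun a b ha h =>
    ReflTransGen.tail ha (hr _ _ ⟨h.1, h.2.1, Or.inl h.2.2⟩)
  refine ⟨D, ⟨hDS, ⟨w, .refl⟩, fun x hx y hy h => ReflTransGen.tail hx ⟨hDS hx, hy, h⟩,
    fun x hx y hy => (hsym hx).trans hy⟩, ⟨x, hxD, ?_⟩, ?_⟩
  · have : ∀ y, TransGen (T.AL Γ) x y →
        y ∈ D ∧ TransGen (fun a b => a ∈ D ∧ b ∈ D ∧ T.Arrow a b) x y := by
      intro y hy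
      induction hy with
      | single h => exact ⟨hDL _ _ hxD h, .single ⟨hxD, hDL _ _ hxD h, h.2.2⟩⟩
      | tail _ h ih => exact ⟨hDL _ _ ih.1 h, .tail ih.2 ⟨ih.1, hDL _ _ ih.1 h, h.2.2⟩⟩
    exact (this x hxx).2
  · exact hinf.mono fun y hy => ⟨rtg_mono hr hy.1, hy.2⟩

end

section
variable {R : Type u} [Ring R]
variable (K : Type u) [CommRing K] [IsArtinianRing K] [Algebra K R] [Module.Finite K R]

include K in
lemma radPow_of_no_path {Y : ModA R} (hY : Y.IsIndec) (n : ℕ) : ∀ {X : ModA R} (hX : X.IsIndec),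
    ¬ ReflTransGen ARArrow (vx X hX) (vx Y hY) → ∀ f : X.M →ₗ[R] Y.M, f ∈ radPow R n X Y := by
  induction n with
  | zero => intro X hX _ f; exact AddSubgroup.mem_top _
  | succ n ih =>
    intro X hX hnp f
    have hf : ¬ SplitMonoMap f := fun h => hnp (by
      rw [(vx_eq (hX := hX) (hY := hY)).2 ⟨LinearEquiv.ofBijective f (splitMono_bij hX hY h)⟩])
    obtain ⟨E, g, hg⟩ := exists_lmas K X hX
    obtain ⟨h, hh⟩ := hg.las Y f hf
    obtain ⟨D⟩ := exists_dec E
    have hsum : f = ∑ i, (h.comp (D.ι i)).comp ((D.π i).comp g) := by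
      rw [← hh]
      ext x
      simp only [LinearMap.sum_apply, LinearMap.comp_apply]
      rw [← map_sum, D.total']
    rw [hsum]
    refine AddSubgroup.sum_mem _ fun i _ => AddSubgroup.subset_closure ?_
    refine ⟨D.Z i, (D.π i).comp g, h.comp (D.ι i), ?_, ?_, rfl⟩
    · intro Z hZ a b hb
      have := hZ.1
      have h1 := (comp_bij (D.indec i) hb).1
      have := (D.indec i).1
      have h3 : Function.Bijective
          (((D.π i).comp g).comp (a.comp (LinearEquiv.ofBijective _ h1).symm.toLinearMap)) := by
        have h4 : ((D.π i).comp g).comp (a.comp (LinearEquiv.ofBijective _ h1).symm.toLinearMap) =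
            LinearMap.id := by
          ext y
          exact (LinearEquiv.ofBijective _ h1).apply_symm_apply y
        rw [h4]; exact Function.bijective_id
      have h5 := (comp_bij hX h3).2
      obtain ⟨r, hr⟩ := bij_splitMono (X := X) (Y := D.Z i) h5
      exact hg.ns ⟨r.comp (D.π i), hr⟩
    · refine ih (D.indec i) (fun hp => hnp ?_) _
      exact ReflTransGen.head (arrow_iff.2 ⟨_, hg.irr hX D i⟩) hp

lemma rtg_ne {V : Type*} {r : V → V → Prop} {x y : V} (h : ReflTransGen r x y) :
    ReflTransGen (fun a b => r a b ∧ a ≠ b) x y := by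
  induction h with
  | refl => exact .refl
  | @tail b c _ h ih =>
    by_cases hbc : b = c
    · rw [← hbc]; exact ih
    · exact ih.tail ⟨h, hbc⟩

include K in
lemma cf_of {X0 : ModA R} (hX0 : X0.IsIndec) (hcf : IsCycleFiniteModule X0) {y z : ARVertex R}
    (h1 : ReflTransGen HomV (vx X0 hX0) y) (h2 : HomV y z) (hyz : y ≠ z)
    (h3 : ReflTransGen HomV z (vx X0 hX0)) : ReflTransGen ARArrow y z := by
  by_contra hno
  obtain ⟨n1, w1, a0, a1, a2⟩ := exists_path (rtg_ne h3)
  obtain ⟨n2, w2, b0, b1, b2⟩ := exists_path (rtg_ne h1)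
  let v : ℕ → ARVertex R := fun k => match k with
    | 0 => y
    | k + 1 => if k ≤ n1 then w1 k else w2 (k - n1)
  have hv : ∀ k < n1 + n2 + 1, HomV (v k) (v (k + 1)) ∧ v k ≠ v (k + 1) := by
    intro k hk
    cases k with
    | zero =>
      have : v 1 = z := by simp [v, a0]
      rw [this]
      exact ⟨h2, hyz⟩
    | succ k =>
      simp only [v]
      rcases lt_trichotomy k n1 with h | h | h
      · rw [if_pos h.le, if_pos (by omega)]
        exact a2 k h
      · rw [if_pos h.le, if_neg (by omega), h, a1, ← b0]
        have := b2 0 (by omega)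
        have e : n1 + 1 - n1 = 0 + 1 := by omega
        rw [e]
        exact this
      · rw [if_neg (by omega), if_neg (by omega)]
        have e : k + 1 - n1 = (k - n1) + 1 := by omega
        rw [e]
        exact b2 _ (by omega)
  have hlast : v (n1 + n2 + 1) = y := by
    simp only [v]
    split_ifs with h
    · have : n2 = 0 := by omega
      subst this
      rw [add_zero, a1, ← b1, b0]
    · have e : n1 + n2 - n1 = n2 := by omega
      rw [e, b1]
  choose X hX hXv using fun x : ARVertex R => vx_surj x
  have hhom : ∀ k, ∃ f : (X (v k)).M →ₗ[R] (X (v (k + 1))).M,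
      k < n1 + n2 + 1 → f ≠ 0 ∧ ¬ Function.Bijective f := by
    intro k
    by_cases hk : k < n1 + n2 + 1
    · obtain ⟨ha, hb⟩ := hv k hk
      rw [← hXv (v k), ← hXv (v (k + 1))] at ha
      obtain ⟨f, hf⟩ := homV_iff.1 ha
      refine ⟨f, fun _ => ⟨hf, fun hbij => hb ?_⟩⟩
      rw [← hXv (v k), ← hXv (v (k + 1))]
      exact vx_eq.2 ⟨LinearEquiv.ofBijective f hbij⟩
    · exact ⟨0, fun h => absurd h hk⟩
  choose f hf using hhom
  let c : ModCycle R :=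
    { len := n1 + n2 + 1
      len_pos := by omega
      obj := fun i => X (v i.1)
      obj_indec := fun i => hX _
      closed := by
        show X (v (n1 + n2 + 1)) = X (v 0)
        rw [hlast]
      hom := fun i => f i.1
      hom_ne_zero := fun i => (hf i.1 i.2).1
      hom_not_iso := fun i => (hf i.1 i.2).2 }
  have hpass : c.Passes X0 := by
    refine ⟨⟨n1 + 1, by show n1 + 1 < n1 + n2 + 1 + 1; omega⟩, ?_⟩
    show (X (v (n1 + 1))).Iso X0
    apply (vx_eq (hX := hX _) (hY := hX0)).1
    rw [hXv]
    simp [v, a1]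
  have := hcf.2 c hpass ⟨0, by show 0 < n1 + n2 + 1; omega⟩
  apply this
  intro n
  show f 0 ∈ radPow R n (X (v 0)) (X (v 1))
  refine radPow_of_no_path K (hX _) n (hX _) ?_ _
  rw [hXv, hXv]
  have : v 1 = z := by simp [v, a0]
  rw [this]
  exact hno

/-- the Auslander-Reiten quiver as an abstract translation quiver -/
def arTQ : TQ (ARVertex R) where
  Arrow := ARArrow
  Tau := TauRel
  Proj := IsProjVertex
  Inj := IsInjVertex
  hom := HomV
  tau_fun := tau_fun'
  tau_inj := tau_inj'
  tau_ex := tau_ex' K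
  taui_ex := taui_ex' K
  tau_not_proj := tau_not_proj'
  tau_not_inj := tau_not_inj'
  mesh_l := mesh_l'
  mesh_r := mesh_r'
  fin_succ := fin_succ' K
  fin_pred := fin_pred' K
  fin_proj := fin_proj' K
  fin_inj := fin_inj' K
  hom_of_arrow := hom_of_arrow'
  sec := sec' K
  per := per' K
  hom_pi := hom_pi'
  rigid := rigid1 K
  rigid' := rigid2 K

include K in
theorem final (Γ C : Set (ARVertex R)) (hΓ : IsCycleFiniteCyclicComponent Γ) (hinf : Γ.Infinite)
    (hsub : Γ ⊆ C) :
    ∃ D : Set (ARVertex R),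
      (IsComponentOf (leftStable C) D ∨ IsComponentOf (rightStable C) D) ∧
      (∃ x ∈ D, OnCycleIn D x) ∧ (D ∩ Γ).Infinite := by
  obtain ⟨⟨hs, -, hcl, hconn⟩, x0, hx0, ⟨X0, hX0⟩, hx0e, hcf⟩ := hΓ
  have hG : (arTQ (R := R) K).Good Γ := by
    refine TQ.good_of_comp (arTQ (R := R) K) hx0 ?_ (fun x hx => hs hx) (fun x hx y hy h => hcl x hx y hy h)
      (fun x hx y hy => hconn x hx y hy)
    intro y z h1 h2 hyz h3
    rw [← hx0e] at h1 h3
    exact cf_of K hX0 hcf h1 h2 hyz h3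
  rcases TQ.main hG hinf with hO | hO
  · obtain ⟨D, h1, h2, h3⟩ := Out_comp (S := leftStable C) hO hsub (fun x => Iff.rfl)
    exact ⟨D, Or.inl h1, h2, h3⟩
  · obtain ⟨D, ⟨h1, h1', hh3, hh4⟩, ⟨x, hx, h2⟩, h3⟩ := Out_comp (S := rightStable C) hO hsub (fun x => by
      have : ∀ y, TauConn x y ↔ ReflTransGen (fun a b => TauRel b a ∨ TauRel a b) x y := fun y =>
        ⟨rtg_mono fun _ _ h => h.symm, rtg_mono fun _ _ h => h.symm⟩
      show (x ∈ C ∧ ¬∃ y, TauConn x y ∧ IsInjVertex y) ↔ _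
      simp only [this]
      exact Iff.rfl)
    refine ⟨D, Or.inr ⟨h1, h1', fun x hx y hy h => hh3 x hx y hy h.symm, fun x hx y hy =>
      rtg_mono (fun _ _ h => ⟨h.1, h.2.1, h.2.2.symm⟩) (hh4 x hx y hy)⟩, ⟨x, hx, ?_⟩, h3⟩
    have h4 := transGen_swap.2 h2
    exact tg_mono (fun _ _ h => ⟨h.2.1, h.1, h.2.2⟩) h4

end

end ARx

/-- **Corollary.** Let `A` be a basic indecomposable artin algebra and `Γ` a cycle-finite
infinite connected component of `_cΓ_A`, lying in a component `C` of `Γ_A`. Then the left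
stable part or the right stable part of `C` admits a connected component `D` containing
an oriented cycle and infinitely many modules of `Γ`. -/
theorem infinite_cyclic_component_stable_part
    (K A : Type u) [CommRing K] [IsArtinianRing K] [Ring A] [Algebra K A]
    [Module.Finite K A] (hbasic : IsBasicAlgebra A) (hconn : IsConnectedAlgebra A)
    (Γ C : Set (ARVertex Aᵐᵒᵖ)) (hΓ : IsCycleFiniteCyclicComponent Γ) (hinf : Γ.Infinite)
    (hC : IsARComponent C) (hsub : Γ ⊆ C) :
    ∃ D : Set (ARVertex Aᵐᵒᵖ),
      (IsComponentOf (leftStable C) D ∨ IsComponentOf (rightStable C) D) ∧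
      (∃ x ∈ D, OnCycleIn D x) ∧ (D ∩ Γ).Infinite := by
  have : Module.Finite K Aᵐᵒᵖ := Module.Finite.equiv (MulOpposite.opLinearEquiv K)
  exact ARx.final (R := Aᵐᵒᵖ) K Γ C hΓ hinf hsub
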